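/- Let K = ℚ(i) and let E be any elliptic curve over K. Then for every quadratic extension L of K, the group E(L) has no subgroup of order 21 (equivalently, since every abelian group of order 21 is cyclic, E(L) has no point of order 21). -/

import Mathlib

open WeierstrassCurve WeierstrassCurve.Affine

/-- The `n`-torsion subgroup `G[n]` of an additive commutative group `G`. -/
def nTorsion (G : Type*) [AddCommGroup G] (n : ℕ) : AddSubgroup G where
  carrier := {x | n • x = 0}
  zero_mem' := by simp
  add_mem' := by
    intro a b ha hb
    simp only [Set.mem_setOf_eq, smul_add] at *
    rw [ha, hb, add_zero]
  neg_mem' := by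
    intro a ha
    simp only [Set.mem_setOf_eq, smul_neg] at *
    rw [ha, neg_zero]

/-- The `p`-primary torsion subgroup `G[p^∞]` of an additive commutative group `G`. -/
def pPrimary (G : Type*) [AddCommGroup G] (p : ℕ) : AddSubgroup G where
  carrier := {x | ∃ k : ℕ, p ^ k • x = 0}
  zero_mem' := ⟨0, by simp⟩
  add_mem' := by
    rintro a b ⟨m, hm⟩ ⟨n, hn⟩
    refine ⟨m + n, ?_⟩
    have h1 : (p ^ (m + n)) • a = 0 := by rw [pow_add, mul_comm, mul_smul, hm, smul_zero]
    have h2 : (p ^ (m + n)) • b = 0 := by rw [pow_add, mul_smul, hn, smul_zero]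
    rw [smul_add, h1, h2, add_zero]
  neg_mem' := by
    rintro a ⟨m, hm⟩
    exact ⟨m, by rw [smul_neg, hm, neg_zero]⟩

/-- The Weierstrass curve over `K` with short Weierstrass equation `y² = x³ + Ax + B`. -/
def shortW {K : Type*} [CommRing K] (A B : K) : WeierstrassCurve K :=
  ⟨0, 0, 0, A, B⟩

namespace S16

/-- A Euclidean-type division criterion for principal ideal rings. -/
theorem pid_of_div {R : Type*} [CommRing R] (f : R → ℕ) 
    (h : ∀ a b : R, b ≠ 0 → ∃ q, f (a - b * q) < f b) : IsPrincipalIdealRing R := by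
  refine ⟨fun I => ?_⟩
  by_cases hI : ∃ x ∈ I, x ≠ 0
  · classical
    have hex : ∃ n, ∃ x ∈ I, x ≠ 0 ∧ f x = n := by
      obtain ⟨x, hx, hx0⟩ := hI
      exact ⟨_, x, hx, hx0, rfl⟩
    obtain ⟨b, hb, hb0, hbn⟩ := Nat.find_spec hex
    refine ⟨b, le_antisymm ?_ ?_⟩
    · intro a ha
      obtain ⟨q, hq⟩ := h a b hb0
      have hr : a - b * q ∈ I := I.sub_mem ha (I.mul_mem_right _ hb)
      by_cases hr0 : a - b * q = 0
      · rw [sub_eq_zero] at hr0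
        exact Ideal.mem_span_singleton.2 ⟨q, hr0⟩
      · exact absurd ⟨_, hr, hr0, rfl⟩ (Nat.find_min hex (m := f (a - b*q)) (by omega))
    · exact (Ideal.span_singleton_le_iff_mem _).2 hb
  · push Not at hI
    refine ⟨0, ?_⟩
    ext x
    constructor
    · intro hx; rw [hI x hx]; simp
    · intro hx
      have : x = 0 := by simpa using hx
      rw [this]; exact I.zero_mem

/-- The Eisenstein integers. -/
abbrev Eis := QuadraticAlgebra ℤ (-1) (-1)

/-- The cube root of unity. -/
def w : Eis := ⟨0, 1⟩

open QuadraticAlgebra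

theorem w2 : w ^ 2 = -1 - w := by
  ext <;> simp [w, pow_two]

/-- norm on Eis -/
def nm (x : Eis) : ℤ := x.re ^ 2 - x.re * x.im + x.im ^ 2

theorem nm_mul (x y : Eis) : nm (x * y) = nm x * nm y := by
  simp [nm]; ring

theorem nm_nonneg (x : Eis) : 0 ≤ nm x := by
  unfold nm; nlinarith [sq_nonneg (x.re - x.im), sq_nonneg x.re, sq_nonneg x.im]

theorem nm_eq_zero {x : Eis} (h : nm x = 0) : x = 0 := by
  have h1 : x.re = 0 := by unfold nm at h; nlinarith [sq_nonneg (x.re - 2 * x.im), sq_nonneg x.re]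
  have h2 : x.im = 0 := by unfold nm at h; rw [h1] at h; simpa using h
  ext <;> simp [h1, h2]

theorem nm_pos {x : Eis} (h : x ≠ 0) : 0 < nm x :=
  lt_of_le_of_ne (nm_nonneg x) (fun h' => h (nm_eq_zero h'.symm))

theorem nm_zero : nm 0 = 0 := by simp [nm]
theorem nm_one : nm 1 = 1 := by simp [nm, QuadraticAlgebra.re_one, QuadraticAlgebra.im_one]
theorem nm_neg (x : Eis) : nm (-x) = nm x := by simp [nm]

instance : IsDomain Eis := by
  have : NoZeroDivisors Eis := ⟨by
    intro a b hab
    have := nm_mul a b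
    rw [hab, nm_zero] at this
    rcases mul_eq_zero.1 this.symm with h | h
    · exact Or.inl (nm_eq_zero h)
    · exact Or.inr (nm_eq_zero h)⟩
  exact NoZeroDivisors.to_isDomain _

/-- hexagonal rounding -/
theorem hex_round (s t : ℚ) : ∃ m n : ℤ, 
    (s - m) ^ 2 - (s - m) * (t - n) + (t - n) ^ 2 ≤ 1 / 3 := by
  have key : ∀ s t : ℚ, 0 ≤ t → t ≤ s → s ≤ 1 → ∃ m n : ℤ, 
    (s - m) ^ 2 - (s - m) * (t - n) + (t - n) ^ 2 ≤ 1 / 3 := by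
    intro s t h0 h1 h2
    by_contra! hc
    have e0 := hc 0 0
    have e1 := hc 1 0
    have e2 := hc 1 1
    push_cast at e0 e1 e2
    nlinarith [mul_nonneg (sub_nonneg.2 h2) (sub_nonneg.2 e0.le), mul_nonneg (sub_nonneg.2 h1) (sub_nonneg.2 e1.le), mul_nonneg h0 (sub_nonneg.2 e2.le), sq_nonneg (s - t - t), sq_nonneg (1 - s - t), sq_nonneg (1 - s - (s - t))]
  have a1 := Int.fract_nonneg s
  have a2 := (Int.fract_lt_one s).le
  have b1 := Int.fract_nonneg t
  have b2 := (Int.fract_lt_one t).le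
  rcases le_total (Int.fract t) (Int.fract s) with h | h
  · obtain ⟨m, n, hmn⟩ := key _ _ b1 h a2
    refine ⟨⌊s⌋ + m, ⌊t⌋ + n, ?_⟩
    unfold Int.fract at hmn
    push_cast
    convert hmn using 1; ring
  · obtain ⟨m, n, hmn⟩ := key _ _ a1 h b2
    refine ⟨⌊s⌋ + n, ⌊t⌋ + m, ?_⟩
    unfold Int.fract at hmn
    push_cast
    convert hmn using 1; ring

/-- division with small remainder in `Eis` -/
theorem eis_div (a b : Eis) (hb : b ≠ 0) : ∃ q, 3 * nm (a - b * q) ≤ nm b := by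
  have hD := nm_pos hb
  set c := a * star b with hc
  obtain ⟨m, n, hmn⟩ := hex_round (c.re / nm b) (c.im / nm b)
  refine ⟨⟨m, n⟩, ?_⟩
  have h1 : nm ((a - b * ⟨m, n⟩) * star b) = nm (a - b * ⟨m, n⟩) * nm b := by
    rw [nm_mul]; congr 1; simp [nm]; ring
  have h2 : nm ((a - b * ⟨m, n⟩) * star b) = 
      (c.re - m * nm b) ^ 2 - (c.re - m * nm b) * (c.im - n * nm b) + (c.im - n * nm b) ^ 2 := by
    have : (a - b * ⟨m, n⟩) * star b = c - ⟨m, n⟩ * ⟨nm b, 0⟩ := by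
      rw [hc]; ext <;> simp [nm] <;> ring
    rw [this]; simp [nm]
  have hDq : (0 : ℚ) < nm b := by exact_mod_cast hD
  have h3 : ((nm (a - b * ⟨m, n⟩) * nm b : ℤ) : ℚ) ≤ (nm b : ℚ) ^ 2 / 3 := by
    rw [← h1, h2]
    push_cast
    have : ((c.re : ℚ) - m * nm b) ^ 2 - (c.re - m * nm b) * (c.im - n * nm b) + (c.im - n * nm b) ^ 2
      = (nm b : ℚ) ^ 2 * (((c.re / nm b : ℚ) - m) ^ 2 - ((c.re / nm b : ℚ) - m) * ((c.im / nm b : ℚ) - n) + ((c.im / nm b : ℚ) - n) ^ 2) := by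
      field_simp
    rw [this]
    have := mul_le_mul_of_nonneg_left hmn (sq_nonneg (nm b : ℚ))
    linarith
  have h4 : 3 * nm (a - b * ⟨m, n⟩) * nm b ≤ nm b * nm b := by
    have : (3 * nm (a - b * ⟨m, n⟩) * nm b : ℚ) ≤ nm b * nm b := by
      push_cast at h3; linarith
    exact_mod_cast this
  exact le_of_mul_le_mul_right h4 hD

instance : IsPrincipalIdealRing Eis := pid_of_div (fun x => (nm x).toNat) (by
  intro a b hb
  obtain ⟨q, hq⟩ := eis_div a b hb
  refine ⟨q, ?_⟩
  have := nm_pos hb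
  have := nm_nonneg (a - b * q)
  beta_reduce
  omega)

theorem isUnit_iff_nm {x : Eis} : IsUnit x ↔ nm x = 1 := by
  constructor
  · rintro ⟨u, rfl⟩
    have h : nm (u : Eis) * nm ((u⁻¹ : Eisˣ) : Eis) = 1 := by rw [← nm_mul, Units.mul_inv, nm_one]
    have h1 := nm_nonneg (u : Eis)
    exact Int.eq_one_of_mul_eq_one_right h1 h
  · intro h
    refine IsUnit.of_mul_eq_one (star x) ?_
    unfold nm at h
    ext
    · simp [QuadraticAlgebra.re_one]; linarith
    · simp [QuadraticAlgebra.im_one]; ring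

theorem unit_cases {x : Eis} (h : nm x = 1) : 
    x = 1 ∨ x = -1 ∨ x = w ∨ x = -w ∨ x = w ^ 2 ∨ x = - w ^ 2 := by
  rw [w2]
  obtain ⟨a, b⟩ := x
  simp only [nm] at h
  have ha : -1 ≤ a ∧ a ≤ 1 := by constructor <;> nlinarith [sq_nonneg (a - 2 * b)]
  have hb : -1 ≤ b ∧ b ≤ 1 := by constructor <;> nlinarith [sq_nonneg (2 * a - b)]
  obtain ⟨ha1, ha2⟩ := ha
  obtain ⟨hb1, hb2⟩ := hb
  interval_cases a <;> interval_cases b <;> simp_all [QuadraticAlgebra.ext_iff, w, QuadraticAlgebra.re_one, QuadraticAlgebra.im_one]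

end S16

namespace S16
open QuadraticAlgebra

theorem w_re : w.re = 0 := rfl
theorem w_im : w.im = 1 := rfl
theorem nm_w : nm w = 1 := by simp [nm, w]

/-- The quadratic extension ring of Eis generated by a root of t^2 = w t - 1. -/
abbrev OR := QuadraticAlgebra Eis (-1) w

/-- relative norm -/
def nR (z : OR) : Eis := z.re ^ 2 + w * z.re * z.im + z.im ^ 2

theorem nR_mul (x y : OR) : nR (x * y) = nR x * nR y := by
  simp only [nR, re_mul, im_mul]
  ring

theorem nR_one : nR 1 = 1 := by simp [nR, QuadraticAlgebra.re_one, QuadraticAlgebra.im_one]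
theorem nR_zero : nR 0 = 0 := by simp [nR]

theorem sq21 {n m : ℤ} (h : n ^ 2 = 21 * m ^ 2) : m = 0 := by
  by_contra hm
  have h1 : m ^ 2 ∣ n ^ 2 := ⟨21, by rw [h]; ring⟩
  obtain ⟨k, rfl⟩ := (Int.pow_dvd_pow_iff two_ne_zero).1 h1
  have h2 : k ^ 2 = 21 := by
    have : m ^ 2 ≠ 0 := pow_ne_zero _ hm
    apply mul_left_cancel₀ this
    linarith [h]
  have h3 : k ≤ 4 := by nlinarith
  have h4 : -4 ≤ k := by nlinarith
  interval_cases k <;> omega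

theorem nR_eq_zero {z : OR} (h : nR z = 0) : z = 0 := by
  have h1 : (2 * z.re + w * z.im) ^ 2 = (w ^ 2 - 4) * z.im ^ 2 := by
    unfold nR at h
    linear_combination 4 * h
  have h2 := congrArg nm h1
  have h3 : nm (w ^ 2 - 4) = 21 := by
    rw [w2]; decide
  simp only [pow_two (2 * z.re + w * z.im), pow_two z.im, nm_mul, h3] at h2
  have h4 : z.im = 0 := nm_eq_zero (sq21 (n := nm (2 * z.re + w * z.im)) (by linarith))
  unfold nR at h
  rw [h4] at h
  have h5 : z.re = 0 := by simpa using h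
  ext1 
  · simpa using h5
  · simpa using h4

instance : IsDomain OR := by
  have : NoZeroDivisors OR := ⟨by
    intro a b hab
    have := nR_mul a b
    rw [hab, nR_zero] at this
    rcases mul_eq_zero.1 this.symm with h | h
    · exact Or.inl (nR_eq_zero h)
    · exact Or.inr (nR_eq_zero h)⟩
  exact NoZeroDivisors.to_isDomain _

theorem quad_aux (A B p q : ℤ) (hA : 0 ≤ A) (hB : 0 ≤ B) (h : p ^ 2 - p * q + q ^ 2 = A * B) :
    8 * (2 * ((A - B) ^ 2 + 5 * A * B - 3 * q ^ 2) - (A + B) * (2 * p - q) + 3 * (A - B) * q) ≤ 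
    27 * (A ^ 2 + B ^ 2) + 58 * (A * B) := by
  have h1 : -(2 * p - q) ≤ A + B := by
    have : (2 * p - q) ^ 2 ≤ (A + B) ^ 2 := by nlinarith [sq_nonneg q, sq_nonneg (A - B)]
    exact (abs_le_of_sq_le_sq' this (by omega)).1 |> fun h => by linarith
  nlinarith [mul_nonneg (add_nonneg hA hB) (sub_nonneg.2 h1), sq_nonneg (4 * q - (A - B))]

theorem nm_quad_le (x y : Eis) : 16 * nm (x ^ 2 + w * x * y + y ^ 2) ≤
    27 * (nm x ^ 2 + nm y ^ 2) + 58 * (nm x * nm y) := by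
  obtain ⟨a, b⟩ := x
  obtain ⟨c, d⟩ := y
  have e := quad_aux (nm ⟨a, b⟩) (nm ⟨c, d⟩) (a * c - a * d + b * d) (b * c - a * d) (nm_nonneg _)
    (nm_nonneg _) (by simp only [nm]; ring)
  refine le_trans (le_of_eq ?_) e
  simp [nm, w, pow_two]
  ring

instance : IsPrincipalIdealRing OR := pid_of_div (fun x => (nm (nR x)).toNat) (by
  intro a b hb
  have hD : nR b ≠ 0 := fun h => hb (nR_eq_zero h)
  set c : OR := a * ⟨b.re + w * b.im, - b.im⟩ with hc
  obtain ⟨q1, h1⟩ := eis_div c.re (nR b) hD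
  obtain ⟨q2, h2⟩ := eis_div c.im (nR b) hD
  refine ⟨⟨q1, q2⟩, ?_⟩
  have e1 : (a - b * ⟨q1, q2⟩) * ⟨b.re + w * b.im, - b.im⟩ = (⟨c.re - nR b * q1, c.im - nR b * q2⟩ : OR) := by
    rw [hc]
    ext1
    · simp only [re_mul, im_mul, re_sub, im_sub, nR]; ring
    · simp only [re_mul, im_mul, re_sub, im_sub, nR]; ring
  have e2 := congrArg nR e1
  rw [nR_mul] at e2
  have e3 : nR (⟨b.re + w * b.im, - b.im⟩ : OR) = nR b := by simp only [nR]; ring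
  have e4 := congrArg nm e2
  rw [e3, nm_mul] at e4
  have e5 := nm_quad_le (c.re - nR b * q1) (c.im - nR b * q2)
  have hM := nm_pos hD
  change nm (nR (a - b * ⟨q1, q2⟩)) * nm (nR b) = nm ((c.re - nR b * q1) ^ 2 + w * (c.re - nR b * q1) * (c.im - nR b * q2) + (c.im - nR b * q2) ^ 2) at e4
  rw [← e4] at e5
  have n1 := nm_nonneg (c.re - nR b * q1)
  have n2 := nm_nonneg (c.im - nR b * q2)
  generalize nm (c.re - nR b * q1) = A at *
  generalize nm (c.im - nR b * q2) = B at *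
  have n3 := nm_nonneg (nR (a - b * ⟨q1, q2⟩))
  generalize nm (nR (a - b * ⟨q1, q2⟩)) = V at *
  generalize nm (nR b) = M at *
  have i1 : 9 * A ^ 2 ≤ M ^ 2 := by nlinarith
  have i2 : 9 * B ^ 2 ≤ M ^ 2 := by nlinarith
  have i3 : 9 * (A * B) ≤ M ^ 2 := by nlinarith
  have : V < M := by
    by_contra! hh
    nlinarith [mul_le_mul_of_nonneg_right hh hM.le]
  omega)

/-- unit generator -/
def ph : ORˣ := ⟨⟨0, 1⟩, ⟨w, -1⟩, by decide, by decide⟩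

theorem nR_unit {z : OR} (h : IsUnit z) : nm (nR z) = 1 := by
  obtain ⟨u, rfl⟩ := h
  apply isUnit_iff_nm.1
  refine IsUnit.of_mul_eq_one (nR ((u⁻¹ : ORˣ) : OR)) ?_
  rw [← nR_mul, Units.mul_inv, nR_one]

theorem desc_aux (x y u : Eis) (hx : x ≠ 0) (hu : nm u = 1) (h : x ^ 2 + w * x * y + y ^ 2 = u)
    (hlt : nm x < nm y) : nm (y + w * x) < nm y := by
  have hy : 0 < nm y := lt_of_le_of_lt (nm_nonneg _) hlt
  have h1 : y * (y + w * x) = u - x ^ 2 := by linear_combination h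
  have h2 := congrArg nm h1
  rw [nm_mul] at h2
  have star_mul_self : ∀ z : Eis, z * star z = ⟨nm z, 0⟩ := by
    intro z; ext <;> simp [nm] <;> ring
  obtain ⟨t, ht⟩ : ∃ t : Eis, t = star u * x ^ 2 := ⟨_, rfl⟩
  have nms : ∀ z : Eis, nm (star z) = nm z := by intro z; simp [nm]; ring
  have ht1 : nm t = nm x ^ 2 := by rw [ht, nm_mul, nms, hu, pow_two x, nm_mul]; ring
  have hus : star u * u = 1 := by
    rw [mul_comm, star_mul_self, hu]; rfl
  have h3 : nm (u - x ^ 2) = 1 + nm x ^ 2 - (2 * t.re - t.im) := by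
    have : nm (star u * (u - x ^ 2)) = nm (1 - t) := by rw [mul_sub, hus, ht]
    rw [nm_mul, nms, hu, one_mul] at this
    rw [this, ← ht1]
    simp [nm, QuadraticAlgebra.re_one, QuadraticAlgebra.im_one]; ring
  have hn := nm_pos hx
  have h4 : (2 * t.re - t.im) ^ 2 + 3 * t.im ^ 2 = (2 * nm x) ^ 2 := by
    have : nm x ^ 2 = t.re ^ 2 - t.re * t.im + t.im ^ 2 := by rw [← ht1]; rfl
    linear_combination -4 * this
  have h5 : - (2 * nm x) ≤ 2 * t.re - t.im := by
    have : (2 * t.re - t.im) ^ 2 ≤ (2 * nm x) ^ 2 := by nlinarith [sq_nonneg t.im]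
    exact (abs_le_of_sq_le_sq' this (by omega)).1
  by_contra! hge
  have h6 : nm y * nm y ≤ nm y * nm (y + w * x) := mul_le_mul_of_nonneg_left hge hy.le
  have h7 : nm y * nm y ≤ (nm x + 1) * (nm x + 1) := by nlinarith
  have h8 : nm y = nm x + 1 := by nlinarith
  have h9 : 2 * t.re - t.im = - (2 * nm x) := by rw [h8] at h6; nlinarith
  have h10 : t.im = 0 := by rw [h9] at h4; nlinarith
  have h11 : t = ⟨-nm x, 0⟩ := by
    ext
    · simp only; rw [h10] at h9; linarith
    · simp only; exact h10
  have hx2 : x ^ 2 = - (u * (x * star x)) := by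
    have : u * (star u * x ^ 2) = u * t := by rw [ht]
    rw [← mul_assoc, mul_comm u, hus, one_mul, h11] at this
    rw [this, star_mul_self, ← mul_neg]
    congr 1
  have hxs : x = - (u * star x) := by
    apply mul_left_cancel₀ hx
    linear_combination hx2
  have hyn : y ≠ 0 := by rintro rfl; rw [nm_zero] at hy; exact lt_irrefl _ hy
  have hys : y + w * x = u * star y := by
    apply mul_left_cancel₀ hyn
    rw [h1, hx2]
    have : (y * star y : Eis) = x * star x + 1 := by
      rw [star_mul_self, star_mul_self, h8]; ext <;> simp [QuadraticAlgebra.re_one, QuadraticAlgebra.im_one]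
    linear_combination u * (-this)
  have h12 := congrArg star hys
  have sw : star w = -1 - w := by ext <;> simp [w, QuadraticAlgebra.re_one, QuadraticAlgebra.im_one]
  simp only [star_add, star_mul, star_star, sw] at h12
  have h13 : (2 * w + 1) * x = 0 := by
    linear_combination hys + u * h12 + y * hus + (1 + w) * hxs
  rcases mul_eq_zero.1 h13 with h | h
  · have := congrArg QuadraticAlgebra.im h
    have h2 : ((2 * w + 1 : Eis)).im = 2 := by decide
    rw [h2] at this
    exact absurd this (by decide)
  · exact hx h

theorem eq_aux (x y u : Eis) (hx : x ≠ 0) (hu : nm u = 1) (h : x ^ 2 + w * x * y + y ^ 2 = u)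
    (he : nm x = nm y) : y + w * x = 0 ∨ x + w * y = 0 := by
  have hn := nm_pos hx
  have star_mul_self : ∀ z : Eis, z * star z = ⟨nm z, 0⟩ := by
    intro z; ext <;> simp [nm] <;> ring
  have nms : ∀ z : Eis, nm (star z) = nm z := by intro z; simp [nm]; ring
  obtain ⟨s, hs⟩ : ∃ s : ℤ, x * star y + star x * y = ⟨s, 0⟩ := by
    refine ⟨(x * star y + star x * y).re, ?_⟩
    ext
    · rfl
    · simp; ring
  have h1 : (⟨nm x, 0⟩ : Eis) * ⟨s, nm x⟩ = u * (star x * star y) := by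
    have e1 := star_mul_self x
    have e2 := star_mul_self y
    rw [← he] at e2
    have e3 : (⟨s, nm x⟩ : Eis) = ⟨s, 0⟩ + w * ⟨nm x, 0⟩ := by
      ext <;> simp [w]
    rw [e3, ← h, ← hs]
    generalize (⟨nm x, 0⟩ : Eis) = N at *
    linear_combination -(x * star y) * e1 - star x * y * e2 - w * (y * star y * e1 + N * e2)
  have h2 := congrArg nm h1
  simp only [nm_mul, nms, hu, ← he] at h2
  have h3 : nm (⟨s, nm x⟩ : Eis) = 1 := by
    have e : nm (⟨nm x, 0⟩ : Eis) = nm x * nm x := by simp [nm]; ring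
    rw [e] at h2
    have : nm x * nm x ≠ 0 := by positivity
    apply mul_left_cancel₀ this
    linarith
  have h4 : nm x = 1 := by
    generalize nm x = n at *
    simp only [nm] at h3
    nlinarith [sq_nonneg (2 * s - n)]
  rw [h4] at he
  rw [← h] at hu
  clear h h1 h2 h3 hn hs star_mul_self nms
  rcases unit_cases h4 with rfl | rfl | rfl | rfl | rfl | rfl <;>
  rcases unit_cases he.symm with rfl | rfl | rfl | rfl | rfl | rfl <;>
  first
  | exact Or.inl (by decide)
  | exact Or.inr (by decide)
  | exact absurd hu (by decide)

theorem unit_form (n : ℕ) : ∀ z : OR, nm (nR z) = 1 → (nm z.re + nm z.im).toNat ≤ n → 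
    ∃ u : Eis, nm u = 1 ∧ ∃ j : ℤ, z = ⟨u, 0⟩ * ((ph ^ j : ORˣ) : OR) := by
  induction n using Nat.strong_induction_on with
  | _ n ih =>
  intro z hz hn
  have p1 := nm_nonneg z.re
  have p2 := nm_nonneg z.im
  -- multiplication steps
  have stepdown : ∀ z' : OR, (∃ u : Eis, nm u = 1 ∧ ∃ j : ℤ, z' = ⟨u, 0⟩ * ((ph ^ j : ORˣ) : OR)) →
      ∀ k : ℤ, z' = z * ((ph ^ k : ORˣ) : OR) → 
      (∃ u : Eis, nm u = 1 ∧ ∃ j : ℤ, z = ⟨u, 0⟩ * ((ph ^ j : ORˣ) : OR)) := by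
    rintro z' ⟨u, hu, j, hj⟩ k hk
    refine ⟨u, hu, j - k, ?_⟩
    rw [zpow_sub, Units.val_mul, ← mul_assoc, ← hj, hk, mul_assoc, ← Units.val_mul]
    simp
  have m1 : z * ((ph ^ (1 : ℤ) : ORˣ) : OR) = ⟨-z.im, z.re + w * z.im⟩ := by
    rw [zpow_one]; ext1 <;> simp [ph]
  have m2 : z * ((ph ^ (-1 : ℤ) : ORˣ) : OR) = ⟨w * z.re + z.im, -z.re⟩ := by
    rw [zpow_neg_one]; ext1 <;> simp [ph] <;> ring
  have hN1 : nR (⟨-z.im, z.re + w * z.im⟩ : OR) = nR z := by simp only [nR]; ring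
  have hN2 : nR (⟨w * z.re + z.im, -z.re⟩ : OR) = nR z := by simp only [nR]; ring
  have base1 : z.im = 0 → ∃ u : Eis, nm u = 1 ∧ ∃ j : ℤ, z = ⟨u, 0⟩ * ((ph ^ j : ORˣ) : OR) := by
    intro h0
    refine ⟨z.re, ?_, 0, ?_⟩
    · have : nR z = z.re * z.re := by simp only [nR, h0]; ring
      rw [this, nm_mul] at hz
      nlinarith
    · simp only [zpow_zero, Units.val_one, mul_one]
      ext1
      · rfl
      · exact h0
  by_cases hx : z.re = 0
  · refine ⟨z.im, ?_, 1, ?_⟩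
    · have : nR z = z.im * z.im := by simp only [nR, hx]; ring
      rw [this, nm_mul] at hz
      nlinarith
    · rw [zpow_one]; ext1
      · simp [ph, hx]
      · simp [ph]
  by_cases hy : z.im = 0
  · exact base1 hy
  have q1 := nm_pos hx
  have q2 := nm_pos hy
  rcases lt_trichotomy (nm z.re) (nm z.im) with h | h | h
  · have := desc_aux z.re z.im (nR z) hx hz rfl h
    refine stepdown _ (ih _ ?_ ⟨w * z.re + z.im, -z.re⟩ (by rw [hN2]; exact hz) le_rfl) (-1) m2.symm
    simp only [nm_neg]
    rw [add_comm (w * z.re)]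
    omega
  · rcases eq_aux z.re z.im (nR z) hx hz rfl h with h' | h'
    · refine stepdown _ (ih _ ?_ ⟨w * z.re + z.im, -z.re⟩ (by rw [hN2]; exact hz) le_rfl) (-1) m2.symm
      simp only [nm_neg]
      rw [add_comm (w * z.re), h', nm_zero]
      omega
    · refine stepdown _ (ih _ ?_ ⟨-z.im, z.re + w * z.im⟩ (by rw [hN1]; exact hz) le_rfl) 1 m1.symm
      simp only [nm_neg]
      rw [h', nm_zero]
      omega
  · have := desc_aux z.im z.re (nR z) hy hz (by simp only [nR]; ring) h
    refine stepdown _ (ih _ ?_ ⟨-z.im, z.re + w * z.im⟩ (by rw [hN1]; exact hz) le_rfl) 1 m1.symm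
    simp only [nm_neg]
    omega

theorem w3 : w ^ 3 = 1 := by decide

/-- units modulo cubes -/
theorem unit_mod_cubes (z : OR) (hz : IsUnit z) : ∃ i < 3, ∃ j < 3, ∃ g : OR, 
    z = ⟨w ^ i, 0⟩ * (ph : OR) ^ j * g ^ 3 := by
  obtain ⟨u, hu, j, hj⟩ := unit_form _ z (nR_unit hz) le_rfl
  have h1 : ∃ i < 3, ∃ s : Eis, u = w ^ i * s ^ 3 := by
    rcases unit_cases hu with h | h | h | h | h | h
    · exact ⟨0, by norm_num, 1, by rw [h]; decide⟩
    · exact ⟨0, by norm_num, -1, by rw [h]; decide⟩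
    · exact ⟨1, by norm_num, 1, by rw [h]; decide⟩
    · exact ⟨1, by norm_num, -1, by rw [h]; decide⟩
    · exact ⟨2, by norm_num, 1, by rw [h]; decide⟩
    · exact ⟨2, by norm_num, -1, by rw [h]; decide⟩
  obtain ⟨i, hi, s, hs⟩ := h1
  refine ⟨i, hi, (j % 3).toNat, by omega, ⟨s, 0⟩ * ((ph ^ (j / 3) : ORˣ) : OR), ?_⟩
  rw [hj, hs]
  have e1 : (ph ^ j : ORˣ) = ph ^ (j % 3).toNat * (ph ^ (j / 3)) ^ 3 := by
    rw [← zpow_natCast, ← zpow_natCast, ← zpow_mul, ← zpow_add]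
    congr 1
    have := Int.emod_add_mul_ediv j 3
    push_cast
    omega
  have e2 : (⟨w ^ i * s ^ 3, 0⟩ : OR) = ⟨w ^ i, 0⟩ * ⟨s, 0⟩ ^ 3 := by
    simp only [pow_succ, pow_zero, one_mul]
    ext1 <;> simp
  rw [e1, e2]
  push_cast
  ring

end S16

namespace S16
open QuadraticAlgebra

theorem red {R : Type*} [CommRing R] [IsDomain R] [IsPrincipalIdealRing R] (n d : R) (hd : d ≠ 0) :
    ∃ g n1 d1, n = g * n1 ∧ d = g * d1 ∧ IsCoprime n1 d1 ∧ g ≠ 0 ∧ d1 ≠ 0 := by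
  obtain ⟨n1, h1⟩ := IsBezout.gcd_dvd_left n d
  obtain ⟨d1, h2⟩ := IsBezout.gcd_dvd_right n d
  obtain ⟨a, b, h3⟩ := IsBezout.gcd_eq_sum n d
  have hg : IsBezout.gcd n d ≠ 0 := by
    intro h; rw [h, zero_mul] at h2; exact hd h2
  refine ⟨IsBezout.gcd n d, n1, d1, h1, h2, ⟨a, b, ?_⟩, hg, ?_⟩
  · apply mul_left_cancel₀ hg
    linear_combination h3 - a * h1 - b * h2
  · rintro rfl; rw [mul_zero] at h2; exact hd h2

theorem denom {R : Type*} [CommRing R] [IsDomain R] [IsPrincipalIdealRing R] (c1 c2 c3 n d r s : R)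
    (hc3 : IsUnit c3) (hd : d ≠ 0) (hs : s ≠ 0) 
    (h : (r ^ 2 + c1 * r * s + c2 * s ^ 2) * d ^ 3 = c3 * n ^ 3 * s ^ 2) :
    ∃ a b e, e ≠ 0 ∧ IsCoprime a e ∧ IsCoprime b e ∧ a * d = n * e ^ 2 ∧ b * s = r * e ^ 3 ∧
      b ^ 2 + c1 * b * e ^ 3 + c2 * e ^ 6 = c3 * a ^ 3 := by
  obtain ⟨g, n1, d1, rfl, rfl, hnd, hg, hd1⟩ := red n d hd
  obtain ⟨k, r1, s1, rfl, rfl, hrs, hk, hs1⟩ := red r s hs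
  have h1 : (r1 ^ 2 + c1 * r1 * s1 + c2 * s1 ^ 2) * d1 ^ 3 = c3 * n1 ^ 3 * s1 ^ 2 := by
    apply mul_left_cancel₀ (mul_ne_zero (pow_ne_zero 3 hg) (pow_ne_zero 2 hk))
    linear_combination h
  have cop1 : IsCoprime (s1 ^ 2) (r1 ^ 2 + c1 * r1 * s1 + c2 * s1 ^ 2) := by
    apply IsCoprime.pow_left
    have : IsCoprime s1 (r1 ^ 2 + s1 * (c1 * r1 + c2 * s1)) := 
      (IsCoprime.add_mul_left_right (hrs.symm.pow_right (n := 2)) _)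
    convert this using 1; ring
  have d1s : s1 ^ 2 ∣ d1 ^ 3 := cop1.dvd_of_dvd_mul_left ⟨c3 * n1 ^ 3, by rw [h1]; ring⟩
  have cop2 : IsCoprime (d1 ^ 3) (c3 * n1 ^ 3) := 
    (isCoprime_mul_unit_left_right hc3 _ _).2 (hnd.symm.pow)
  have sd : d1 ^ 3 ∣ s1 ^ 2 := cop2.dvd_of_dvd_mul_left ⟨r1 ^ 2 + c1 * r1 * s1 + c2 * s1 ^ 2, by rw [← h1]; ring⟩
  have hds : d1 ∣ s1 := by
    rw [← IsIntegrallyClosed.pow_dvd_pow_iff two_ne_zero]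
    exact dvd_trans ⟨d1, by ring⟩ sd
  obtain ⟨e, rfl⟩ := hds
  have hass : Associated (d1 ^ 3) ((d1 * e) ^ 2) := associated_of_dvd_dvd sd d1s
  obtain ⟨u, hu⟩ := hass
  have he2 : e ^ 2 = u * d1 := by
    apply mul_left_cancel₀ (pow_ne_zero 2 hd1)
    linear_combination -hu
  have he0 : e ≠ 0 := right_ne_zero_of_mul hs1
  refine ⟨u * n1, u * r1, e, he0, ?_, ?_, ?_, ?_, ?_⟩
  · rw [isCoprime_mul_unit_left_left u.isUnit]
    have : IsCoprime n1 (e ^ 2) := by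
      rw [he2, isCoprime_mul_unit_left_right u.isUnit]; exact hnd
    exact (IsCoprime.pow_right_iff two_pos).1 this
  · rw [isCoprime_mul_unit_left_left u.isUnit]
    exact hrs.of_mul_right_right
  · linear_combination -g * n1 * he2
  · linear_combination -k * r1 * e * he2
  · apply mul_left_cancel₀ (pow_ne_zero 3 hd1)
    have e3 : e ^ 3 = u * (d1 * e) := by linear_combination e * he2
    have e6 : e ^ 6 = u ^ 2 * (d1 * e) ^ 2 := by linear_combination (e ^ 3 + u * (d1 * e)) * e3
    rw [e3, e6]
    linear_combination (u : R) ^ 2 * h1 + c3 * n1 ^ 3 * u ^ 2 * d1 ^ 2 * he2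

/-- reduction modulo the prime above 3 -/
def ch : Eis →+* ZMod 3 where
  toFun x := (x.re + x.im : ℤ)
  map_zero' := by simp
  map_one' := by simp [QuadraticAlgebra.re_one, QuadraticAlgebra.im_one]
  map_add' x y := by simp; ring
  map_mul' x y := by 
    have h3 : (3 : ZMod 3) = 0 := rfl
    simp
    linear_combination (-(x.im : ZMod 3) * y.im) * h3

theorem ch_apply (x : Eis) : ch x = ((x.re + x.im : ℤ) : ZMod 3) := rfl

/-- the prime above 3 -/
def lam : Eis := 1 + 2 * w
theorem lam_sq : lam ^ 2 = -3 := by decide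
theorem ch_w : ch w = 1 := by decide
theorem ch_lam : ch lam = 0 := by decide

theorem ch_eq_zero {x : Eis} : ch x = 0 ↔ lam ∣ x := by
  constructor
  · intro h
    rw [ch_apply, ZMod.intCast_zmod_eq_zero_iff_dvd _ 3 |>.trans Iff.rfl] at h
    obtain ⟨k, hk⟩ := h
    refine ⟨⟨2 * k - x.re, k - x.re⟩ , ?_⟩
    obtain ⟨a, b⟩ := x
    simp only at hk
    have hb : b = 3 * k - a := by push_cast at hk; linarith
    subst hb
    ext <;> simp [lam, w, QuadraticAlgebra.re_one, QuadraticAlgebra.im_one] <;> ring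
  · rintro ⟨y, rfl⟩
    rw [map_mul, ch_lam, zero_mul]

theorem lam_ne : lam ≠ 0 := by decide

theorem lam_prime : Prime lam := by
  refine ⟨lam_ne, ?_, ?_⟩
  · intro h
    have := h.map ch
    rw [ch_lam] at this
    exact absurd this (by decide)
  · intro a b hab
    rw [← ch_eq_zero, ← ch_eq_zero]
    rw [← ch_eq_zero, map_mul] at hab
    exact mul_eq_zero.1 hab

theorem lam_pow_eq {s t : ℕ} {u v : Eis} (h : lam ^ s * u = lam ^ t * v) (hu : ch u ≠ 0) (hv : ch v ≠ 0) :
    s = t := by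
  have aux : ∀ {s t : ℕ} {u v : Eis}, lam ^ s * u = lam ^ t * v → ch u ≠ 0 → ¬ s < t := by
    intro s t u v h hu hst
    obtain ⟨k, rfl⟩ := Nat.exists_eq_add_of_lt hst
    have : u = lam * (lam ^ k * v) := by
      apply mul_left_cancel₀ (pow_ne_zero s lam_ne)
      rw [h]; ring
    rw [this, map_mul, ch_lam, zero_mul] at hu
    exact hu rfl
  rcases lt_trichotomy s t with h1 | h1 | h1
  · exact absurd h1 (aux h hu)
  · exact h1
  · exact absurd h1 (aux h.symm hv)

theorem lam_factor {x : Eis} (hx : x ≠ 0) : ∃ n x0, ch x0 ≠ 0 ∧ x = lam ^ n * x0 := by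
  obtain ⟨n, x0, h0, h⟩ := WfDvdMonoid.max_power_factor' hx lam_prime.not_isUnit
  exact ⟨n, x0, fun h' => h0 (ch_eq_zero.1 h'), h⟩

theorem coprime_lam {x : Eis} (hx : ch x ≠ 0) : IsCoprime x lam := by
  rw [isCoprime_comm]
  rw [(lam_prime.irreducible).coprime_iff_not_dvd]
  exact fun h => hx (ch_eq_zero.2 h)

theorem ch_cube (t : Eis) (ht : ch t ≠ 0) : ∃ ε : ℤ, (ε = 1 ∨ ε = -1) ∧ (ch t = (ε : ZMod 3)) ∧ ∃ k : Eis, t = (ε : Eis) + lam * k := by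
  have h : ch t = 1 ∨ ch t = -1 := by
    generalize ch t = c at *
    revert c; decide
  rcases h with h | h
  · have : lam ∣ t - 1 := by rw [← ch_eq_zero, map_sub, h, map_one, sub_self]
    obtain ⟨k, hk⟩ := this
    exact ⟨1, Or.inl rfl, by simp [h], k, by push_cast; linear_combination hk⟩
  · have : lam ∣ t + 1 := by rw [← ch_eq_zero, map_add, h, map_one]; decide
    obtain ⟨k, hk⟩ := this
    exact ⟨-1, Or.inr rfl, by simp [h], k, by push_cast; linear_combination hk⟩

end S16

namespace S16
open QuadraticAlgebra

theorem ph_val : (ph : OR) = ⟨0, 1⟩ := rfl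

theorem ph_sq : (ph : OR) ^ 2 = ⟨-1, w⟩ := by decide
theorem cube3 (z : OR) : z ^ 3 = z * z * z := by ring

/-- the factorisation step -/
theorem stepD (δ : Eis) (i : ℕ) (hi : i < 3) (a b e : Eis) 
    (ha : ch a ≠ 0) (hb : ch b ≠ 0)
    (heq : b ^ 2 + lam * δ * b * e ^ 3 + w * lam ^ 2 * δ ^ 2 * e ^ 6 = -(w ^ (2 * i)) * a ^ 3)
    (hcop : IsCoprime a (2 * b + lam * δ * e ^ 3)) :
    ∃ x y : Eis, b = w ^ i * (x ^ 3 - 3 * x * y ^ 2 - w * y ^ 3) ∧ 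
      δ * e ^ 3 = w ^ (i + 2) * (y * (y ^ 2 - lam * x * y - lam * w ^ 2 * x ^ 2)) := by
  have hw := w2
  have hw3 := w3
  obtain ⟨A, hA⟩ : ∃ A : OR, A = ⟨b, lam * δ * w ^ 2 * e ^ 3⟩ := ⟨_, rfl⟩
  obtain ⟨A', hA'⟩ : ∃ A' : OR, A' = ⟨b + lam * δ * e ^ 3, - (lam * δ * w ^ 2 * e ^ 3)⟩ := ⟨_, rfl⟩
  have hunit : (-(w ^ i)) * (-(w ^ (2 * i))) = (1 : Eis) := by
    have : (w ^ 3) ^ i = 1 := by rw [hw3, one_pow]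
    rw [← pow_mul] at this
    rw [neg_mul_neg, ← pow_add, ← this]; congr 1; ring
  have hprod : A * (⟨-(w ^ i), 0⟩ * A') = ⟨a, 0⟩ ^ 3 := by
    rw [hA, hA', cube3]
    ext1
    · simp only [re_mul, im_mul]
      linear_combination (-(w ^ i)) * heq + a ^ 3 * hunit - w ^ i * (lam ^ 2 * δ ^ 2 * e ^ 6 * w) * hw3
    · simp only [re_mul, im_mul]
      linear_combination w ^ i * (lam ^ 2 * δ ^ 2 * e ^ 6 * w ^ 2) * hw3
  have hcopA : IsCoprime A (⟨-(w ^ i), 0⟩ * A') := by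
    have hc3 : IsCoprime (a ^ 3) (2 * b + lam * δ * e ^ 3) := hcop.pow_left
    obtain ⟨u, v, huv⟩ := hc3
    refine ⟨⟨u, 0⟩ * ⟨-(w ^ i), 0⟩ * A' + ⟨v, 0⟩, ⟨v, 0⟩ * ⟨-(w ^ (2 * i)), 0⟩, ?_⟩
    have e1 : (⟨-(w ^ (2 * i)), 0⟩ : OR) * ⟨-(w ^ i), 0⟩ = 1 := by
      ext1
      · simp only [re_mul, im_mul, QuadraticAlgebra.re_one]; linear_combination hunit
      · simp only [re_mul, im_mul, QuadraticAlgebra.im_one]; ring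
    have e2 : (⟨u, 0⟩ : OR) * ⟨a, 0⟩ ^ 3 + ⟨v, 0⟩ * (A + A') = 1 := by
      rw [hA, hA', cube3]
      ext1
      · simp only [re_mul, im_mul, re_add, im_add, QuadraticAlgebra.re_one]; linear_combination huv
      · simp only [re_mul, im_mul, re_add, im_add, QuadraticAlgebra.im_one]; ring
    rw [← hprod] at e2
    linear_combination e2 + ⟨v, 0⟩ * A' * e1
  obtain ⟨g, ε, hg⟩ := exists_associated_pow_of_mul_eq_pow' hcopA hprod
  obtain ⟨i', hi', j, hj, g', hε⟩ := unit_mod_cubes ε ε.isUnit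
  obtain ⟨⟨x, y⟩, hγ⟩ : ∃ γ : OR, γ = g * g' := ⟨_, rfl⟩
  have hmain : A = ⟨w ^ i', 0⟩ * (ph : OR) ^ j * ⟨x, y⟩ ^ 3 := by
    rw [hγ, ← hg, hε]; ring
  have hcube : (⟨x, y⟩ : OR) ^ 3 = ⟨x ^ 3 - 3 * x * y ^ 2 - w * y ^ 3, 3 * x ^ 2 * y + 3 * w * x * y ^ 2 + (w ^ 2 - 1) * y ^ 3⟩ := by
    rw [pow_succ, pow_two]
    ext1
    · simp only [re_mul, im_mul]; ring
    · simp only [re_mul, im_mul]; ring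
  have ch3 : ch 3 = 0 := by decide
  have hj0 : j = 0 := by
    rw [hcube, hA] at hmain
    interval_cases j
    · rfl
    · exfalso
      rw [pow_one, ph_val] at hmain
      have r := congrArg (fun z => ch z.re) hmain
      have m := congrArg (fun z => ch z.im) hmain
      simp only [re_mul, im_mul, map_mul, map_add, map_sub, map_pow, ch_w, ch_lam, ch3, map_neg, map_one, map_zero] at r m
      generalize ch b = b at *
      generalize ch x = x at *
      generalize ch y = y at *
      apply hb; rw [r]
      ring_nf at m ⊢
      try linear_combination -m
    · exfalso
      rw [ph_sq] at hmain
      have r := congrArg (fun z => ch z.re) hmain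
      have m := congrArg (fun z => ch z.im) hmain
      simp only [re_mul, im_mul, map_mul, map_add, map_sub, map_pow, ch_w, ch_lam, ch3, map_neg, map_one, map_zero] at r m
      generalize ch b = b at *
      generalize ch x = x at *
      generalize ch y = y at *
      apply hb; rw [r]
      ring_nf at m ⊢
      linear_combination m
  subst hj0
  have hnorm := congrArg nR hmain
  have hNA : nR A = -(w ^ (2 * i)) * a ^ 3 := by
    rw [hA, ← heq]; simp only [nR]
    linear_combination (lam * δ * b * e ^ 3 + lam ^ 2 * δ ^ 2 * e ^ 6 * w) * hw3
  obtain ⟨G, hG⟩ : ∃ G, G = nR (⟨x, y⟩ : OR) := ⟨_, rfl⟩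
  have hNr : nR (⟨w ^ i', 0⟩ * (ph : OR) ^ 0 * ⟨x, y⟩ ^ 3) = w ^ (2 * i') * G ^ 3 := by
    rw [hG, pow_zero, mul_one, nR_mul]
    have : nR (⟨x, y⟩ ^ 3 : OR) = nR ⟨x, y⟩ ^ 3 := by
      rw [pow_succ, pow_two, nR_mul, nR_mul]; ring
    rw [this]
    congr 1
    simp only [nR]; ring
  rw [hNA, hNr] at hnorm
  have hii : i' = i := by
    have ha0 : a ≠ 0 := by rintro rfl; exact ha (map_zero _)
    have wu : IsUnit w := isUnit_iff_nm.2 nm_w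
    have d1 : G ^ 3 ∣ a ^ 3 := by
      have : G ^ 3 ∣ -(w ^ (2 * i)) * a ^ 3 := by rw [hnorm]; exact Dvd.intro_left _ rfl
      rwa [IsUnit.dvd_mul_left (wu.pow _).neg] at this
    have d2 := (IsIntegrallyClosed.pow_dvd_pow_iff three_ne_zero).1 d1
    obtain ⟨k, rfl⟩ := d2
    have hG0 : G ≠ 0 := left_ne_zero_of_mul ha0
    have hk : -(w ^ (2 * i)) * k ^ 3 = w ^ (2 * i') := by
      apply mul_left_cancel₀ (pow_ne_zero 3 hG0)
      linear_combination hnorm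
    have hku : nm k = 1 := by
      rw [← isUnit_iff_nm]
      have : IsUnit (-(w ^ (2 * i)) * k ^ 3) := by rw [hk]; exact wu.pow _
      exact (isUnit_pow_iff three_ne_zero).1 (isUnit_of_mul_isUnit_right this)
    clear hG hnorm hNr hNA hmain hε hunit hprod hcopA heq
    rcases unit_cases hku with rfl | rfl | rfl | rfl | rfl | rfl <;>
    interval_cases i <;> interval_cases i' <;> first | rfl | exact absurd hk (by decide)
  subst hii
  rw [hcube, hA, pow_zero, mul_one] at hmain
  refine ⟨x, y, ?_, ?_⟩
  · have r := congrArg QuadraticAlgebra.re hmain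
    simp only [re_mul] at r
    linear_combination r
  · have m := congrArg QuadraticAlgebra.im hmain
    simp only [im_mul] at m
    have hl : lam = 1 + 2 * w := rfl
    apply mul_left_cancel₀ lam_ne
    have m' : lam * δ * w ^ 2 * e ^ 3 = w ^ i' * (3 * x ^ 2 * y + 3 * w * x * y ^ 2 + (w ^ 2 - 1) * y ^ 3) := by linear_combination m
    have l2 := lam_sq
    have lw : w ^ 2 - 1 = lam * w := by decide
    have w4 : w ^ 4 = w := by decide
    rw [pow_add]
    have m2 : lam * (δ * e ^ 3) = w * (lam * δ * w ^ 2 * e ^ 3) := by linear_combination -lam * δ * e ^ 3 * hw3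
    rw [m2, m', lw]
    linear_combination w ^ i' * (w * x ^ 2 * y + w ^ 2 * x * y ^ 2) * l2 + w ^ i' * lam ^ 2 * x ^ 2 * y * w4

theorem thmD (δ : Eis) (i : ℕ) (hi : i < 3) (hδ : ∃ k, δ = w ^ (i + 1) + 3 * k)
    (hcop : ∀ a b e : Eis, e ≠ 0 → IsCoprime a e → ch a ≠ 0 → 
      b ^ 2 + lam * δ * b * e ^ 3 + w * lam ^ 2 * δ ^ 2 * e ^ 6 = -(w ^ (2 * i)) * a ^ 3 → 
      IsCoprime a (2 * b + lam * δ * e ^ 3)) (m : ℕ) : 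
    ∀ a b e e0 : Eis, ch e0 ≠ 0 → e = lam ^ m * e0 → IsCoprime a e → ch b ≠ 0 → 
      b ^ 2 + lam * δ * b * e ^ 3 + w * lam ^ 2 * δ ^ 2 * e ^ 6 = -(w ^ (2 * i)) * a ^ 3 → False := by
  have hw := w2
  have hw3 := w3
  have hl : lam = 1 + 2 * w := rfl
  have ch3 : ch 3 = 0 := by decide
  have hδ1 : ch δ = 1 := by
    obtain ⟨k, hk⟩ := hδ
    rw [hk]; simp [ch_w, ch3]
  have habch : ∀ a b e : Eis, b ^ 2 + lam * δ * b * e ^ 3 + w * lam ^ 2 * δ ^ 2 * e ^ 6 = -(w ^ (2 * i)) * a ^ 3 →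
      (ch a ≠ 0 ↔ ch b ≠ 0) := by
    intro a b e h
    have := congrArg ch h
    simp only [map_mul, map_add, map_pow, map_neg, ch_lam, ch_w, one_pow] at this
    generalize ch a = a at *
    generalize ch b = b at *
    have h2 : b ^ 2 = - a ^ 3 := by linear_combination this
    clear this
    revert a b; decide
  have wu : IsUnit w := isUnit_iff_nm.2 nm_w
  induction m with
  | zero =>
    intro a b e e0 he0 he hae hb heq
    rw [pow_zero, one_mul] at he
    subst he
    have ha := (habch _ _ _ heq).2 hb
    have hen : e ≠ 0 := by rintro rfl; exact he0 (map_zero _)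
    obtain ⟨x, y, hbx, hey⟩ := stepD δ i hi a b e ha hb heq (hcop a b e hen hae ha heq)
    have hy : ch y ≠ 0 := by
      intro h0
      have := congrArg ch hey
      simp only [map_mul, map_sub, map_pow, hδ1, h0, zero_mul, mul_zero, one_mul] at this
      exact he0 (by simpa using this)
    have hbc := congrArg ch hbx
    simp only [map_mul, map_sub, map_pow, ch_w, ch3] at hbc
    obtain ⟨ε, hε, hεc, s, hs⟩ := ch_cube e he0
    obtain ⟨ε', hε', hεc', t, ht⟩ := ch_cube y hy
    obtain ⟨k, hk⟩ := hδ
    have hεε : ε = ε' := by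
      have := congrArg ch hey
      simp only [map_mul, map_sub, map_pow, hδ1, ch_lam, ch_w, hεc, hεc'] at this
      rcases hε with rfl | rfl <;> rcases hε' with rfl | rfl <;> first | rfl | (exfalso; revert this; simp; decide)
    subst hεε
    have hε3 : ((ε : Eis)) ^ 3 = ε := by rcases hε with rfl | rfl <;> simp <;> ring
    have l2 := lam_sq
    -- cubes mod 3
    obtain ⟨s', hs'⟩ : ∃ s', e ^ 3 = ε + 3 * s' := 
      ⟨ε ^ 2 * lam * s - 3 * ε * s ^ 2 - lam * s ^ 3, by
        rw [hs]; linear_combination hε3 + (3 * ε * s ^ 2 + lam * s ^ 3) * l2⟩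
    obtain ⟨t', ht'⟩ : ∃ t', y ^ 3 = ε + 3 * t' := 
      ⟨ε ^ 2 * lam * t - 3 * ε * t ^ 2 - lam * t ^ 3, by
        rw [ht]; linear_combination hε3 + (3 * ε * t ^ 2 + lam * t ^ 3) * l2⟩
    have e1 : w ^ (i + 1) * ((ε : Eis) - w * ε + w * lam * (x * y ^ 2 + w ^ 2 * x ^ 2 * y) + 
      lam ^ 2 * (w * t' - s' - w ^ 0 * (w ^ (2 * (i+1)) * k * e ^ 3))) = 0 := by
      have wi : w ^ (i + 1) * w ^ (2 * (i + 1)) = 1 := by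
        rw [← pow_add, show i + 1 + 2 * (i + 1) = 3 * (i + 1) by ring, pow_mul, hw3, one_pow]
      rw [hk] at hey
      have w12 : w ^ (i + 2) = w ^ (i + 1) * w := pow_succ _ _
      rw [w12] at hey
      linear_combination hey - w ^ (i + 1) * hs' + w ^ (i + 1) * w * ht' - lam ^ 2 * k * e ^ 3 * wi + (w ^ (i + 1) * (w * t' - s') - k * e ^ 3) * l2
    have e2 : (1 : Eis) - w = lam * w ^ 2 := by decide
    have e3 : w ^ 2 * ε + w * (x * y ^ 2 + w ^ 2 * x ^ 2 * y) + 
      lam * (w * t' - s' - w ^ 0 * (w ^ (2 * (i+1)) * k * e ^ 3)) = 0 := by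
      rcases mul_eq_zero.1 e1 with h | h
      · exact absurd h (wu.pow _).ne_zero
      · apply mul_left_cancel₀ lam_ne
        linear_combination h - ε * e2
    have e4 := congrArg ch e3
    simp only [map_mul, map_add, map_pow, ch_lam, ch_w, hεc', map_zero, map_intCast] at e4
    rw [hεc'] at hbc
    generalize ch b = b at *
    generalize ch x = x at *
    clear * - hε hb hbc e4
    apply hb; rw [hbc]
    rw [one_pow, one_mul, one_mul, one_mul, zero_mul, add_zero] at e4
    rw [one_pow, one_mul, zero_mul, zero_mul, sub_zero, one_mul]
    clear hbc
    rcases hε with rfl | rfl <;> push_cast at e4 ⊢ <;> revert x <;> decide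
  | succ m ih => 
    intro a b e e0 he0 he hae hb heq
    have ha := (habch _ _ _ heq).2 hb
    have he00 : e0 ≠ 0 := by rintro rfl; exact he0 (map_zero _)
    have hen : e ≠ 0 := by rw [he]; exact mul_ne_zero (pow_ne_zero _ lam_ne) he00
    have hche : ch e = 0 := by rw [he, map_mul, map_pow, ch_lam]; simp
    have hδ0 : δ ≠ 0 := by rintro rfl; rw [map_zero] at hδ1; exact absurd hδ1 (by decide)
    obtain ⟨x, y, hbx, hey⟩ := stepD δ i hi a b e ha hb heq (hcop a b e hen hae ha heq)
    have hyc : ch y = 0 := by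
      have := congrArg ch hey
      simp only [map_mul, map_sub, map_pow, hδ1, ch_lam, ch_w, hche] at this
      have h2 : ch y ^ 3 = 0 := by
        linear_combination -this
      exact pow_eq_zero_iff (three_ne_zero) |>.1 h2
    have hxc : ch x ≠ 0 := by
      intro h0
      have hbc := congrArg ch hbx
      simp only [map_mul, map_sub, map_pow, ch_w, ch3, hyc, h0] at hbc
      apply hb; rw [hbc]; simp
    have hy0 : y ≠ 0 := by
      rintro rfl
      rw [zero_mul, mul_zero] at hey
      exact mul_ne_zero hδ0 (pow_ne_zero 3 hen) hey
    obtain ⟨y1, rfl⟩ := ch_eq_zero.1 hyc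
    have hy1 : y1 ≠ 0 := right_ne_zero_of_mul hy0
    obtain ⟨k, y0, hy0c, hky⟩ := lam_factor hy1
    have hval : 3 * m + 3 = k + 2 := by
      apply lam_pow_eq (u := δ * e0 ^ 3) (v := w ^ (i + 2) * y0 * (lam * y1 ^ 2 - lam * x * y1 - w ^ 2 * x ^ 2))
      · have h1 : δ * e ^ 3 = lam ^ (3 * m + 3) * (δ * e0 ^ 3) := by
          rw [he]; ring
        have h2 : w ^ (i + 2) * (lam * y1 * ((lam * y1) ^ 2 - lam * x * (lam * y1) - lam * w ^ 2 * x ^ 2)) 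
          = lam ^ (k + 2) * (w ^ (i + 2) * y0 * (lam * y1 ^ 2 - lam * x * y1 - w ^ 2 * x ^ 2)) := by
          have h3 : lam ^ (k + 2) * (w ^ (i + 2) * y0 * (lam * y1 ^ 2 - lam * x * y1 - w ^ 2 * x ^ 2)) = 
            (lam ^ k * y0) * (lam ^ 2 * w ^ (i + 2) * (lam * y1 ^ 2 - lam * x * y1 - w ^ 2 * x ^ 2)) := by ring
          rw [h3, ← hky]; ring
        rw [← h1, ← h2, hey]
      · rw [map_mul, map_pow, hδ1, one_mul]; exact pow_ne_zero _ he0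
      · simp only [map_mul, map_sub, map_pow, ch_lam, ch_w, one_pow]
        intro h
        have : ch y0 * ch x ^ 2 = 0 := by linear_combination -h
        exact mul_ne_zero hy0c (pow_ne_zero 2 hxc) this
    obtain ⟨y, hyy⟩ : ∃ y, y = lam * y1 := ⟨_, rfl⟩
    rw [← hyy] at hey hy0
    have hid : (w ^ 2 * lam * x + w * y) ^ 2 + (w ^ 2 * lam * x + w * y) * y + w * y ^ 2 = 
      - w ^ 2 * lam * (y ^ 2 - lam * x * y - lam * w ^ 2 * x ^ 2) := by
      rw [hl]; clear * - hw; grind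
    have wi : w ^ (2 * i) * w ^ (i + 2) = w ^ 2 := by
      rw [← pow_add, show 2 * i + (i + 2) = 3 * i + 2 by ring, pow_add, pow_mul, hw3, one_pow, one_mul]
    obtain ⟨a', b', e', he', hae', hbe', had, hbd, heq'⟩ := denom (lam * δ) (w * lam ^ 2 * δ ^ 2) (-(w ^ (2 * i))) 
      (δ * lam * e) y (δ * lam * (w ^ 2 * lam * x + w * y)) y (wu.pow _).neg hy0 hy0 (by
        linear_combination y ^ 3 * δ ^ 2 * lam ^ 2 * hid + w ^ (2 * i) * δ ^ 2 * lam ^ 3 * y ^ 2 * hey + 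
          δ ^ 2 * lam ^ 3 * y ^ 3 * (y ^ 2 - lam * x * y - lam * w ^ 2 * x ^ 2) * wi)
    obtain ⟨m', e0', he0', hem'⟩ := lam_factor he'
    have ha'0 : a' ≠ 0 := by
      rintro rfl
      rw [zero_mul] at had
      exact mul_ne_zero (mul_ne_zero (mul_ne_zero hδ0 lam_ne) hen) (pow_ne_zero 2 he') had.symm
    obtain ⟨q, a0', ha0', hqa⟩ := lam_factor ha'0
    have hval2 : q + k + 1 = m + 2 + 2 * m' := by
      apply lam_pow_eq (u := a0' * y0) (v := δ * e0 * e0' ^ 2)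
      · calc lam ^ (q + k + 1) * (a0' * y0) = (lam ^ q * a0') * (lam * (lam ^ k * y0)) := by ring
          _ = a' * y := by rw [← hqa, ← hky, hyy]
          _ = δ * lam * (lam ^ (m + 1) * e0) * (lam ^ m' * e0') ^ 2 := by rw [had, ← hem', ← he]
          _ = _ := by ring
      · rw [map_mul]; exact mul_ne_zero ha0' hy0c
      · simp only [map_mul, map_pow, hδ1, one_mul]; exact mul_ne_zero he0 (pow_ne_zero 2 he0')
    have hq : q = 0 := by
      by_contra hq
      have hm' : m' ≠ 0 := by omega
      have d1 : lam ∣ a' := by rw [hqa]; exact Dvd.dvd.mul_right (dvd_pow_self _ hq) _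
      have d2 : lam ∣ e' := by rw [hem']; exact Dvd.dvd.mul_right (dvd_pow_self _ hm') _
      exact lam_prime.not_isUnit (hae'.isUnit_of_dvd' d1 d2)
    have hm' : m' = m := by omega
    subst hm'
    rw [hq, pow_zero, one_mul] at hqa
    subst hqa
    refine ih a' b' e' e0' he0' hem' hae' ((habch a' b' e' ?_).1 ha0') ?_
    · linear_combination heq'
    · linear_combination heq'

end S16

namespace S16
open QuadraticAlgebra

/-- reduction at a prime above 7, sending w to 2 -/
def r2 : Eis →+* ZMod 7 where
  toFun x := (x.re + 2 * x.im : ℤ)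
  map_zero' := by simp
  map_one' := by simp [QuadraticAlgebra.re_one, QuadraticAlgebra.im_one]
  map_add' x y := by simp; ring
  map_mul' x y := by 
    have h3 : (7 : ZMod 7) = 0 := rfl
    simp
    linear_combination (-(x.im : ZMod 7) * y.im) * h3

/-- reduction at a prime above 7, sending w to 4 -/
def r4 : Eis →+* ZMod 7 where
  toFun x := (x.re + 4 * x.im : ℤ)
  map_zero' := by simp
  map_one' := by simp [QuadraticAlgebra.re_one, QuadraticAlgebra.im_one]
  map_add' x y := by simp; ring
  map_mul' x y := by 
    have h3 : (7 : ZMod 7) = 0 := rfl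
    simp
    linear_combination (-3 * (x.im : ZMod 7) * y.im) * h3

/-- primes above 7 -/
def be : Eis := -3 - 2 * w
/-- primes above 7 -/
def bb : Eis := -1 + 2 * w

theorem r2_eq_zero {x : Eis} : r2 x = 0 ↔ be ∣ x := by
  constructor
  · intro h
    have h : ((x.re + 2 * x.im : ℤ) : ZMod 7) = 0 := h
    rw [ZMod.intCast_zmod_eq_zero_iff_dvd _ 7 |>.trans Iff.rfl] at h
    obtain ⟨k, hk⟩ := h
    refine ⟨bb * ⟨k, 0⟩ - w * ⟨x.im, 0⟩, ?_⟩
    obtain ⟨a, b⟩ := x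
    simp only at hk
    have hb : a = 7 * k - 2 * b := by push_cast at hk; linarith
    subst hb
    ext <;> simp [be, bb, w, QuadraticAlgebra.re_one, QuadraticAlgebra.im_one] <;> ring
  · rintro ⟨y, rfl⟩
    rw [map_mul, show r2 be = 0 by decide, zero_mul]

theorem r4_eq_zero {x : Eis} : r4 x = 0 ↔ bb ∣ x := by
  constructor
  · intro h
    have h : ((x.re + 4 * x.im : ℤ) : ZMod 7) = 0 := h
    rw [ZMod.intCast_zmod_eq_zero_iff_dvd _ 7 |>.trans Iff.rfl] at h
    obtain ⟨k, hk⟩ := h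
    refine ⟨be * ⟨k, 0⟩ + (w + 2) * ⟨x.im, 0⟩, ?_⟩
    obtain ⟨a, b⟩ := x
    simp only at hk
    have hb : a = 7 * k - 4 * b := by push_cast at hk; linarith
    subst hb
    ext <;> simp [be, bb, w, QuadraticAlgebra.re_one, QuadraticAlgebra.im_one] <;> ring
  · rintro ⟨y, rfl⟩
    rw [map_mul, show r4 bb = 0 by decide, zero_mul]

instance prime7 : Fact (Nat.Prime 7) := ⟨by norm_num⟩

theorem be_ne : be ≠ 0 := by decide
theorem bb_ne : bb ≠ 0 := by decide
theorem be_prime : Prime be := by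
  refine ⟨be_ne, fun h => ?_, fun a b hab => ?_⟩
  · have := h.map r2
    rw [show r2 be = 0 by decide] at this
    exact not_isUnit_zero this
  · rw [← r2_eq_zero, ← r2_eq_zero]
    rw [← r2_eq_zero, map_mul] at hab
    exact mul_eq_zero.1 hab
theorem bb_prime : Prime bb := by
  refine ⟨bb_ne, fun h => ?_, fun a b hab => ?_⟩
  · have := h.map r4
    rw [show r4 bb = 0 by decide] at this
    exact not_isUnit_zero this
  · rw [← r4_eq_zero, ← r4_eq_zero]
    rw [← r4_eq_zero, map_mul] at hab
    exact mul_eq_zero.1 hab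

theorem cop_of_not_dvd {p a : Eis} (hp : Prime p) (h : ¬ p ∣ a) : IsCoprime a p := by
  rw [isCoprime_comm, hp.irreducible.coprime_iff_not_dvd]; exact h

theorem T_sq (δ a b e : Eis) (i : ℕ) 
    (heq : b ^ 2 + lam * δ * b * e ^ 3 + w * lam ^ 2 * δ ^ 2 * e ^ 6 = -(w ^ (2 * i)) * a ^ 3) :
    (2 * b + lam * δ * e ^ 3) ^ 2 = lam ^ 3 * be * δ ^ 2 * e ^ 6 - 4 * w ^ (2 * i) * a ^ 3 := by
  have h1 : lam ^ 3 * be = lam ^ 2 * (1 - 4 * w) := by decide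
  linear_combination 4 * heq - δ ^ 2 * e ^ 6 * h1

theorem hcop_A (a b e : Eis) (hae : IsCoprime a e) (ha : ch a ≠ 0)
    (heq : b ^ 2 + lam * 1 * b * e ^ 3 + w * lam ^ 2 * 1 ^ 2 * e ^ 6 = -(w ^ (2 * 2)) * a ^ 3) :
    IsCoprime a (2 * b + lam * 1 * e ^ 3) := by
  have hT := T_sq _ _ _ _ _ heq
  generalize 2 * b + lam * 1 * e ^ 3 = T at *
  have hbe : ¬ be ∣ a := by
    rintro ⟨a1, rfl⟩
    have hTd : be ∣ T := by
      apply be_prime.dvd_of_dvd_pow (n := 2)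
      exact ⟨lam ^ 3 * e ^ 6 - 4 * w ^ (2 * 2) * be ^ 2 * a1 ^ 3, by rw [hT]; ring⟩
    obtain ⟨T1, rfl⟩ := hTd
    have h2 : be * T1 ^ 2 = lam ^ 3 * e ^ 6 - 4 * w ^ (2 * 2) * be ^ 2 * a1 ^ 3 := by
      apply mul_left_cancel₀ be_ne; linear_combination hT
    have h3 := congrArg r2 h2
    simp only [map_mul, map_sub, map_pow, show r2 be = 0 by decide, show r2 lam = 5 by decide] at h3
    have h4 : r2 e ^ 6 = 0 := by
      have : (5 : ZMod 7) ^ 3 = -1 := by decide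
      rw [this] at h3
      linear_combination h3
    have h5 := r2_eq_zero.1 (pow_eq_zero_iff (by norm_num) |>.1 h4)
    exact be_prime.not_isUnit (hae.isUnit_of_dvd' (dvd_mul_right _ _) h5)
  have h1 : IsCoprime a (lam ^ 3 * be * 1 ^ 2 * e ^ 6) := by
    refine IsCoprime.mul_right (IsCoprime.mul_right (IsCoprime.mul_right ?_ ?_) ?_) ?_
    · exact (coprime_lam ha).pow_right
    · exact cop_of_not_dvd be_prime hbe
    · rw [one_pow]; exact isCoprime_one_right
    · exact hae.pow_right
  have h2 : IsCoprime a (T ^ 2) := by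
    rw [hT]
    have := IsCoprime.add_mul_left_right h1 (-4 * w ^ (2 * 2) * a ^ 2)
    have e : lam ^ 3 * be * 1 ^ 2 * e ^ 6 - 4 * w ^ (2 * 2) * a ^ 3 = lam ^ 3 * be * 1 ^ 2 * e ^ 6 + a * (-4 * w ^ (2 * 2) * a ^ 2) := by ring
    rw [e]; exact this
  exact (IsCoprime.pow_right_iff two_pos).1 h2

theorem hcop_B (a b e : Eis) (hae : IsCoprime a e) (ha : ch a ≠ 0)
    (heq : b ^ 2 + lam * (be * bb ^ 2) * b * e ^ 3 + w * lam ^ 2 * (be * bb ^ 2) ^ 2 * e ^ 6 = -(w ^ (2 * 1)) * a ^ 3) :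
    IsCoprime a (2 * b + lam * (be * bb ^ 2) * e ^ 3) := by
  have hT := T_sq _ _ _ _ _ heq
  generalize 2 * b + lam * (be * bb ^ 2) * e ^ 3 = T at *
  have hbe : ¬ be ∣ a := by
    rintro ⟨a1, rfl⟩
    have he0 : r2 e ≠ 0 := fun h => 
      be_prime.not_isUnit (hae.isUnit_of_dvd' (dvd_mul_right _ _) (r2_eq_zero.1 h))
    have hTd : be ∣ T := by
      apply be_prime.dvd_of_dvd_pow (n := 2)
      exact ⟨lam ^ 3 * (be * bb ^ 2) ^ 2 * e ^ 6 - 4 * w ^ (2 * 1) * be ^ 2 * a1 ^ 3, by rw [hT]; ring⟩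
    obtain ⟨T1, rfl⟩ := hTd
    have h2 : T1 ^ 2 = be * (lam ^ 3 * bb ^ 4 * e ^ 6 - 4 * w ^ 2 * a1 ^ 3) := by
      apply mul_left_cancel₀ (pow_ne_zero 2 be_ne); linear_combination hT
    obtain ⟨T2, rfl⟩ : be ∣ T1 := be_prime.dvd_of_dvd_pow (n := 2) ⟨_, h2⟩
    have h2' : be * T2 ^ 2 = (lam ^ 3 * bb ^ 4 * e ^ 6 - 4 * w ^ 2 * a1 ^ 3) := by
      apply mul_left_cancel₀ be_ne; linear_combination h2
    have h3 := congrArg r2 h2'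
    simp only [map_mul, map_sub, map_pow, show r2 be = 0 by decide, show r2 lam = 5 by decide, 
      show r2 bb = 3 by decide, show r2 w = 2 by decide, show r2 4 = 4 by decide] at h3
    generalize r2 e = e at *
    generalize r2 a1 = a at *
    rw [zero_mul] at h3
    clear * - he0 h3
    revert e a; decide
  have hbb : ¬ bb ∣ a := by
    rintro ⟨a1, rfl⟩
    have he0 : r4 e ≠ 0 := fun h => 
      bb_prime.not_isUnit (hae.isUnit_of_dvd' (dvd_mul_right _ _) (r4_eq_zero.1 h))
    have hTd : bb ∣ T := by
      apply bb_prime.dvd_of_dvd_pow (n := 2)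
      exact ⟨lam ^ 3 * be * bb ^ 3 * be ^ 2 * e ^ 6 - 4 * w ^ (2 * 1) * bb ^ 2 * a1 ^ 3, by rw [hT]; ring⟩
    obtain ⟨T1, rfl⟩ := hTd
    have h2 : T1 ^ 2 = bb * (lam ^ 3 * be ^ 3 * bb * e ^ 6 - 4 * w ^ 2 * a1 ^ 3) := by
      apply mul_left_cancel₀ (pow_ne_zero 2 bb_ne); linear_combination hT
    obtain ⟨T2, rfl⟩ : bb ∣ T1 := bb_prime.dvd_of_dvd_pow (n := 2) ⟨_, h2⟩
    have h2' : bb * T2 ^ 2 = (lam ^ 3 * be ^ 3 * bb * e ^ 6 - 4 * w ^ 2 * a1 ^ 3) := by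
      apply mul_left_cancel₀ bb_ne; linear_combination h2
    have ha1 : r4 a1 = 0 := by
      have h3 := congrArg r4 h2'
      simp only [map_mul, map_sub, map_pow, show r4 bb = 0 by decide, show r4 lam = 2 by decide, 
        show r4 be = 3 by decide, show r4 w = 4 by decide, show r4 4 = 4 by decide] at h3
      generalize r4 e = e at *
      generalize r4 a1 = a at *
      rw [zero_mul, mul_zero, zero_mul] at h3
      clear * - h3
      revert a; decide
    obtain ⟨a2, rfl⟩ := r4_eq_zero.1 ha1
    have h2'' : T2 ^ 2 = (lam ^ 3 * be ^ 3 * e ^ 6 - 4 * w ^ 2 * bb ^ 2 * a2 ^ 3) := by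
      apply mul_left_cancel₀ bb_ne; linear_combination h2'
    have h3 := congrArg r4 h2''
    simp only [map_mul, map_sub, map_pow, show r4 bb = 0 by decide, show r4 lam = 2 by decide, 
        show r4 be = 3 by decide, show r4 w = 4 by decide, show r4 4 = 4 by decide] at h3
    generalize r4 e = e at *
    generalize r4 T2 = t at *
    generalize r4 a2 = a2 at *
    have h4 : t ^ 2 = 2 ^ 3 * 3 ^ 3 * e ^ 6 := by rw [h3]; ring
    clear * - he0 h4
    revert e t; decide
  have h1 : IsCoprime a (lam ^ 3 * be * (be * bb ^ 2) ^ 2 * e ^ 6) := by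
    have c1 := cop_of_not_dvd be_prime hbe
    have c2 := cop_of_not_dvd bb_prime hbb
    refine IsCoprime.mul_right (IsCoprime.mul_right (IsCoprime.mul_right ?_ c1) ?_) ?_
    · exact (coprime_lam ha).pow_right
    · exact (c1.mul_right c2.pow_right).pow_right
    · exact hae.pow_right
  have h2 : IsCoprime a (T ^ 2) := by
    rw [hT]
    have := IsCoprime.add_mul_left_right h1 (-4 * w ^ (2 * 1) * a ^ 2)
    have e : lam ^ 3 * be * (be * bb ^ 2) ^ 2 * e ^ 6 - 4 * w ^ (2 * 1) * a ^ 3 = lam ^ 3 * be * (be * bb ^ 2) ^ 2 * e ^ 6 + a * (-4 * w ^ (2 * 1) * a ^ 2) := by ring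
    rw [e]; exact this
  exact (IsCoprime.pow_right_iff two_pos).1 h2

theorem cube_mod9 {t : Eis} (h : ch t = 1) : ∃ s, t ^ 3 = 1 + lam ^ 4 * s := by
  have : lam ∣ t - 1 := by rw [← ch_eq_zero, map_sub, h, map_one, sub_self]
  obtain ⟨k, hk⟩ := this
  have h2 : lam ∣ k ^ 3 - k := by
    rw [← ch_eq_zero, map_sub, map_pow]
    generalize ch k = c
    revert c; decide
  obtain ⟨l, hl⟩ := h2
  have ht : t = 1 + lam * k := by linear_combination hk
  refine ⟨l - k ^ 2, ?_⟩
  rw [ht]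
  have l2 := lam_sq
  linear_combination (lam * k + lam ^ 2 * k ^ 2) * l2 + lam ^ 3 * hl

/-- common normal form -/
theorem normal_form (δ c : Eis) (i : ℕ) (hc : ch c = 1) (hcδ : be * δ ^ 2 = c) 
    (hD : ∀ m : ℕ, ∀ a b e e0 : Eis, ch e0 ≠ 0 → e = lam ^ m * e0 → IsCoprime a e → ch b ≠ 0 → 
      b ^ 2 + lam * δ * b * e ^ 3 + w * lam ^ 2 * δ ^ 2 * e ^ 6 = -(w ^ (2 * i)) * a ^ 3 → False)
    (s : ℤ) (hs : ∃ k, c - 4 * w ^ (2 * i) = s * lam ^ 3 + lam ^ 4 * k)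
    (a b e : Eis) (he : e ≠ 0) (hae : IsCoprime a e)
    (heq : b ^ 2 + lam * δ * b * e ^ 3 + w * lam ^ 2 * δ ^ 2 * e ^ 6 = -(w ^ (2 * i)) * a ^ 3) :
    ∃ a1 U : Eis, ch a1 = 1 ∧ ch e ≠ 0 ∧ ch U ^ 2 = s ∧ a = lam * a1 ∧ 2 * b + lam * δ * e ^ 3 = lam ^ 3 * U := by
  obtain ⟨m, e0, he0, hem⟩ := lam_factor he
  have hb : ch b = 0 := by
    by_contra hb
    exact hD m a b e e0 he0 hem hae hb heq
  have ha : ch a = 0 := by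
    have := congrArg ch heq
    simp only [map_mul, map_add, map_pow, map_neg, ch_lam, ch_w, one_pow, hb] at this
    have h3 : ch a ^ 3 = 0 := by linear_combination this
    exact pow_eq_zero_iff three_ne_zero |>.1 h3
  obtain ⟨a1, rfl⟩ := ch_eq_zero.1 ha
  have hec : ch e ≠ 0 := fun h => 
    lam_prime.not_isUnit (hae.isUnit_of_dvd' (dvd_mul_right _ _) (ch_eq_zero.1 h))
  have hT := T_sq _ _ _ _ _ heq
  generalize 2 * b + lam * δ * e ^ 3 = T at *
  obtain ⟨T1, rfl⟩ : lam ∣ T := lam_prime.dvd_of_dvd_pow (n := 2) 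
    ⟨lam ^ 2 * (be * δ ^ 2 * e ^ 6 - 4 * w ^ (2 * i) * a1 ^ 3), by rw [hT]; ring⟩
  obtain ⟨T2, rfl⟩ : lam ∣ T1 := lam_prime.dvd_of_dvd_pow (n := 2) 
    ⟨(be * δ ^ 2 * e ^ 6 - 4 * w ^ (2 * i) * a1 ^ 3), by 
      apply mul_left_cancel₀ (pow_ne_zero 2 lam_ne); linear_combination hT⟩
  have h1 : lam * T2 ^ 2 = c * e ^ 6 - 4 * w ^ (2 * i) * a1 ^ 3 := by
    apply mul_left_cancel₀ (pow_ne_zero 3 lam_ne); linear_combination hT + lam ^ 3 * e ^ 6 * hcδ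
  have he2 : ch (e ^ 2) = 1 := by
    rw [map_pow]; generalize ch e = c at *; clear * - hec; revert c; decide
  have ha1 : ch a1 = 1 := by
    have := congrArg ch h1
    have e6 : ch e ^ 6 = 1 := by
      rw [map_pow] at he2
      calc ch e ^ 6 = (ch e ^ 2) ^ 3 := by ring
        _ = 1 := by rw [he2]; ring
    simp only [map_mul, map_sub, map_pow, ch_lam, ch_w, one_pow, e6, hc, show ch 4 = 1 by decide] at this
    generalize ch a1 = c at *
    generalize ch T2 = t at *
    clear * - this
    revert c t; decide
  obtain ⟨p, hp⟩ := cube_mod9 he2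
  obtain ⟨q, hq⟩ := cube_mod9 ha1
  obtain ⟨k, hk⟩ := hs
  have h2 : T2 ^ 2 = lam ^ 2 * (s + lam * (k + c * p - 4 * w ^ (2 * i) * q)) := by
    apply mul_left_cancel₀ lam_ne
    linear_combination h1 + c * hp - 4 * w ^ (2 * i) * hq + hk
  obtain ⟨U, rfl⟩ : lam ∣ T2 := lam_prime.dvd_of_dvd_pow (n := 2) 
    ⟨lam * (s + lam * (k + c * p - 4 * w ^ (2 * i) * q)), by rw [h2]; ring⟩
  refine ⟨a1, U, ha1, hec, ?_, rfl, by ring⟩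
  have h3 : U ^ 2 = (s + lam * (k + c * p - 4 * w ^ (2 * i) * q)) := by
    apply mul_left_cancel₀ (pow_ne_zero 2 lam_ne); linear_combination h2
  have := congrArg ch h3
  simpa [ch_lam] using this

theorem nf_A (a b e : Eis) (he : e ≠ 0) (hae : IsCoprime a e)
    (heq : b ^ 2 + lam * 1 * b * e ^ 3 + w * lam ^ 2 * 1 ^ 2 * e ^ 6 = -(w ^ (2 * 2)) * a ^ 3) :
    ∃ a1 U : Eis, ch a1 = 1 ∧ ch e ≠ 0 ∧ ch U ≠ 0 ∧ a = lam * a1 ∧ 2 * b + lam * e ^ 3 = lam ^ 3 * U := by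
  obtain ⟨a1, U, h1, h2, h3, h4, h5⟩ := normal_form 1 be 2 (by decide) (by ring) 
    (fun m => thmD 1 2 (by norm_num) ⟨0, by decide⟩ (fun a b e _ h1 h2 h3 => hcop_A a b e h1 h2 h3) m)
    1 ⟨0, by decide⟩ a b e he hae heq
  refine ⟨a1, U, h1, h2, ?_, h4, by linear_combination h5⟩
  intro h; rw [h] at h3; exact absurd h3 (by decide)

theorem nf_B (a b e : Eis) (he : e ≠ 0) (hae : IsCoprime a e)
    (heq : b ^ 2 + lam * (be * bb ^ 2) * b * e ^ 3 + w * lam ^ 2 * (be * bb ^ 2) ^ 2 * e ^ 6 = -(w ^ (2 * 1)) * a ^ 3) :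
    False := by
  obtain ⟨a1, U, h1, h2, h3, h4, h5⟩ := normal_form (be * bb ^ 2) (343 * bb) 1 (by decide) (by decide) 
    (fun m => thmD (be * bb ^ 2) 1 (by norm_num) ⟨⟨-2, 5⟩, by decide⟩ (fun a b e _ h1 h2 h3 => hcop_B a b e h1 h2 h3) m)
    (-1) ⟨⟨-38, 76⟩, by decide⟩ a b e he hae heq
  generalize ch U = u at *
  clear * - h3
  revert u; decide

end S16

namespace S16
open QuadraticAlgebra

/-- the field of fractions of `Eis` -/
abbrev kk := QuadraticAlgebra ℚ (-1) (-1)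

instance factk : Fact (∀ r : ℚ, r ^ 2 ≠ -1 + -1 * r) := ⟨fun r h => by nlinarith [sq_nonneg (2 * r + 1)]⟩

/-- the embedding of `Eis` -/
def io : Eis →+* kk where
  toFun x := ⟨x.re, x.im⟩
  map_zero' := by ext <;> simp
  map_one' := by ext <;> simp [QuadraticAlgebra.re_one, QuadraticAlgebra.im_one]
  map_add' x y := by ext <;> simp
  map_mul' x y := by ext <;> simp

theorem io_inj {x y : Eis} (h : io x = io y) : x = y := by
  have h1 := congrArg QuadraticAlgebra.re h
  have h2 := congrArg QuadraticAlgebra.im h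
  simp only [io, RingHom.coe_mk, MonoidHom.coe_mk, OneHom.coe_mk] at h1 h2
  ext
  · exact_mod_cast h1
  · exact_mod_cast h2

theorem io_ne {x : Eis} (h : x ≠ 0) : io x ≠ 0 := fun h' => h (io_inj (by rw [h', map_zero]))

theorem frac (x : kk) : ∃ n d : Eis, d ≠ 0 ∧ x * io d = io n := by
  refine ⟨⟨x.re.num * x.im.den, x.im.num * x.re.den⟩, ⟨x.re.den * x.im.den, 0⟩, ?_, ?_⟩
  · intro h
    have h1 := congrArg QuadraticAlgebra.re h
    simp at h1
  · have e1 : (x.re.num : ℚ) = x.re * x.re.den := (Rat.mul_den_eq_num _).symm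
    have e2 : (x.im.num : ℚ) = x.im * x.im.den := (Rat.mul_den_eq_num _).symm
    ext
    · simp only [io, RingHom.coe_mk, MonoidHom.coe_mk, OneHom.coe_mk, re_mul]; push_cast; rw [e1]; ring
    · simp only [io, RingHom.coe_mk, MonoidHom.coe_mk, OneHom.coe_mk, im_mul]; push_cast; rw [e2]; ring

/-- omega in `kk` -/
def wk : kk := io w
theorem wk2 : wk ^ 2 = -1 - wk := by
  have := congrArg io w2
  simpa [wk] using this
theorem iow : io w = wk := rfl
theorem io2 : io 2 = 2 := by rw [show (2 : Eis) = 1 + 1 by decide, map_add, map_one]; norm_num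
theorem io3 : io 3 = 3 := by rw [show (3 : Eis) = 1 + 1 + 1 by decide, map_add, map_add, map_one]; norm_num
theorem io4 : io 4 = 4 := by rw [show (4 : Eis) = 1 + 1 + 1 + 1 by decide, map_add, map_add, map_add, map_one]; norm_num
theorem iolam : io lam = 1 + 2 * wk := by simp [lam, wk, io2]
theorem iobe : io be = -3 - 2 * wk := by simp [be, wk, io2, io3]
theorem iobb : io bb = -1 + 2 * wk := by simp [bb, wk, io2]

theorem denk (c1 c2 c3 : Eis) (hc3 : IsUnit c3) (X V : kk) 
    (h : V ^ 2 + io c1 * V + io c2 = io c3 * X ^ 3) : 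
    ∃ a b e : Eis, e ≠ 0 ∧ IsCoprime a e ∧ b^2+c1*b*e^3+c2*e^6=c3*a^3 ∧ X * io e ^ 2 = io a ∧ V * io e ^ 3 = io b := by
  obtain ⟨n, d, hd, hX⟩ := frac X
  obtain ⟨r, s, hs, hV⟩ := frac V
  have hd' := io_ne hd
  have hs' := io_ne hs
  obtain ⟨a, b, e, he, hae, -, h1, h2, h3⟩ := denom c1 c2 c3 n d r s hc3 hd hs (by
    apply io_inj
    simp only [map_mul, map_add, map_pow]
    rw [← hX, ← hV]
    linear_combination io s ^ 2 * io d ^ 3 * h)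
  refine ⟨a, b, e, he, hae, h3, ?_, ?_⟩
  · apply mul_right_cancel₀ hd'
    have := congrArg io h1
    simp only [map_mul, map_pow] at this
    linear_combination io e ^ 2 * hX - this
  · apply mul_right_cancel₀ hs'
    have := congrArg io h2
    simp only [map_mul, map_pow] at this
    linear_combination io e ^ 3 * hV - this

theorem w_unit : IsUnit w := IsUnit.of_mul_eq_one (w ^ 2) (by decide)

theorem nfk (z y : kk) (h : (1 + 2 * wk) ^ 3 * y ^ 2 = (-3 - 2 * wk) - 4 * wk * z ^ 3) :
    ∃ a U e : Eis, ch a = 1 ∧ ch e ≠ 0 ∧ ch U ≠ 0 ∧ z * io e ^ 2 = io a ∧ y * io e ^ 3 = io U := by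
  have hw := wk2
  have hl : (1 + 2 * wk : kk) ≠ 0 := by rw [← iolam]; exact io_ne lam_ne
  have h2 : (2 : kk) ≠ 0 := by
    intro h
    have := congrArg QuadraticAlgebra.re h
    simp at this
  obtain ⟨V, hV0⟩ : ∃ V, 2 * V = (1 + 2 * wk) ^ 3 * y - (1 + 2 * wk) := 
    ⟨((1 + 2 * wk) ^ 3 * y - (1 + 2 * wk)) / 2, by rw [mul_div_cancel₀ _ h2]⟩
  obtain ⟨a, b, e, he, hae, h1, hX, hV⟩ := denk (lam * 1) (w * lam ^ 2 * 1 ^ 2) (-(w ^ (2 * 2)))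
    (w_unit.pow _).neg ((1 + 2 * wk) * z) V (by
      simp only [map_mul, map_neg, map_pow, map_one, iow, iolam]
      have h4 : wk ^ (2 * 2) = wk := by grind
      have h5 : (1 + 2 * wk) ^ 3 * (-3 - 2 * wk) = (1 + 2 * wk) ^ 2 * (1 - 4 * wk) := by grind
      apply mul_left_cancel₀ (mul_ne_zero h2 h2)
      rw [h4]
      linear_combination (1 + 2 * wk) ^ 3 * h + h5 + (2 * V + (1 + 2 * wk) ^ 3 * y + (1 + 2 * wk)) * hV0)
  obtain ⟨a1, U, g1, g2, g3, g4, g5⟩ := nf_A a b e he hae h1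
  refine ⟨a1, U, e, g1, g2, g3, ?_, ?_⟩
  · apply mul_left_cancel₀ hl
    rw [g4, map_mul, iolam] at hX
    linear_combination hX
  · apply mul_left_cancel₀ (pow_ne_zero 3 hl)
    have := congrArg io g5
    simp only [map_mul, map_add, map_pow, iolam, ← hV, io2] at this
    linear_combination this - io e ^ 3 * hV0

theorem adj {a b : Eis} (ha : ch a = 1) (hb : ch b = 1) : ∃ j : ℕ, ∃ κ, w ^ j * a - b = lam ^ 2 * κ := by
  have : lam ∣ a - b := by rw [← ch_eq_zero, map_sub, ha, hb, sub_self]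
  obtain ⟨u, hu⟩ := this
  have h3 : ch u = 0 ∨ ch u = 1 ∨ ch u = 2 := by generalize ch u = c; revert c; decide
  have e1 : w = 1 + lam * (1 + w) := by decide
  have e2 : w ^ 2 = 1 + lam * (w - 1 + 2) * w + lam * (1 + w) := by decide
  rcases h3 with h3 | h3 | h3
  · obtain ⟨v, hv⟩ := ch_eq_zero.1 h3
    exact ⟨0, v, by rw [pow_zero, one_mul, hu, hv]; ring⟩
  · obtain ⟨v, hv⟩ : lam ∣ (1 + w) * a + u := by 
      rw [← ch_eq_zero, map_add, map_mul, map_add, ha, h3, ch_w]; decide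
    exact ⟨1, v, by linear_combination lam * hv + hu + a * e1⟩
  · obtain ⟨v, hv⟩ : lam ∣ (w - 1 + 2) * w * a + (1 + w) * a + u := by 
      rw [← ch_eq_zero]; simp only [map_add, map_mul, map_sub, ha, h3, ch_w]; decide
    exact ⟨2, v, by linear_combination lam * hv + hu + a * e2⟩

theorem two_ne_k : (2 : kk) ≠ 0 := by
  intro h
  have := congrArg QuadraticAlgebra.re h
  simp at this

theorem wk_ne : wk ≠ 0 := by
  intro h
  have := wk2
  rw [h] at this
  norm_num at this
theorem lk_ne : (1 + 2 * wk : kk) ≠ 0 := by rw [← iolam]; exact io_ne lam_ne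

theorem thmA_aux (z y : kk) (h : (1 + 2 * wk) ^ 3 * y ^ 2 = (-3 - 2 * wk) - 4 * wk * z ^ 3)
   (a U e κ : Eis) (he : ch e ≠ 0) (hU : ch (U + e ^ 3) ≠ 0) (ha : a - e ^ 2 = lam ^ 2 * κ) 
   (hz : z * io e ^ 2 = io a) (hy : y * io e ^ 3 = io U) : z = 1 := by
  by_contra hz1
  have hz1 : z - 1 ≠ 0 := sub_ne_zero.2 hz1
  have hw := wk2
  have hwn := wk_ne
  have hln := lk_ne
  have h2n := two_ne_k
  have he0 : e ≠ 0 := by rintro rfl; exact he (map_zero _)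
  have hie := io_ne he0
  obtain ⟨μ, hμ⟩ : ∃ μ, μ * (z - 1) = y + 1 := ⟨(y + 1) / (z - 1), by field_simp⟩
  obtain ⟨z3, hz3⟩ : ∃ z3, 4 * wk * (z3 + z + 1) = -(1 + 2 * wk) ^ 3 * μ ^ 2 := 
    ⟨-(1 + 2 * wk) ^ 3 * μ ^ 2 / (4 * wk) - z - 1, by 
      have h4 : (4 : kk) ≠ 0 := by rw [show (4 : kk) = 2 * 2 by norm_num]; exact mul_ne_zero h2n h2n
      field_simp; ring⟩
  obtain ⟨y3, hy3⟩ : ∃ y3, y3 = -1 + μ * (z3 - 1) := ⟨_, rfl⟩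
  have hy' : y = μ * (z - 1) - 1 := by linear_combination -hμ
  have hl3 : (1 + 2 * wk) ^ 3 = -3 - 6 * wk := by grind
  have h3 : (1 + 2 * wk) ^ 3 * y3 ^ 2 = (-3 - 2 * wk) - 4 * wk * z3 ^ 3 := by
    rw [hy3]
    rw [hy'] at h
    apply mul_left_cancel₀ hz1
    rw [hl3] at h hz3 ⊢
    linear_combination (z3 - 1) * h + (z3 - 1) * (z - 1) * (z3 - z) * hz3
  obtain ⟨a3, U3, e3, g1, g2, g3, g4, g5⟩ := nfk z3 y3 h3
  have key : -(U + e ^ 3) ^ 2 * e3 ^ 2 = 4 * w * lam * κ ^ 2 * (a3 * e ^ 2 + e3 ^ 2 * (a + e ^ 2)) := by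
    have hk := congrArg io ha
    apply io_inj
    simp only [map_mul, map_sub, map_neg, map_add, map_pow, iolam, iow, io4] at hk ⊢
    rw [← hz] at hk
    rw [← hz, ← hy, ← g4]
    apply mul_left_cancel₀ (pow_ne_zero 3 hln)
    rw [hy']
    generalize io e = E at *
    generalize io e3 = E3 at *
    generalize io κ = k at *
    have hk2 : E ^ 4 * (z - 1) ^ 2 = (1 + 2 * wk) ^ 4 * k ^ 2 := by
      have : E ^ 2 * (z - 1) = (1 + 2 * wk) ^ 2 * k := by linear_combination hk
      calc _ = (E ^ 2 * (z - 1)) ^ 2 := by ring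
        _ = _ := by rw [this]; ring
    linear_combination -(E ^ 6 * (z - 1) ^ 2 * E3 ^ 2) * hz3 + 4 * wk * (z3 + z + 1) * E3 ^ 2 * E ^ 2 * hk2
  have := congrArg ch key
  simp only [map_mul, ch_lam, mul_zero, zero_mul, map_neg, map_pow] at this
  rw [neg_mul, neg_eq_zero, mul_eq_zero, pow_eq_zero_iff two_ne_zero, pow_eq_zero_iff two_ne_zero] at this
  tauto

theorem thmA (z y : kk) (h : (1 + 2 * wk) ^ 3 * y ^ 2 = (-3 - 2 * wk) - 4 * wk * z ^ 3) : z ^ 3 = 1 := by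
  obtain ⟨a, U, e, g1, g2, g3, g4, g5⟩ := nfk z y h
  have he2 : ch (e ^ 2) = 1 := by
    rw [map_pow]; generalize ch e = c at *; clear * - g2; revert c; decide
  obtain ⟨j, κ, hj⟩ := adj g1 he2
  have w3 : wk ^ 3 = 1 := by have := wk2; grind
  have hz : (wk ^ j * z) ^ 3 = z ^ 3 := by
    rw [mul_pow, ← pow_mul, mul_comm j, pow_mul, w3, one_pow, one_mul]
  have hs : ch (U + e ^ 3) ≠ 0 ∨ ch (-U + e ^ 3) ≠ 0 := by
    simp only [map_add, map_neg, map_pow]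
    generalize ch e = c at *
    generalize ch U = d at *
    clear * - g2 g3
    revert c d
    decide
  have : wk ^ j * z = 1 := by
    rcases hs with hs | hs
    · exact thmA_aux (wk ^ j * z) y (by rw [hz]; exact h) (w ^ j * a) U e κ g2 hs hj 
        (by rw [map_mul, map_pow, iow]; linear_combination wk ^ j * g4) g5
    · exact thmA_aux (wk ^ j * z) (-y) (by rw [hz, neg_sq]; exact h) (w ^ j * a) (-U) e κ g2 hs hj 
        (by rw [map_mul, map_pow, iow]; linear_combination wk ^ j * g4) (by rw [map_neg]; linear_combination -g5)
  rw [← hz, this, one_pow]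

/-- conjugation -/
def cj : kk →+* kk where
  toFun x := ⟨x.re - x.im, -x.im⟩
  map_zero' := by ext <;> simp
  map_one' := by ext <;> simp [QuadraticAlgebra.re_one, QuadraticAlgebra.im_one]
  map_add' x y := by ext <;> simp <;> ring
  map_mul' x y := by ext <;> simp <;> ring
theorem cj_wk : cj wk = wk ^ 2 := by
  rw [wk2]
  ext <;> simp [cj, wk, io, w_re, w_im]

theorem thmB (z y : kk) (h : (1 + 2 * wk) ^ 3 * (-7) * y ^ 2 = (-3 - 2 * wk) - 4 * wk * z ^ 3) : False := by
  have hw := wk2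
  have h' := congrArg cj h
  simp only [map_mul, map_sub, map_neg, map_add, map_pow, cj_wk, map_ofNat, map_one] at h'
  generalize cj y = y at *
  generalize cj z = z at *
  have h2 := two_ne_k
  have hB : 7 * (1 + 2 * wk) ^ 3 * y ^ 2 = (-1 + 2 * wk) - 4 * wk ^ 2 * z ^ 3 := by
    rw [hw] at h'
    rw [hw]
    have : (1 + 2 * (-1 - wk)) ^ 3 = -(1 + 2 * wk) ^ 3 := by ring
    rw [this] at h'
    linear_combination h'
  obtain ⟨a, b, e, he, hae, h1, hX, hV⟩ := denk (lam * (be * bb ^ 2)) (w * lam ^ 2 * (be * bb ^ 2) ^ 2) (-(w ^ (2 * 1)))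
    (w_unit.pow _).neg (7 * (1 + 2 * wk) * z) ((49 * (1 + 2 * wk) ^ 3 * y - (1 + 2 * wk) * (io be * io bb ^ 2)) / 2) (by
      simp only [map_mul, map_neg, map_pow, iow, iolam]
      field_simp
      have e1 : (io be * io bb ^ 2) ^ 2 * (1 - 4 * wk) = 343 * (-1 + 2 * wk) * (1 + 2 * wk) := by
        rw [iobe, iobb]; grind
      linear_combination 343 * (1 + 2 * wk) ^ 3 * hB - (1 + 2 * wk) ^ 2 * e1)
  exact nf_B a b e he hae h1
end S16

namespace S16
open QuadraticAlgebra

instance factF : Fact (∀ r : kk, r ^ 2 ≠ -1 + 0 * r) := ⟨fun r h => by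
  have h1 := congrArg QuadraticAlgebra.re h
  have h2 := congrArg QuadraticAlgebra.im h
  rw [pow_two, zero_mul, add_zero] at h1 h2
  simp only [re_mul, im_mul, re_neg, im_neg, QuadraticAlgebra.re_one, QuadraticAlgebra.im_one] at h1 h2
  have h3 : r.im * (2 * r.re - r.im) = 0 := by linear_combination h2
  rcases mul_eq_zero.1 h3 with h4 | h4
  · rw [h4] at h1
    nlinarith [sq_nonneg r.re]
  · have h5 : r.im = 2 * r.re := by linear_combination -h4
    rw [h5] at h1
    have h6 : IsSquare (3 : ℚ) := ⟨3 * r.re, by linear_combination 3 * h1⟩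
    have h7 : ¬ IsSquare (3 : ℚ) := by norm_num
    exact h7 h6⟩

/-- the field `Q(w, i)` -/
abbrev FF := QuadraticAlgebra kk (-1) 0

/-- the embedding of the Gaussian integers -/
def ga : GaussianInt →+* FF where
  toFun x := ⟨(x.re : kk), (x.im : kk)⟩
  map_zero' := by ext1 <;> simp
  map_one' := by ext1 <;> simp [QuadraticAlgebra.re_one, QuadraticAlgebra.im_one]
  map_add' x y := by ext1 <;> simp
  map_mul' x y := by ext1 <;> simp

theorem ga_re (x : GaussianInt) : (ga x).re = (x.re : kk) := rfl
theorem ga_im (x : GaussianInt) : (ga x).im = (x.im : kk) := rfl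

theorem int_inj {a : ℤ} (h : (a : kk) = 0) : a = 0 := by
  have := congrArg QuadraticAlgebra.re h
  simpa using this

theorem ga_ne {x : GaussianInt} (h : x ≠ 0) : ga x ≠ 0 := by
  intro h'
  apply h
  have h1 := congrArg QuadraticAlgebra.re h'
  have h2 := congrArg QuadraticAlgebra.im h'
  rw [ga_re] at h1
  rw [ga_im] at h2
  ext
  · exact int_inj h1
  · exact int_inj h2

/-- i in FF -/
def iF : FF := ⟨0, 1⟩
theorem iF2 : iF ^ 2 = -1 := by
  rw [pow_two]; ext1 <;> simp [iF]
/-- omega in FF -/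
def wF : FF := ⟨wk, 0⟩
theorem wF2 : wF ^ 2 = -1 - wF := by
  have := wk2
  rw [pow_two] at *
  ext1
  · simp [wF, this]
  · simp [wF]

/-- square up to -7 -/
def Good (x : FF) : Prop := ∃ r, x = r ^ 2 ∨ x = -7 * r ^ 2
theorem Good.mul {x y : FF} : Good x → Good y → Good (x * y) := by
  rintro ⟨r, h⟩ ⟨s, h'⟩
  rcases h with rfl | rfl <;> rcases h' with rfl | rfl
  · exact ⟨r * s, Or.inl (by ring)⟩
  · exact ⟨r * s, Or.inr (by ring)⟩
  · exact ⟨r * s, Or.inr (by ring)⟩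
  · exact ⟨7 * r * s, Or.inl (by ring)⟩
theorem good_sq (x : FF) : Good (x ^ 2) := ⟨x, Or.inl rfl⟩
theorem good_neg : Good (-1) := ⟨iF, Or.inl iF2.symm⟩
theorem good_one : Good 1 := ⟨1, Or.inl (by ring)⟩
theorem good3 : Good 3 := ⟨iF * (1 + 2 * wF), Or.inl (by
  linear_combination -(1 + 2 * wF) ^ 2 * iF2 + 4 * wF2)⟩
theorem good7 : Good 7 := ⟨iF, Or.inr (by rw [iF2]; norm_num)⟩

/-- parity -/
def pa : GaussianInt →+* ZMod 2 where
  toFun x := (x.re + x.im : ℤ)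
  map_zero' := by simp
  map_one' := by simp
  map_add' x y := by simp; ring
  map_mul' x y := by
    simp
    ring

/-- 1+i -/
def th : GaussianInt := ⟨1, 1⟩
/-- i -/
def gi : GaussianInt := ⟨0, 1⟩
theorem gi2 : gi ^ 2 = -1 := by decide
theorem th_def : th = 1 + gi := by decide
theorem th_ne : th ≠ 0 := by decide

theorem pa_eq_zero {x : GaussianInt} : pa x = 0 ↔ th ∣ x := by
  constructor
  · intro h
    have h : ((x.re + x.im : ℤ) : ZMod 2) = 0 := h
    rw [ZMod.intCast_zmod_eq_zero_iff_dvd _ 2 |>.trans Iff.rfl] at h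
    obtain ⟨k, hk⟩ := h
    refine ⟨⟨k, k - x.re⟩, ?_⟩
    push_cast at hk
    ext
    · simp [th]
    · simp [th]; linarith
  · rintro ⟨y, rfl⟩
    rw [map_mul, show pa th = 0 by decide, zero_mul]

theorem th_prime : Prime th := by
  refine ⟨th_ne, fun h => ?_, fun a b hab => ?_⟩
  · have := h.map pa
    rw [show pa th = 0 by decide] at this
    exact not_isUnit_zero this
  · rw [← pa_eq_zero, ← pa_eq_zero]
    rw [← pa_eq_zero, map_mul] at hab
    exact mul_eq_zero.1 hab

theorem pa_cases (c : ZMod 2) : c = 0 ∨ c = 1 := by revert c; decide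

theorem odd_sq {x : GaussianInt} (h : pa x = 1) : ∃ k, x ^ 2 = 1 + 2 * k := by
  have : th ∣ x - 1 := by rw [← pa_eq_zero, map_sub, h, map_one, sub_self]
  obtain ⟨k, hk⟩ := this
  refine ⟨th * k + gi * k ^ 2, ?_⟩
  have : x = 1 + th * k := by linear_combination hk
  rw [this, th_def]
  linear_combination k ^ 2 * gi2

theorem prime3 : Prime (3 : GaussianInt) := by
  have : Fact (Nat.Prime 3) := ⟨by norm_num⟩
  exact_mod_cast GaussianInt.prime_of_nat_prime_of_mod_four_eq_three 3 (by norm_num)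
theorem prime7' : Prime (7 : GaussianInt) := by
  exact_mod_cast GaussianInt.prime_of_nat_prime_of_mod_four_eq_three 7 (by norm_num)

theorem dvd21 {g : GaussianInt} (h : g ∣ 21) : ∃ u : GaussianIntˣ, ∃ c : ℤ, g = u * c ∧ (c = 1 ∨ c = 3 ∨ c = 7 ∨ c = 21) := by
  have h7 : ∀ g : GaussianInt, g ∣ 7 → ∃ u : GaussianIntˣ, ∃ c : ℤ, g = u * c ∧ (c = 1 ∨ c = 7) := by
    intro g hg
    rcases prime7'.irreducible.dvd_iff.1 hg with h1 | h1
    · exact ⟨h1.unit, 1, by simp, Or.inl rfl⟩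
    · obtain ⟨u, hu⟩ := h1
      exact ⟨u, 7, by rw [← hu]; push_cast; ring, Or.inr rfl⟩
  by_cases h3 : (3 : GaussianInt) ∣ g
  · obtain ⟨g', rfl⟩ := h3
    obtain ⟨k, hk⟩ := h
    obtain ⟨u, c, h1, h2⟩ := h7 g' ⟨k, by
      apply mul_left_cancel₀ prime3.ne_zero; linear_combination hk⟩
    refine ⟨u, 3 * c, by rw [h1]; push_cast; ring, ?_⟩
    omega
  · have : IsCoprime g 3 := by
      rw [isCoprime_comm, prime3.irreducible.coprime_iff_not_dvd]; exact h3
    obtain ⟨u, c, h1, h2⟩ := h7 g (this.dvd_of_dvd_mul_left (by rw [show (3 : GaussianInt) * 7 = 21 by norm_num]; exact h))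
    exact ⟨u, c, h1, by omega⟩

theorem sqcl {a b n : GaussianInt} (hab : IsCoprime a b) (h : a * b * 3 = n ^ 2) : 
    ∃ u : GaussianIntˣ, ∃ c : ℤ, ∃ m, a = u * c * m ^ 2 ∧ (c = 1 ∨ c = 3) := by
  obtain ⟨n1, rfl⟩ : 3 ∣ n := prime3.dvd_of_dvd_pow (n := 2) ⟨a * b, by rw [← h]; ring⟩
  have h1 : a * b = 3 * n1 ^ 2 := by apply mul_left_cancel₀ prime3.ne_zero; linear_combination h
  rcases prime3.dvd_or_dvd (a := a) (b := b) ⟨_, h1⟩ with ⟨a1, rfl⟩ | ⟨b1, rfl⟩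
  · have h2 : a1 * b = n1 ^ 2 := by apply mul_left_cancel₀ prime3.ne_zero; linear_combination h1
    obtain ⟨d, u, hd⟩ := exists_associated_pow_of_mul_eq_pow' (hab.of_mul_left_right) h2
    exact ⟨u, 3, d, by rw [← hd]; push_cast; ring, Or.inr rfl⟩
  · have h2 : a * b1 = n1 ^ 2 := by apply mul_left_cancel₀ prime3.ne_zero; linear_combination h1
    obtain ⟨d, u, hd⟩ := exists_associated_pow_of_mul_eq_pow' (hab.of_mul_right_right) h2
    exact ⟨u, 1, d, by rw [← hd]; push_cast; ring, Or.inl rfl⟩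

theorem gunit (u : GaussianIntˣ) : (u : GaussianInt) = 1 ∨ (u : GaussianInt) = -1 ∨ (u : GaussianInt) = gi ∨ (u : GaussianInt) = -gi := by
  have h := (Zsqrtd.isUnit_iff_norm_isUnit (u : GaussianInt)).1 u.isUnit
  generalize (u : GaussianInt) = x at *
  obtain ⟨a, b⟩ := x
  rw [Int.isUnit_iff] at h
  simp only [Zsqrtd.norm] at h
  have h1 : a * a + b * b = 1 := by
    rcases h with h | h
    · linarith
    · nlinarith [mul_self_nonneg a, mul_self_nonneg b]
  have ha : a ≤ 1 := by nlinarith [mul_self_nonneg b]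
  have ha' : -1 ≤ a := by nlinarith [mul_self_nonneg b]
  have hb : b ≤ 1 := by nlinarith [mul_self_nonneg a]
  have hb' : -1 ≤ b := by nlinarith [mul_self_nonneg a]
  interval_cases a <;> interval_cases b <;> first | (exfalso; revert h1; norm_num; done) | decide

/-- the octic form -/
def F8 {R : Type*} [CommRing R] (p q : R) : R := 
  (p^2-p*q+q^2)*(p^6+p^5*q-6*p^4*q^2-3*p^3*q^3+14*p^2*q^4-7*p*q^5+q^6)

theorem kap_good (p q1 S g Y a b : GaussianInt) (hp : pa p = 1) (hcop : IsCoprime p (th * q1))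
    (hS : S = p^4-3*p^2*(th*q1)^2+2*p*(th*q1)^3+2*q1^4)
    (hg : g = p^2-2*p*(th*q1)+gi*q1^2)
    (h1 : a + b = S) (h2 : a * b = 3 * (q1 ^ 2 * g) ^ 2) (ha : pa a = 1) : Good (ga a) ∧ a ≠ 0 := by
  have hane : a ≠ 0 := by rintro rfl; rw [map_zero] at ha; exact absurd ha (by decide)
  refine ⟨?_, hane⟩
  have hth2 : th ^ 2 = 2 * gi := by decide
  have hpaS : pa S = 1 := by
    rw [hS]; simp only [map_add, map_sub, map_mul, map_pow, hp, show pa th = 0 by decide, show pa 2 = 0 by decide]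
    ring
  have hpab : pa b = 0 := by
    have := congrArg pa h1
    rw [map_add, ha, hpaS] at this
    linear_combination this
  have hpan : pa (q1 ^ 2 * g) = 0 := by
    have := congrArg pa h2
    rw [map_mul, hpab, mul_zero, map_mul, map_pow, show pa 3 = 1 by decide, one_mul] at this
    exact pow_eq_zero_iff two_ne_zero |>.1 this.symm
  obtain ⟨k, hk⟩ := odd_sq hp
  obtain ⟨n', hn'⟩ := pa_eq_zero.1 hpan
  have htha : IsCoprime (th ^ 2) a := by
    apply IsCoprime.pow_left
    rw [th_prime.irreducible.coprime_iff_not_dvd, ← pa_eq_zero, ha]; decide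
  have hb2 : th ^ 2 ∣ b := by
    apply htha.dvd_of_dvd_mul_left
    rw [h2, hn']; exact ⟨3 * n' ^ 2, by ring⟩
  obtain ⟨b', hb'⟩ := hb2
  have hamod : ∃ k, a = 1 + 2 * k := by
    refine ⟨2*k+2*k^2-3*p^2*gi*q1^2+p*(th*q1)^3+q1^4 - gi * b', ?_⟩
    rw [hth2] at hb'
    have e4 : p ^ 4 = 1 + 2 * (2 * k + 2 * k ^ 2) := by
      calc p ^ 4 = (p ^ 2) ^ 2 := by ring
        _ = _ := by rw [hk]; ring
    linear_combination h1 - hb' + hS + e4 - 3 * p ^ 2 * q1 ^ 2 * hth2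
  -- gcd
  obtain ⟨g0, b1, a1, e2, e1, hc', hg0, -⟩ := red b a hane
  have hc := hc'.symm
  have hg0S : g0 ∣ S := by rw [← h1, e1, e2]; exact dvd_add (dvd_mul_right _ _) (dvd_mul_right _ _)
  have hcopS : IsCoprime S (th * q1) := by
    have h4 : IsCoprime (p ^ 4) (th * q1) := hcop.pow_left
    have := IsCoprime.add_mul_left_left h4 (-3*p^2*(th*q1)+2*p*(th*q1)^2+(1-gi)*q1^3)
    have e : S = p ^ 4 + (th * q1) * (-3*p^2*(th*q1)+2*p*(th*q1)^2+(1-gi)*q1^3) := by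
      rw [hS]
      have : th * (1 - gi) = 2 := by decide
      linear_combination -q1 ^ 4 * this
    rw [e]; exact this
  have hg0q : IsCoprime g0 (th * q1) := hcopS.of_isCoprime_of_dvd_left hg0S
  have hg0q1 : IsCoprime g0 q1 := hg0q.of_mul_right_right
  have hsq : g0 ^ 2 ∣ (3 * g) ^ 2 := by
    have : IsCoprime (g0 ^ 2) (q1 ^ 4) := hg0q1.pow
    apply this.dvd_of_dvd_mul_left
    refine ⟨3 * (a1 * b1), ?_⟩
    rw [e1, e2] at h2
    linear_combination -3 * h2
  have h3g : g0 ∣ 3 * g := (IsIntegrallyClosed.pow_dvd_pow_iff two_ne_zero).1 hsq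
  have h21 : g0 ∣ 21 := by
    have : IsCoprime g0 ((th * q1) ^ 5) := hg0q.pow_right
    apply this.dvd_of_dvd_mul_left
    obtain ⟨s, hs⟩ := hg0S
    obtain ⟨t, ht⟩ := h3g
    refine ⟨-(64 * t * (th * q1) ^ 3 - 4 * (3 * s - t * (p ^ 2 + 2 * p * (th * q1) + gi * q1 ^ 2)) * (8 * p - 13 * (th * q1))), ?_⟩
    have e : -7 * (th * q1) ^ 5 = 64 * g * (th * q1) ^ 3 - 4 * (S - g * (p ^ 2 + 2 * p * (th * q1) + gi * q1 ^ 2)) * (8 * p - 13 * (th * q1)) := by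
      rw [hS, hg]
      obtain ⟨Q, hQ⟩ : ∃ Q, Q = th * q1 := ⟨_, rfl⟩
      have i2 := gi2
      have hQ2 : Q ^ 2 = 2 * (gi * q1 ^ 2) := by rw [hQ, mul_pow, hth2]; ring
      have hQ4 : q1 ^ 4 = - (gi * q1 ^ 2) ^ 2 := by linear_combination q1 ^ 4 * i2
      rw [← hQ, hQ4]
      generalize gi * q1 ^ 2 = v at *
      linear_combination (32*Q^3 + (4*p^2+3*(Q^2+2*v))*(8*p-13*Q)) * hQ2
    linear_combination -3 * e - (64 * (th * q1) ^ 3 + 4 * (p ^ 2 + 2 * p * (th * q1) + gi * q1 ^ 2) * (8 * p - 13 * (th * q1))) * ht + 12 * (8 * p - 13 * (th * q1)) * hs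
  have hn'' : ∃ n, a1 * b1 * 3 = n ^ 2 := by
    have : g0 ∣ 3 * (q1 ^ 2 * g) := by
      apply (IsIntegrallyClosed.pow_dvd_pow_iff two_ne_zero).1
      refine ⟨3 * (a1 * b1), ?_⟩
      rw [e1, e2] at h2
      linear_combination -3 * h2
    obtain ⟨n, hn⟩ := this
    refine ⟨n, ?_⟩
    apply mul_left_cancel₀ (pow_ne_zero 2 hg0)
    rw [e1, e2] at h2
    linear_combination 3 * h2 + (3 * (q1 ^ 2 * g) + g0 * n) * hn
  obtain ⟨n, hn⟩ := hn''
  obtain ⟨u, c, hu, hcc⟩ := dvd21 h21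
  obtain ⟨v, d, m, hv, hd⟩ := sqcl hc hn
  have ea : a = ((u * v : GaussianIntˣ) : GaussianInt) * (c * d : ℤ) * m ^ 2 := by
    rw [e1, hu, hv]; push_cast; ring
  have hgc : Good (ga ((c * d : ℤ) : GaussianInt)) := by
    have g3 := good3
    have g7 := good7
    have g1 := good_one
    rw [map_intCast]
    push_cast
    apply Good.mul
    · rcases hcc with rfl | rfl | rfl | rfl
      · simpa using g1
      · simpa using g3
      · simpa using g7
      · have := g3.mul g7
        norm_num at this ⊢; exact this
    · rcases hd with rfl | rfl
      · simpa using g1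
      · simpa using g3
  rw [ea, map_mul, map_mul, map_pow]
  refine (Good.mul ?_ hgc).mul (good_sq _)
  obtain ⟨k2, hk2⟩ := hamod
  rcases gunit (u * v) with h | h | h | h
  · rw [h, map_one]; exact good_one
  · rw [h, map_neg, map_one]; exact good_neg
  all_goals
    exfalso
    rw [h, hk2] at ea
    have := congrArg Zsqrtd.re ea
    generalize c * d = cd at this
    obtain ⟨x, y⟩ := m
    rw [pow_two] at this
    simp [gi] at this
    ring_nf at this
    generalize cd * x * y = t at this
    omega
end S16

namespace S16
open QuadraticAlgebra

/-- the quartic -/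
def Hf (p q : FF) : FF := p^4-2*p^2*q^2+wF*(2*p^2*q^2-4*p*q^3+q^4)

theorem two_ne_F : (2 : FF) ≠ 0 := by
  intro h
  have := congrArg QuadraticAlgebra.re h
  simp at this

theorem seven_ne_F : (7 : FF) ≠ 0 := by
  have : (7 : GaussianInt) ≠ 0 := prime7'.ne_zero
  have := ga_ne this
  rwa [show (7 : GaussianInt) = 1+1+1+1+1+1+1 by decide, map_add, map_add, map_add, map_add, map_add, map_add, map_one, show (1+1+1+1+1+1+1 : FF) = 7 by norm_num] at this

theorem ga_two : ga 2 = 2 := by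
  rw [show (2 : GaussianInt) = 1+1 by decide, map_add, map_one]; norm_num

theorem h_good_aux (p q1 Y a b : GaussianInt) (hp : pa p = 1) (hcop : IsCoprime p (th * q1))
    (hY : Y ^ 2 = F8 p (th * q1))
    (ha : p^4-3*p^2*(th*q1)^2+2*p*(th*q1)^3+2*q1^4 + Y = 2 * a)
    (hb : p^4-3*p^2*(th*q1)^2+2*p*(th*q1)^3+2*q1^4 - Y = 2 * b)
    (h2 : a * b = 3 * (q1 ^ 2 * (p^2-2*p*(th*q1)+gi*q1^2)) ^ 2) (hpa : pa a = 1) :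
    Good (Hf (ga p) (ga (th * q1))) := by
  obtain ⟨⟨r, hr⟩, hane⟩ := kap_good p q1 _ _ Y a b hp hcop rfl rfl (by
    have : (2 : GaussianInt) ≠ 0 := by decide
    apply mul_left_cancel₀ this
    linear_combination -ha - hb) h2 hpa
  have hga := ga_ne hane
  have h2F := two_ne_F
  have h7F := seven_ne_F
  have hrne : r ≠ 0 := by
    rintro rfl
    apply hga
    rcases hr with h | h <;> rw [h] <;> ring
  have hq : 2 * q1 ^ 4 * 2 = - (th * q1) ^ 4 := by
    have : th ^ 4 = -4 := by decide
    linear_combination q1 ^ 4 * this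
  have hκ : 4 * ga a = 2 * ga Y + 2 * ga p ^ 4 - 6 * ga p ^ 2 * ga (th * q1) ^ 2 + 4 * ga p * ga (th * q1) ^ 3 - ga (th * q1) ^ 4 := by
    have h := congrArg ga (show 2 * (2 * a) = 2 * Y + 2 * p ^ 4 - (2 + 2 + 2) * p ^ 2 * (th * q1) ^ 2 + (2 + 2) * p * (th * q1) ^ 3 - (th * q1) ^ 4 by
      linear_combination -2 * ha + hq)
    simp only [map_add, map_sub, map_mul ga 2, map_mul ga _ (p ^ _), map_mul ga _ p, map_mul ga _ ((th * q1) ^ _), map_pow, ga_two] at h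
    linear_combination h
  have hY' : ga Y ^ 2 = F8 (ga p) (ga (th * q1)) := by
    have h := congrArg ga hY
    rw [map_pow] at h
    rw [h]
    simp only [F8, map_add, map_sub, map_mul ga (_ - _ + _), map_mul ga _ (p ^ _), map_mul ga _ p, map_mul ga _ ((th * q1) ^ _), map_mul ga _ ((th * q1)), map_pow]
    congr
  generalize ga (th * q1) = Q at *
  generalize ga p = P at *
  have key : Hf P Q * (4 * ga a) = (ga Y + Hf P Q) ^ 2 := by
    rw [hκ]
    have : (ga Y + Hf P Q) ^ 2 = F8 P Q + 2 * ga Y * Hf P Q + Hf P Q ^ 2 := by rw [← hY']; ring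
    rw [this]
    simp only [Hf, F8]
    have hw := wF2
    linear_combination (-(2*P^2*Q^2-4*P*Q^3+Q^4) ^ 2) * hw
  rcases hr with h | h
  · refine ⟨(ga Y + Hf P Q) / (2 * r), Or.inl ?_⟩
    rw [h] at key
    field_simp
    linear_combination key
  · refine ⟨(ga Y + Hf P Q) / (14 * r), Or.inr ?_⟩
    rw [h] at key
    have h14 : (14 : FF) ≠ 0 := by rw [show (14 : FF) = 2 * 7 by norm_num]; exact mul_ne_zero h2F h7F
    field_simp
    linear_combination -7 * key

theorem h_good (p q1 Y : GaussianInt) (hp : pa p = 1) (hcop : IsCoprime p (th * q1))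
    (hY : Y ^ 2 = F8 p (th * q1)) : Good (Hf (ga p) (ga (th * q1))) := by
  obtain ⟨S, hS⟩ : ∃ S, S = p^4-3*p^2*(th*q1)^2+2*p*(th*q1)^3+2*q1^4 := ⟨_, rfl⟩
  obtain ⟨g, hg⟩ : ∃ g, g = p^2-2*p*(th*q1)+gi*q1^2 := ⟨_, rfl⟩
  have hth2 : th ^ 2 = 2 * gi := by decide
  have e1 : (S - Y) * (S + Y) = 12 * (q1 ^ 2 * g) ^ 2 := by
    have : (S - Y) * (S + Y) = S ^ 2 - F8 p (th * q1) := by rw [← hY]; ring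
    rw [this, hS, hg]
    obtain ⟨Q, hQ⟩ : ∃ Q, Q = th * q1 := ⟨_, rfl⟩
    have i2 := gi2
    have hQ2 : Q ^ 2 = 2 * (gi * q1 ^ 2) := by rw [hQ, mul_pow, hth2]; ring
    have hQ4 : q1 ^ 4 = - (gi * q1 ^ 2) ^ 2 := by linear_combination q1 ^ 4 * i2
    rw [mul_pow (q1 ^ 2), show (q1 ^ 2) ^ 2 = q1 ^ 4 by ring, ← hQ, hQ4]
    generalize gi * q1 ^ 2 = v at *
    clear * - hQ2
    simp only [F8]
    grind
  have hx : ∃ x1, Y - S = th * x1 := by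
    apply th_prime.dvd_of_dvd_pow (n := 2)
    refine ⟨th * (-gi) * (-6*(q1 ^ 2 * g)^2-S*(Y-S)), ?_⟩
    have i2 := gi2
    linear_combination -e1 + gi * (-6*(q1 ^ 2 * g)^2-S*(Y-S)) * hth2 + 2 * (-6*(q1 ^ 2 * g)^2-S*(Y-S)) * i2
  obtain ⟨x1, hx1⟩ := hx
  have hx2 : ∃ x2, x1 = th * x2 := by
    apply th_prime.dvd_of_dvd_pow (n := 2)
    refine ⟨(-gi) * (-3*(1-gi)*(q1 ^ 2 * g)^2-S*x1), ?_⟩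
    have h6 : th * (3 * (1 - gi)) = 6 := by decide
    have h7 : th ^ 2 * (-gi) = 2 := by decide
    have e2 : (th * x1) ^ 2 = 2 * (-6*(q1 ^ 2 * g)^2-S*(th * x1)) := by rw [← hx1]; linear_combination -e1
    apply mul_left_cancel₀ (pow_ne_zero 2 th_ne)
    linear_combination e2 - (-6*(q1 ^ 2 * g)^2-S*(th * x1)) * h7 + th ^ 2 * (-gi) * (q1 ^ 2 * g)^2 * h6
  obtain ⟨x2, rfl⟩ := hx2
  obtain ⟨b, hb⟩ : ∃ b, S - Y = 2 * b := ⟨-gi * x2, by linear_combination -hx1 - x2 * hth2⟩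
  obtain ⟨a, ha⟩ : ∃ a, S + Y = 2 * a := ⟨S - b, by linear_combination -hb⟩
  have hab : a * b = 3 * (q1 ^ 2 * g) ^ 2 := by
    have : (4 : GaussianInt) ≠ 0 := by decide
    apply mul_left_cancel₀ this
    rw [ha, hb] at e1
    linear_combination e1
  have hpaS : pa S = 1 := by
    rw [hS]; simp only [map_add, map_sub, map_mul, map_pow, hp, show pa th = 0 by decide, show pa 2 = 0 by decide]
    ring
  have hs : a + b = S := by
    have : (2 : GaussianInt) ≠ 0 := by decide
    apply mul_left_cancel₀ this
    linear_combination -ha - hb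
  rw [hS] at ha hb
  rw [hg] at hab
  rcases pa_cases (pa a) with h | h
  · have hb1 : pa b = 1 := by
      have := congrArg pa hs
      rw [map_add, h, hpaS, zero_add] at this
      exact this
    exact h_good_aux p q1 (-Y) b a hp hcop (by rw [neg_sq]; exact hY) (by linear_combination hb) (by linear_combination ha) (by rw [← hab]; ring) hb1
  · exact h_good_aux p q1 Y a b hp hcop hY ha hb hab h
end S16

namespace S16
open QuadraticAlgebra

/-- embedding -/
def em : kk →+* FF where
  toFun x := ⟨x, 0⟩
  map_zero' := by ext1 <;> simp
  map_one' := by ext1 <;> simp [QuadraticAlgebra.re_one, QuadraticAlgebra.im_one]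
  map_add' x y := by ext1 <;> simp
  map_mul' x y := by ext1 <;> simp
theorem em_re (x : kk) : (em x).re = x := rfl
theorem em_im (x : kk) : (em x).im = 0 := rfl
theorem em_wk : em wk = wF := rfl
theorem em2 : em 2 = 2 := by rw [← one_add_one_eq_two, map_add, map_one]; norm_num
theorem em3 : em 3 = 3 := by rw [show (3 : kk) = 1+1+1 by norm_num, map_add, map_add, map_one]; norm_num
theorem em4 : em 4 = 4 := by rw [show (4 : kk) = 2+2 by norm_num, map_add, em2]; norm_num

theorem dec (c : kk) (z y : FF) (h : em ((1+2*wk)^3*c) * y^2 = em (-3-2*wk) - em (4*wk) * z^3) :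
    (1+2*wk)^3*c*(y.re^2-y.im^2) = (-3-2*wk) - 4*wk*(z.re^3-3*z.re*z.im^2) ∧ 
    (1+2*wk)^3*c*(2*y.re*y.im) = - (4*wk*(3*z.re^2*z.im-z.im^3)) := by
  have h1 := congrArg QuadraticAlgebra.re h
  have h2 := congrArg QuadraticAlgebra.im h
  rw [show y ^ 2 = y * y by ring, show z ^ 3 = z * (z * z) by ring] at h1 h2
  simp only [re_mul, im_mul, re_sub, im_sub, em_re, em_im] at h1 h2
  constructor
  · linear_combination h1
  · linear_combination h2

theorem step (c z0 z1 y0 y1 : kk)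
    (hre : (1+2*wk)^3*c*(y0^2-y1^2) = (-3-2*wk) - 4*wk*(z0^3-3*z0*z1^2))
    (him : (1+2*wk)^3*c*(2*y0*y1) = - (4*wk*(3*z0^2*z1-z1^3))) (hz : z1 ≠ 0) :
    ∃ μ z3 y3, μ * z1 = y1 ∧ 4*wk*(z3+2*z0) = -(1+2*wk)^3*c*μ^2 ∧ y3 = y0+μ*(z3-z0) ∧ 
      (1+2*wk)^3*c*y3^2 = (-3-2*wk) - 4*wk*z3^3 ∧ (1+2*wk)^3*c*(2*y0*μ) = - (4*wk*(3*z0^2-z1^2)) := by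
  have h4 : (4 * wk : kk) ≠ 0 := mul_ne_zero (by rw [show (4 : kk) = 2 * 2 by norm_num]; exact mul_ne_zero two_ne_k two_ne_k) wk_ne
  obtain ⟨μ, rfl⟩ : ∃ μ, y1 = μ * z1 := ⟨y1 / z1, by field_simp⟩
  obtain ⟨z3, hz3⟩ : ∃ z3, 4*wk*(z3+2*z0) = -(1+2*wk)^3*c*μ^2 := 
    ⟨-(1+2*wk)^3*c*μ^2 / (4 * wk) - 2 * z0, by rw [sub_add_cancel, mul_div_cancel₀ _ h4]⟩
  have h5 : (1+2*wk)^3*c*(2*y0*μ) = - (4*wk*(3*z0^2-z1^2)) := by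
    apply mul_right_cancel₀ hz; linear_combination him
  refine ⟨μ, z3, _, rfl, hz3, rfl, ?_, h5⟩
  linear_combination hre + (z3 - z0) * h5 + ((z3-z0)^2+z1^2) * hz3

/-- the rational Gaussian numbers in FF -/
def gq (a b : ℚ) : FF := ⟨⟨a, 0⟩, ⟨b, 0⟩⟩

theorem wk_re : wk.re = 0 := by simp [wk, io, w_re]
theorem wk_im : wk.im = 1 := by simp [wk, io, w_im]

theorem fin_ab (a b : ℚ) (e1 : 2*b^2+b^3-4*a-4*a*b-3*a*b^2+6*a^2+3*a^2*b-2*a^3 = 0)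
    (e2 : 4*b+3*b^3+4*a-6*a*b-6*a^2+3*a^3 = 0) : 
    (a = 0 ∧ b = 0) ∨ (a = 2/3 ∧ b = -2/3) ∨ (a = 4/3 ∧ b = 2/3) := by
  have : a * (3*a-2)^2*(3*a-4)^2 = 0 := by
    linear_combination (-16 + 18*b-39*b^2+27/2*b^3-81/4*b^4+42*a-60*a*b+54*a*b^2-81/4*a*b^3-30*a^2+81/2*a^2*b) * e1 + (8*b-5*b^2+9*b^3+27/4*b^4-6*a-37*a*b-9/2*a*b^2-27/2*a*b^3+7*a^2+27*a^2*b) * e2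
  rcases mul_eq_zero.1 this with h | h
  · rcases mul_eq_zero.1 h with h | h
    · subst h
      left
      refine ⟨rfl, ?_⟩
      have : b * (3*b^2+4) = 0 := by linear_combination e2
      rcases mul_eq_zero.1 this with h | h
      · exact h
      · nlinarith [sq_nonneg b]
    · have h : a = 2/3 := by have := pow_eq_zero_iff two_ne_zero |>.1 h; linarith
      subst h
      right; left
      refine ⟨rfl, ?_⟩
      linear_combination -3/4 * e1 + 1/4 * e2
  · have h : a = 4/3 := by have := pow_eq_zero_iff two_ne_zero |>.1 h; linarith
    subst h
    right; right
    refine ⟨rfl, ?_⟩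
    have : b * (3*b-2) = 0 := by linear_combination 1/2*e2-3/2*e1
    rcases mul_eq_zero.1 this with h | h
    · subst h; norm_num at e2
    · linarith

theorem fin_L1 (x0 x1 : ℚ) (hx1 : x1 ≠ 0) (c2 c1 c0 μ A : kk) (hA : 9 * A = 8 + 4 * wk)
    (h2 : c2 = 3*A-2*μ) (h1 : c1 = -3*A+(1+2*wk)*μ^2-4*wk*μ) (h0 : c0 = μ^2*(-2-wk)-2*(-1-wk)*μ)
    (k1 : em c2 * gq x0 x1 ^ 2 + em c1 * gq x0 x1 + em c0 = 0) : False := by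
  have p1 := congrArg QuadraticAlgebra.re k1
  have p2 := congrArg QuadraticAlgebra.im k1
  rw [pow_two] at p1 p2
  simp only [re_add, im_add, re_mul, im_mul, em_re, em_im, gq, QuadraticAlgebra.re_zero, QuadraticAlgebra.im_zero] at p1 p2
  have p1r := congrArg QuadraticAlgebra.re p1
  have p1i := congrArg QuadraticAlgebra.im p1
  have p2r := congrArg QuadraticAlgebra.re p2
  have p2i := congrArg QuadraticAlgebra.im p2
  simp at p1r p1i p2r p2i
  have q1r : c1.re = -2*x0*c2.re := by apply mul_right_cancel₀ hx1; linear_combination p2r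
  have q1i : c1.im = -2*x0*c2.im := by apply mul_right_cancel₀ hx1; linear_combination p2i
  have q0r : c0.re = (x0^2+x1^2)*c2.re := by linear_combination p1r - x0 * q1r
  have q0i : c0.im = (x0^2+x1^2)*c2.im := by linear_combination p1i - x0 * q1i
  obtain ⟨a, b⟩ := μ
  have hA' : A = ⟨8/9, 4/9⟩ := by
    have a1 := congrArg QuadraticAlgebra.re hA
    have a2 := congrArg QuadraticAlgebra.im hA
    simp [wk_re, wk_im] at a1 a2
    ext
    · simp; linarith
    · simp; linarith
  have E1 : c1.re * c2.im - c1.im * c2.re = 0 := by rw [q1r, q1i]; ring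
  have E2 : c0.re * c2.im - c0.im * c2.re = 0 := by rw [q0r, q0i]; ring
  have s2r : c2.re = 8/3-2*a := by rw [h2, hA']; simp; ring
  have s2i : c2.im = 4/3-2*b := by rw [h2, hA']; simp; ring
  have s1r : c1.re = -8/3+a^2+b^2-4*a*b+4*b := by rw [h1, hA', pow_two]; simp [wk_re, wk_im]; ring
  have s1i : c1.im = -4/3+2*a^2-b^2-2*a*b-4*a+4*b := by rw [h1, hA', pow_two]; simp [wk_re, wk_im]; ring
  have s0r : c0.re = -2*a^2+b^2+2*a*b+2*a-2*b := by rw [h0, pow_two]; simp [wk_re, wk_im]; ring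
  have s0i : c0.im = -a^2+2*b^2-2*a*b+2*a := by rw [h0, pow_two]; simp [wk_re, wk_im]; ring
  rw [s1r, s1i, s2r, s2i] at E1
  rw [s0r, s0i, s2r, s2i] at E2
  rw [s2r, s1r] at q1r
  rw [s2r, s0r] at q0r
  rcases fin_ab a b (by linear_combination -1/2*E1) (by linear_combination -3/2*E2) with ⟨rfl, rfl⟩ | ⟨rfl, rfl⟩ | ⟨rfl, rfl⟩
  · have : x0^2+x1^2 = 0 := by linear_combination -3/8 * q0r
    exact hx1 (by nlinarith [sq_nonneg x0, sq_nonneg x1])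
  · have h : x0 = 1 := by linear_combination 3/8*q1r
    subst h
    have : x1^2 = 0 := by linear_combination -3/4 * q0r
    exact hx1 (by nlinarith)
  · norm_num at q1r

theorem L1 (x0 x1 : ℚ) (z : FF) (y0 μ : kk) (hz1 : z.im ≠ 0)
    (hx : z * (gq x0 x1 + wF) = gq x0 x1 + wF ^ 2)
    (h1 : 4*wk*(1+2*z.re) = -(1+2*wk)^3*1*μ^2) (h2 : 1 = y0 + μ * (1 - z.re))
    (h3 : (1+2*wk)^3*1*(2*y0*μ) = - (4*wk*(3*z.re^2-z.im^2))) : False := by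
  have hw := wk2
  have hx1 : x1 ≠ 0 := by
    rintro rfl
    have p := congrArg QuadraticAlgebra.im hx
    have e2 : (wF ^ 2).im = 0 := by rw [pow_two]; simp [wF]
    simp only [re_add, im_add, re_mul, im_mul, e2, gq] at p
    have hw0 : wF.im = 0 := rfl
    have hw1 : wF.re = wk := rfl
    rw [hw0, hw1] at p
    have p' : z.im * (⟨x0, 0⟩ + wk) = 0 := by
      have z0 : (⟨0, 0⟩ : kk) = 0 := rfl
      rw [z0] at p
      linear_combination p
    rcases mul_eq_zero.1 p' with h | h
    · exact hz1 h
    · have := congrArg QuadraticAlgebra.im h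
      simp [wk_im] at this
  obtain ⟨A, hA⟩ : ∃ A : kk, A = ⟨8/9, 4/9⟩ := ⟨_, rfl⟩
  have h9 : 9 * A = 8 + 4 * wk := by
    rw [hA]; ext <;> simp [wk_re, wk_im] <;> norm_num
  have h9n : (9 : kk) ≠ 0 := by
    intro h; have := congrArg QuadraticAlgebra.re h; simp at this
  have hlA : 4 * wk = -(1+2*wk)^3 * A := by
    apply mul_left_cancel₀ h9n
    have : (1+2*wk)^3 = -3 - 6 * wk := by grind
    rw [this]
    linear_combination (-(3 + 6 * wk)) * h9 - 24 * hw
  have hl3 : (1+2*wk)^3 ≠ 0 := pow_ne_zero 3 lk_ne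
  have g1 : A * (1+2*z.re) = μ^2 := by
    apply mul_left_cancel₀ hl3
    linear_combination -h1 + (1+2*z.re) * hlA
  have g3 : 2*y0*μ = A * (3*z.re^2-z.im^2) := by
    apply mul_left_cancel₀ hl3
    linear_combination h3 - (3*z.re^2-z.im^2) * hlA
  have gN : A * (z.re^2+z.im^2) = A + μ^2 - 2*μ := by
    linear_combination 2 * μ * h2 + g3 - (1 - 2 * z.re) * g1
  have hz : z ^ 2 = 2 * em z.re * z - em (z.re^2+z.im^2) := by
    rw [pow_two, ← em2]
    ext1
    · simp only [re_mul, im_mul, re_sub, im_sub, em_re, em_im]; ring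
    · simp only [re_mul, im_mul, re_sub, im_sub, em_re, em_im]; ring
  have hq : em A * z^2 + em (A - μ^2) * z + em (A + μ^2 - 2*μ) = 0 := by
    rw [hz, ← gN, ← g1]
    simp only [map_mul, map_add, map_sub, map_pow, map_one, em2]
    ring
  refine fin_L1 x0 x1 hx1 _ _ _ μ A h9 rfl rfl rfl ?_
  generalize gq x0 x1 = X at *
  have key : em A * (X + wF^2)^2 + em (A - μ^2) * (X + wF^2) * (X + wF) + em (A + μ^2 - 2*μ) * (X + wF)^2 = 0 := by
    rw [← hx]
    linear_combination (X + wF)^2 * hq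
  simp only [map_mul, map_add, map_sub, map_pow, map_one, map_neg, em2, em3, em4, em_wk] at key ⊢
  have hW := wF2
  rw [hW] at key
  generalize em A = A' at *
  generalize em μ = m at *
  clear * - key hW
  linear_combination key + (-A' + 2 * m - 2 * m ^ 2) * hW
end S16

namespace S16
open QuadraticAlgebra

theorem gq_mul (a b c d : ℚ) : gq a b * gq c d = gq (a*c-b*d) (a*d+b*c) := by
  ext1
  · ext <;> simp [gq] <;> ring
  · ext <;> simp [gq]
theorem gq_zero {a b : ℚ} (h : gq a b = 0) : a = 0 ∧ b = 0 := by
  have h1 := congrArg (fun x => x.re.re) h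
  have h2 := congrArg (fun x => x.im.re) h
  simpa [gq] using And.intro h1 h2

theorem L2 (p0 p1 q0 q1 : ℚ) (z : FF) (y0 μ : kk) (hz1 : z.im ≠ 0) 
    (hD : gq p0 p1 + wF * gq q0 q1 ≠ 0)
    (hx : z * (gq p0 p1 + wF * gq q0 q1) = gq p0 p1 + wF ^ 2 * gq q0 q1)
    (h1 : 4*wk*(1+2*z.re) = -(1+2*wk)^3*1*μ^2) (h2 : 1 = y0 + μ * (1 - z.re))
    (h3 : (1+2*wk)^3*1*(2*y0*μ) = - (4*wk*(3*z.re^2-z.im^2))) : False := by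
  by_cases hq : gq q0 q1 = 0
  · rw [hq, mul_zero, add_zero] at hD
    rw [hq, mul_zero, mul_zero, add_zero] at hx
    have : z = 1 := by apply mul_right_cancel₀ hD; rw [hx, one_mul]
    rw [this, QuadraticAlgebra.im_one] at hz1
    exact hz1 rfl
  · have hN : q0^2+q1^2 ≠ 0 := by
      intro h
      apply hq
      have a1 : q0 = 0 := by nlinarith [sq_nonneg q0, sq_nonneg q1]
      have a2 : q1 = 0 := by nlinarith [sq_nonneg q0, sq_nonneg q1]
      rw [a1, a2]; rfl
    have hxq : gq ((p0*q0+p1*q1)/(q0^2+q1^2)) ((p1*q0-p0*q1)/(q0^2+q1^2)) * gq q0 q1 = gq p0 p1 := by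
      rw [gq_mul]
      congr 1 <;> field_simp <;> ring
    refine L1 ((p0*q0+p1*q1)/(q0^2+q1^2)) ((p1*q0-p0*q1)/(q0^2+q1^2)) z y0 μ hz1 ?_ h1 h2 h3
    apply mul_right_cancel₀ hq
    rw [← hxq] at hx
    linear_combination hx

theorem L3 (p0 p1 q0 q1 : ℚ) (z : FF) (y0 μ z3 y3 ρ s : kk) (hz1 : z.im ≠ 0) 
    (hD : gq p0 p1 + wF * gq q0 q1 ≠ 0)
    (hρ : ρ * z3 = 1) (hρ3 : ρ ^ 3 = 1) (hs : s * y3 = 1) (hs2 : s ^ 2 = 1)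
    (hx : em ρ * z * (gq p0 p1 + wF * gq q0 q1) = gq p0 p1 + wF ^ 2 * gq q0 q1)
    (h1 : 4*wk*(z3+2*z.re) = -(1+2*wk)^3*1*μ^2) (h2 : y3 = y0 + μ * (z3 - z.re))
    (h3 : (1+2*wk)^3*1*(2*y0*μ) = - (4*wk*(3*z.re^2-z.im^2))) : False := by
  have hz3 : z3 = ρ ^ 2 := by linear_combination ρ ^ 2 * hρ - z3 * hρ3
  have hρne : ρ ≠ 0 := by rintro rfl; simp at hρ3
  have er : (em ρ * z).re = ρ * z.re := by simp [em]
  have ei : (em ρ * z).im = ρ * z.im := by simp [em]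
  refine L2 p0 p1 q0 q1 (em ρ * z) (s * y0) (s * ρ^2 * μ) (by rw [ei]; exact mul_ne_zero hρne hz1) hD hx ?_ ?_ ?_
  · rw [er]
    linear_combination ρ * h1 - 4 * wk * hρ - (1+2*wk)^3*μ^2*(ρ * hρ3 * s ^ 2 + ρ * hs2) * (-1)
  · rw [er]
    linear_combination s * h2 - hs + s * μ * hz3 + (-s * μ * z.re) * hρ3 * (-1)
  · rw [er, ei]
    linear_combination ρ ^ 2 * h3 + ρ^2 * ((1+2*wk)^3*(2*y0*μ)) * hs2

theorem nosq (m T : Eis) (h : T ^ 2 = -1 + 4 * m) : False := by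
  obtain ⟨s, t⟩ := T
  obtain ⟨u, v⟩ := m
  have e1 := congrArg QuadraticAlgebra.re h
  have e2 := congrArg QuadraticAlgebra.im h
  rw [pow_two] at e1 e2
  simp [QuadraticAlgebra.re_one, QuadraticAlgebra.im_one] at e1 e2
  have f1 := congrArg (Int.cast : ℤ → ZMod 4) e1
  have f2 := congrArg (Int.cast : ℤ → ZMod 4) e2
  push_cast at f1 f2
  have h4 : (4 : ZMod 4) = 0 := rfl
  rw [h4] at f1 f2
  generalize (s : ZMod 4) = s at *
  generalize (t : ZMod 4) = t at *
  generalize (u : ZMod 4) = u at *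
  generalize (v : ZMod 4) = v at *
  clear * - f1 f2
  rw [zero_mul] at f1 f2
  clear u v
  revert s t
  decide

theorem nosqk (m : Eis) (T : kk) (h : T ^ 2 = io (-1 + 4 * m)) : False := by
  obtain ⟨n, d, hd, hT⟩ := frac T
  have h1 : n ^ 2 = (-1 + 4 * m) * d ^ 2 := by
    apply io_inj
    rw [map_pow, ← hT, map_mul, ← h, map_pow]; ring
  obtain ⟨k, rfl⟩ : d ∣ n := (IsIntegrallyClosed.pow_dvd_pow_iff two_ne_zero).1 ⟨_, h1.trans (mul_comm _ _)⟩
  apply nosq m k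
  apply mul_left_cancel₀ (pow_ne_zero 2 hd)
  linear_combination h1

theorem caseY0 (D R : ℤ) (hD : Odd D) (hR : Even R) (c z y : kk) (hc : c = 1 ∨ c = -7)
   (hne : (D + wk * R : kk) ≠ 0)
   (hz : z * (D + wk * R) = D + wk^2 * R) (h : (1+2*wk)^3*c*(-y^2) = (-3-2*wk) - 4*wk*z^3) : False := by
  obtain ⟨d, rfl⟩ := hD
  obtain ⟨r, rfl⟩ := hR
  have hw := wk2
  have hl3 : (1+2*wk)^3 ≠ 0 := pow_ne_zero 3 lk_ne
  have h1 : -c * (y * (((2*d+1:ℤ):kk) + wk * ((r+r:ℤ):kk))^2)^2 = ((2*d+1:ℤ):kk)^4-2*((2*d+1:ℤ):kk)^2*((r+r:ℤ):kk)^2+wk*(2*((2*d+1:ℤ):kk)^2*((r+r:ℤ):kk)^2-4*((2*d+1:ℤ):kk)*((r+r:ℤ):kk)^3+((r+r:ℤ):kk)^4) := by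
    generalize ((2*d+1:ℤ):kk) = P at *
    generalize ((r+r:ℤ):kk) = Q at *
    apply mul_left_cancel₀ hl3
    have : (1+2*wk)^3*(P^4-2*P^2*Q^2+wk*(2*P^2*Q^2-4*P*Q^3+Q^4)) = (-3-2*wk)*(P+wk*Q)^4 - 4*wk*(P+wk^2*Q)^3*(P+wk*Q) := by
      grind
    rw [this, ← hz]
    linear_combination (P + wk * Q)^4 * h
  have hcastI : ∀ n : ℤ, io (n : Eis) = (n : kk) := fun n => map_intCast io n
  obtain ⟨m, hm⟩ : ∃ m : Eis, ((2*d+1:ℤ):kk)^4-2*((2*d+1:ℤ):kk)^2*((r+r:ℤ):kk)^2+wk*(2*((2*d+1:ℤ):kk)^2*((r+r:ℤ):kk)^2-4*((2*d+1:ℤ):kk)*((r+r:ℤ):kk)^3+((r+r:ℤ):kk)^4) = 1 + 4 * io m := by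
    refine ⟨((4*d^4+8*d^3+6*d^2+2*d - 2 * (2*d+1)^2*r^2 : ℤ) : Eis) + w * ((2*(2*d+1)^2*r^2-8*(2*d+1)*r^3+4*r^4 : ℤ) : Eis), ?_⟩
    rw [map_add, map_mul, hcastI, hcastI, iow]
    push_cast
    ring
  rw [hm] at h1
  generalize y * (((2*d+1:ℤ):kk) + wk * ((r+r:ℤ):kk))^2 = T at *
  rcases hc with rfl | rfl
  · apply nosqk (-m) T
    simp only [map_add, map_neg, map_mul, io4, map_one]
    linear_combination -h1
  · apply nosqk (2 + 7 * m) (7 * T)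
    have io7 : io 7 = 7 := by rw [show (7 : Eis) = 4 + 3 by decide, map_add, io3, io4]; norm_num
    simp only [map_add, map_neg, map_mul, io4, io7, io2, map_one]
    linear_combination 7 * h1

theorem ga_gq (x : GaussianInt) : ga x = gq x.re x.im := by
  ext1
  · ext <;> simp [ga, gq]
  · ext <;> simp [ga, gq]

set_option maxHeartbeats 4000000 in
theorem thmC1 (p q1 : GaussianInt) (hp : pa p = 1) (hG : Good (Hf (ga p) (ga (th * q1)))) : 
    p * (th * q1) * (p - th * q1) = 0 := by
  obtain ⟨q, hq⟩ : ∃ q, q = th * q1 := ⟨_, rfl⟩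
  have hpq : pa q = 0 := by rw [hq, map_mul, show pa th = 0 by decide, zero_mul]
  rw [← hq] at hG ⊢
  clear hq
  have hw := wF2
  have hwk := wk2
  have hcomp : ∀ a b : ℤ, (a : kk) + wk * (b : kk) = 0 → a = 0 := by
    intro a b h
    have := congrArg QuadraticAlgebra.re h
    simpa [wk_re, wk_im] using this
  have hDn : ga p + wF * ga q ≠ 0 := by
    intro h
    have h1 := congrArg QuadraticAlgebra.re h
    have h2 := congrArg QuadraticAlgebra.im h
    simp only [re_add, im_add, re_mul, im_mul, ga_re, ga_im, wF, QuadraticAlgebra.re_zero, QuadraticAlgebra.im_zero] at h1 h2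
    have a1 := hcomp p.re q.re (by linear_combination h1)
    have a2 := hcomp p.im q.im (by linear_combination h2)
    have : p = 0 := by ext <;> simp [a1, a2]
    rw [this, map_zero] at hp
    exact absurd hp (by decide)
  obtain ⟨z, hz⟩ : ∃ z, z * (ga p + wF * ga q) = ga p + wF^2 * ga q := ⟨_, div_mul_cancel₀ _ hDn⟩
  obtain ⟨c, t, hc, ht⟩ : ∃ c : kk, ∃ t : FF, (c = 1 ∨ c = -7) ∧ Hf (ga p) (ga q) = em c * t ^ 2 := by
    obtain ⟨t, h | h⟩ := hG
    · exact ⟨1, t, Or.inl rfl, by rw [map_one, one_mul, h]⟩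
    · refine ⟨-7, t, Or.inr rfl, ?_⟩
      rw [h, map_neg, show (7 : kk) = 4 + 3 by norm_num, map_add, em4, em3]; norm_num
  have hcne : c ≠ 0 := by
    rcases hc with rfl | rfl
    · exact one_ne_zero
    · intro h; have := congrArg QuadraticAlgebra.re h; simp at this
  obtain ⟨y, hy⟩ : ∃ y, y * (ga p + wF * ga q)^2 = t := ⟨_, div_mul_cancel₀ _ (pow_ne_zero 2 hDn)⟩
  have hE : em ((1+2*wk)^3*c) * y^2 = em (-3-2*wk) - em (4*wk) * z^3 := by
    apply mul_right_cancel₀ (pow_ne_zero 4 hDn)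
    simp only [map_mul, map_add, map_sub, map_pow, map_one, map_neg, em2, em3, em4, em_wk]
    have : (1+2*wF)^3*Hf (ga p) (ga q) = (-3-2*wF)*(ga p+wF*ga q)^4 - 4*wF*(ga p+wF^2*ga q)^3*(ga p+wF*ga q) := by
      simp only [Hf]
      generalize ga p = P
      generalize ga q = Q
      clear * - hw
      grind
    rw [ht, ← hy, ← hz] at this
    linear_combination this
  obtain ⟨hre, him⟩ := dec c z y hE
  by_cases hz1 : z.im = 0
  · rw [hz1] at hre him
    have hl3 : (1+2*wk)^3 ≠ 0 := pow_ne_zero 3 lk_ne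
    have h00 : y.re * y.im = 0 := by
      have : ((1+2*wk)^3*c*2) * (y.re * y.im) = 0 := by linear_combination him
      rcases mul_eq_zero.1 this with h | h
      · exact absurd h (mul_ne_zero (mul_ne_zero hl3 hcne) two_ne_k)
      · exact h
    have hz0 : z = em z.re := by ext1 <;> simp [em, hz1]
    rcases mul_eq_zero.1 h00 with h0 | h0
    · exfalso
      rw [h0] at hre
      have z1 := congrArg QuadraticAlgebra.re hz
      have z2 := congrArg QuadraticAlgebra.im hz
      have ew : wF ^ 2 = em (wk ^ 2) := by rw [map_pow]; rfl
      rw [ew] at z1 z2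
      simp only [re_add, im_add, re_mul, im_mul, ga_re, ga_im, wF, em_re, em_im, hz1] at z1 z2
      have z1' : z.re * (p.re + wk * q.re) = p.re + wk ^ 2 * q.re := by linear_combination z1
      have z2' : z.re * (p.im + wk * q.im) = p.im + wk ^ 2 * q.im := by linear_combination z2
      have hdet : p.re * q.im = p.im * q.re := by
        have : (1 + 2 * wk) * ((p.re * q.im - p.im * q.re : ℤ) : kk) = 0 := by
          have e : ((p.re:kk) + wk ^ 2 * q.re) * (p.im + wk * q.im) = (p.im + wk ^ 2 * q.im) * (p.re + wk * q.re) := by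
            rw [← z1', ← z2']; ring
          push_cast
          linear_combination e - ((p.im:kk) * q.re - p.re * q.im) * hwk
        rcases mul_eq_zero.1 this with h | h
        · exact absurd h lk_ne
        · have := int_inj h
          omega
      have podd : Odd (p.re + p.im) := by
        rw [← Int.not_even_iff_odd]
        intro h
        have h1 : ((p.re + p.im : ℤ) : ZMod 2) = 1 := hp
        have h2 : ((p.re + p.im : ℤ) : ZMod 2) = 0 := (ZMod.intCast_zmod_eq_zero_iff_dvd _ 2).2 h.two_dvd
        rw [h2] at h1
        exact absurd h1 (by decide)
      have qev : Even (q.re + q.im) := by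
        have h2 : ((q.re + q.im : ℤ) : ZMod 2) = 0 := hpq
        exact even_iff_two_dvd.2 ((ZMod.intCast_zmod_eq_zero_iff_dvd _ 2).1 h2)
      have hpar := congrArg (fun n : ℤ => Even n) hdet
      simp only [Int.even_mul] at hpar
      rw [Int.odd_add] at podd
      rw [Int.even_add] at qev
      rcases Int.even_or_odd p.re with h | h
      · have hpi : Odd p.im := by rw [← Int.not_even_iff_odd]; rw [← Int.not_even_iff_odd] at podd; tauto
        have hqi : Even q.im := by
          rw [← Int.not_even_iff_odd] at hpi
          have : (Even p.re ∨ Even q.im) ↔ (Even p.im ∨ Even q.re) := by rw [hpar]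
          tauto
        refine caseY0 p.im q.im hpi hqi c z.re y.im hc ?_ z2' (by linear_combination hre)
        intro h'
        have := hcomp _ _ h'
        rw [this] at hpi
        exact absurd hpi (by decide)
      · have hpi : Even p.im := by rw [← Int.not_even_iff_odd] at podd h; tauto
        have hqi : Even q.re := by
          rw [← Int.not_even_iff_odd] at h
          have : (Even p.re ∨ Even q.im) ↔ (Even p.im ∨ Even q.re) := by rw [hpar]
          tauto
        refine caseY0 p.re q.re h hqi c z.re y.im hc ?_ z1' (by linear_combination hre)
        intro h'
        have := hcomp _ _ h'
        rw [this] at h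
        exact absurd h (by decide)
    · rw [h0] at hre
      rcases hc with rfl | rfl
      · have h3 := thmA z.re y.re (by linear_combination hre)
        have h4 : z ^ 3 = 1 := by rw [hz0, ← map_pow, h3, map_one]
        have h5 : ga (p * q * (p - q)) = 0 := by
          simp only [map_mul, map_sub]
          have h6 : (ga p + wF^2 * ga q)^3 = (ga p + wF * ga q)^3 := by
            rw [← hz, mul_pow, h4, one_mul]
          have h7 : (wF ^ 2 - wF) * 3 ≠ 0 := by
            intro h
            have : (wF ^ 2 - wF) * 3 = em (-(1 + 2 * wk) * 3) := by
              simp only [map_mul, map_add, map_neg, em_wk, em2, em3, map_one, hw]; ring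
            rw [this] at h
            have h' : (-(1 + 2 * wk) * 3 : kk) = 0 := congrArg QuadraticAlgebra.re h
            have h3 : (3 : kk) ≠ 0 := by intro h; have := congrArg QuadraticAlgebra.re h; simp at this
            exact (mul_ne_zero (neg_ne_zero.2 lk_ne) h3) h'
          have w3 : wF ^ 3 = 1 := by clear * - hw; grind
          apply mul_left_cancel₀ h7
          generalize ga p = P at *
          generalize ga q = Q at *
          clear * - h6 hw w3
          have w4 : wF ^ 4 = wF := by grind
          have w6 : wF ^ 6 = 1 := by grind
          linear_combination h6 - 3*P*Q^2*w4 - Q^3 * (w6 - w3)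
        by_contra hne
        exact ga_ne hne h5
      · exact (thmB z.re y.re (by linear_combination hre)).elim
  · exfalso
    obtain ⟨μ, z3, y3, -, k1, k2, k3, k4⟩ := step c z.re z.im y.re y.im hre him hz1
    rcases hc with rfl | rfl
    · have h3 := thmA z3 y3 (by linear_combination k3)
      have hl3 : (1+2*wk)^3 ≠ 0 := pow_ne_zero 3 lk_ne
      have hy3 : y3 ^ 2 = 1 := by
        apply mul_left_cancel₀ hl3
        have : (1+2*wk)^3 = -3 - 6 * wk := by clear * - hwk; grind
        linear_combination k3 - 4 * wk * h3 - this
      have hs2 : y3 * y3 = 1 := by linear_combination hy3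
      have hP := ga_gq p
      have hQ := ga_gq q
      have hQP : ga q - ga p = gq (q.re - p.re) (q.im - p.im) := by
        rw [hP, hQ]; ext1 <;> ext <;> simp [gq]
      have hPn : - ga p = gq (-p.re) (-p.im) := by
        rw [hP]; ext1 <;> ext <;> simp [gq]
      have w3 : wk ^ 3 = 1 := by clear * - hwk; grind
      have w3F : wF ^ 3 = 1 := by clear * - hw; grind
      have hfac : (z3 - 1) * ((z3 - wk^2) * (z3 - wk)) = 0 := by
        have e1 : (z3 - wk^2) * (z3 - wk) = z3^2 + z3 + 1 := by clear * - hwk; grind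
        rw [e1]; linear_combination h3
      have hWne : wF ≠ 0 := by
        intro h; rw [h] at w3F; simp at w3F
      rcases mul_eq_zero.1 hfac with h | h
      · have h : z3 = 1 := by linear_combination h
        refine L3 p.re p.im q.re q.im z y.re μ z3 y3 1 y3 hz1 ?_ (by rw [h, one_mul]) (one_pow 3) hs2 hy3 ?_ k1 k2 k4
        · rw [← hP, ← hQ]; exact hDn
        · rw [← hP, ← hQ, map_one, one_mul]; exact hz
      rcases mul_eq_zero.1 h with h | h
      · have h : z3 = wk^2 := by linear_combination h
        refine L3 q.re q.im (q.re - p.re) (q.im - p.im) z y.re μ z3 y3 wk y3 hz1 ?_ (by rw [h]; linear_combination w3) w3 hs2 hy3 ?_ k1 k2 k4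
        · have := hQP
          push_cast at this
          rw [← this, ← hQ]
          have e : ga q + wF * (ga q - ga p) = -wF * (ga p + wF * ga q) := by linear_combination ga q * hw
          rw [e]; exact mul_ne_zero (neg_ne_zero.2 hWne) hDn
        · have := hQP
          push_cast at this
          rw [← this, ← hQ, em_wk]
          linear_combination (-wF^2) * hz + (wF * z * ga q - ga q * (1 - wF + wF^2)) * hw
      · have h : z3 = wk := by linear_combination h
        refine L3 (q.re - p.re) (q.im - p.im) (-p.re) (-p.im) z y.re μ z3 y3 (wk^2) y3 hz1 ?_ (by rw [h]; linear_combination w3) (by rw [← pow_mul, mul_comm, pow_mul, w3, one_pow]) hs2 hy3 ?_ k1 k2 k4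
        · have h1 := hQP
          have h2 := hPn
          push_cast at h1 h2
          rw [← h1, ← h2]
          have e : ga q - ga p + wF * (- ga p) = wF^2 * (ga p + wF * ga q) := by linear_combination -ga p * hw - ga q * w3F
          rw [e]; exact mul_ne_zero (pow_ne_zero 2 hWne) hDn
        · have h1 := hQP
          have h2 := hPn
          push_cast at h1 h2
          rw [← h1, ← h2, map_pow, em_wk]
          linear_combination wF * hz + (-z * ga p * wF + ga p + ga q * (wF - 1)) * hw
    · exact thmB z3 y3 (by linear_combination k3)

theorem F8_rot {R : Type*} [CommRing R] (p q : R) : F8 q (q - p) = F8 p q := by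
  simp only [F8]; ring

theorem thmC_even (p q Y : GaussianInt) (hp : pa p = 1) (hq : pa q = 0) (hc : IsCoprime p q) (hY : Y ^ 2 = F8 p q) :
    p * q * (p - q) = 0 := by
  obtain ⟨q1, rfl⟩ := pa_eq_zero.1 hq
  exact thmC1 p q1 hp (h_good p q1 Y hp hc hY)

theorem thmC (p q Y : GaussianInt) (hc : IsCoprime p q) (hY : Y ^ 2 = F8 p q) :
    p * q * (p - q) = 0 := by
  have c1 : IsCoprime q (q - p) := by
    have := IsCoprime.add_mul_left_right (hc.symm.neg_right) 1
    rwa [mul_one, neg_add_eq_sub] at this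
  have c2 : IsCoprime (q - p) (q - p - q) := by
    have := IsCoprime.add_mul_left_right (c1.symm.neg_right) 1
    rwa [mul_one, neg_add_eq_sub] at this
  rcases pa_cases (pa p) with hp | hp
  · rcases pa_cases (pa q) with hq | hq
    · exact absurd (hc.isUnit_of_dvd' (pa_eq_zero.1 hp) (pa_eq_zero.1 hq)) th_prime.not_isUnit
    · have h := thmC_even (q - p) (q - p - q) Y (by rw [map_sub, hp, hq, sub_zero]) (by rw [map_sub, map_sub, hp, hq]; decide) c2 (by rw [F8_rot, F8_rot]; exact hY)
      linear_combination h
  · rcases pa_cases (pa q) with hq | hq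
    · exact thmC_even p q Y hp hq hc hY
    · have h := thmC_even q (q - p) Y hq (by rw [map_sub, hp, hq, sub_self]) c1 (by rw [F8_rot]; exact hY)
      linear_combination -h
end S16

namespace S16

theorem ex_phi (K : Type*) [Field K] [Algebra ℚ K] [IsCyclotomicExtension {4} ℚ K] :
    ∃ φ : GaussianInt →+* K, Function.Injective φ ∧
      ∀ x, ∃ p q, q ≠ 0 ∧ IsCoprime p q ∧ x * φ q = φ p := by
  haveI : CharZero K := algebraRat.charZero K
  have hζ := IsCyclotomicExtension.zeta_spec 4 ℚ K
  set ζ := IsCyclotomicExtension.zeta 4 ℚ K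
  have h2 : ζ * ζ = ((-1 : ℤ) : K) := by
    have h4 : ζ ^ 4 = 1 := hζ.pow_eq_one
    have hne : ζ ^ 2 ≠ 1 := hζ.pow_ne_one_of_pos_of_lt (by norm_num) (by norm_num)
    have : (ζ ^ 2 - 1) * (ζ ^ 2 + 1) = 0 := by linear_combination h4
    rcases mul_eq_zero.1 this with h | h
    · exact absurd (sub_eq_zero.1 h) hne
    · push_cast; linear_combination h
  have htop := IsCyclotomicExtension.adjoin_primitive_root_eq_top (A := ℚ) hζ
  have hinj := Zsqrtd.lift_injective (R := K) (d := -1) ⟨ζ, h2⟩ (fun n => by nlinarith [mul_self_nonneg n])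
  set φ : GaussianInt →+* K := Zsqrtd.lift ⟨ζ, h2⟩ with hφ
  refine ⟨φ, hinj, ?_⟩
  have hne : ∀ q, q ≠ 0 → φ q ≠ 0 := fun q hq h => hq (hinj (h.trans (map_zero φ).symm))
  have key : ∀ x : K, ∃ p q, q ≠ 0 ∧ x * φ q = φ p := by
    intro x
    have hx : x ∈ Algebra.adjoin ℚ ({ζ} : Set K) := by rw [htop]; trivial
    induction hx using Algebra.adjoin_induction with
    | mem x hx =>
      rw [Set.mem_singleton_iff] at hx
      subst hx
      refine ⟨⟨0, 1⟩, 1, one_ne_zero, ?_⟩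
      simp [hφ, Zsqrtd.lift]
    | algebraMap r =>
      refine ⟨(r.num : GaussianInt), (r.den : GaussianInt), ?_, ?_⟩
      · exact_mod_cast r.den_ne_zero
      · rw [map_intCast, map_natCast]
        have : (r : K) * r.den = r.num := by exact_mod_cast Rat.mul_den_eq_num r
        rw [← this]; simp
    | add x y _ _ h1 h2 =>
      obtain ⟨p, q, h, e⟩ := h1
      obtain ⟨p', q', h', e'⟩ := h2
      refine ⟨p * q' + p' * q, q * q', mul_ne_zero h h', ?_⟩
      simp only [map_add, map_mul]
      linear_combination φ q' * e + φ q * e'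
    | mul x y _ _ h1 h2 =>
      obtain ⟨p, q, h, e⟩ := h1
      obtain ⟨p', q', h', e'⟩ := h2
      refine ⟨p * p', q * q', mul_ne_zero h h', ?_⟩
      simp only [map_mul]
      rw [← e, ← e']; ring
  intro x
  obtain ⟨p, q, hq, e⟩ := key x
  obtain ⟨g, n1, d1, rfl, rfl, hc, hg, hd⟩ := red p q hq
  refine ⟨n1, d1, hd, hc, ?_⟩
  apply mul_left_cancel₀ (hne g hg)
  simp only [map_mul] at e
  linear_combination e

section

theorem par {K : Type*} [Field K] (φ : GaussianInt →+* K) (hi : Function.Injective φ)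
    (hf : ∀ x, ∃ p q, q ≠ 0 ∧ IsCoprime p q ∧ x * φ q = φ p) (x : K) : ∃ p q, x * φ q = φ p ∧ ¬ (pa p = 0 ∧ pa q = 0) := by
  obtain ⟨p, q, hq, ⟨a, b, hc⟩, e⟩ := hf x
  refine ⟨p, q, e, ?_⟩
  rintro ⟨h1, h2⟩
  have := congrArg pa hc
  rw [map_add, map_mul, map_mul, h1, h2] at this
  revert this
  rw [map_one]; simp

theorem par3 {K : Type*} [Field K] (φ : GaussianInt →+* K) (hi : Function.Injective φ)
    (hf : ∀ x, ∃ p q, q ≠ 0 ∧ IsCoprime p q ∧ x * φ q = φ p) (s t : K) (h : s ^ 2 - s * t + t ^ 2 = 0) : t = 0 := by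
  by_contra ht
  obtain ⟨p, q, e, hn⟩ := par φ hi hf (s / t)
  have e : s * φ q = φ p * t := by
    field_simp at e; linear_combination e
  have h0 : φ (p ^ 2 - p * q + q ^ 2) = 0 := by
    apply mul_left_cancel₀ (pow_ne_zero 2 ht)
    simp only [map_add, map_sub, map_mul, map_pow]
    linear_combination φ q ^ 2 * h - (φ p * t + s * φ q) * e + t * φ q * e
  have h1 := congrArg pa (hi (h0.trans (map_zero φ).symm))
  simp only [map_add, map_sub, map_mul, map_pow, map_zero] at h1
  generalize pa p = P at *
  generalize pa q = Q at *
  revert P Q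
  decide

theorem parc {K : Type*} [Field K] (φ : GaussianInt →+* K) (hi : Function.Injective φ)
    (hf : ∀ x, ∃ p q, q ≠ 0 ∧ IsCoprime p q ∧ x * φ q = φ p) (d : K) (m n : GaussianInt) (h : d ^ 3 + 2 * φ m * d ^ 2 + (1 + 2 * φ n) * d + 1 = 0) : False := by
  obtain ⟨p, q, e, hn⟩ := par φ hi hf d
  have h0 : φ (p ^ 3 + 2 * m * p ^ 2 * q + (1 + 2 * n) * p * q ^ 2 + q ^ 3) = 0 := by
    simp only [map_add, map_mul, map_pow, map_one, map_ofNat, ← e]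
    linear_combination φ q ^ 3 * h
  have h1 := congrArg pa (hi (h0.trans (map_zero φ).symm))
  have p2 : pa 2 = 0 := by decide
  simp only [map_add, map_mul, map_pow, map_zero, map_one, p2] at h1
  generalize pa p = P at *
  generalize pa q = Q at *
  generalize pa m = m at *
  generalize pa n = n at *
  revert P Q m n
  decide

theorem thmCK {K : Type*} [Field K] (φ : GaussianInt →+* K) (hi : Function.Injective φ)
    (hf : ∀ x, ∃ p q, q ≠ 0 ∧ IsCoprime p q ∧ x * φ q = φ p) (x y : K) (h : y ^ 2 = (x^2-x+1)*(x^6+x^5-6*x^4-3*x^3+14*x^2-7*x+1)) : x = 0 ∨ x = 1 := by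
  have hne : ∀ q, q ≠ 0 → φ q ≠ 0 := fun q hq h => hq (hi (h.trans (map_zero φ).symm))
  obtain ⟨p, q, hq, hc, e⟩ := hf x
  obtain ⟨n, d, hd, -, e2⟩ := hf (y * φ q ^ 4)
  have h1 : n ^ 2 = F8 p q * d ^ 2 := by
    apply hi
    simp only [F8, map_add, map_sub, map_mul, map_pow, map_ofNat, ← e, ← e2]
    linear_combination φ q ^ 8 * φ d ^ 2 * h
  obtain ⟨k, rfl⟩ : d ∣ n := (IsIntegrallyClosed.pow_dvd_pow_iff two_ne_zero).1 ⟨_, h1.trans (mul_comm _ _)⟩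
  have h2 := thmC p q k hc (by
    apply mul_left_cancel₀ (pow_ne_zero 2 hd)
    linear_combination h1)
  have h3 := congrArg φ h2
  simp only [map_mul, map_sub, map_zero, ← e] at h3
  have hQ := hne q hq
  have h4 : φ q ^ 3 * (x * (x - 1)) = 0 := by linear_combination h3
  rcases mul_eq_zero.1 h4 with h | h
  · exact absurd h (pow_ne_zero 3 hQ)
  rcases mul_eq_zero.1 h with h | h
  · exact Or.inl h
  · exact Or.inr (sub_eq_zero.1 h)

/-- The curve `X_H`: no point with given `d` and root `v`. -/
theorem noV {K : Type*} [Field K] (φ : GaussianInt →+* K) (hi : Function.Injective φ)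
    (hf : ∀ x, ∃ p q, q ≠ 0 ∧ IsCoprime p q ∧ x * φ q = φ p) (d h v : K) (hd0 : d ≠ 0) (hd1 : d ≠ 1) (hh : h * (d ^ 2 - d) = d^3-8*d^2+5*d+1)
    (hV : v^4-h*v^3-3*h*v^2-7*h*v+h^2 = 0) : False := by
  have hh0 : h ≠ 0 := by
    rintro rfl
    apply parc φ hi hf d (-4) 2
    simp only [map_neg, map_ofNat]
    linear_combination -hh
  have hv0 : v ≠ 0 := by
    rintro rfl
    exact pow_ne_zero 2 hh0 (by linear_combination hV)
  obtain ⟨w, hw⟩ : ∃ w, w * v = h := ⟨h / v, div_mul_cancel₀ _ hv0⟩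
  have hw2 : w^2-w*(v^2+3*v+7)+v^2 = 0 := by
    apply mul_left_cancel₀ (pow_ne_zero 2 hv0)
    rw [← hw] at hV
    linear_combination hV
  obtain ⟨s, hs⟩ : ∃ s, w = s + 1 := ⟨w - 1, by ring⟩
  obtain ⟨t, ht⟩ : ∃ t, v = t - 2 := ⟨v + 2, by ring⟩
  have hC : d^3-8*d^2+5*d+1 - (s+1)*(t-2)*(d^2-d) = 0 := by rw [← hs, ← ht, hw]; linear_combination -hh
  have hQ : s^2+s*t-s*t^2-3*s-3*t = 0 := by rw [hs, ht] at hw2; linear_combination hw2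
  have hden : d * t + s - t ≠ 0 := by
    intro h0
    by_cases t0 : t = 0
    · have s0 : s = 0 := by rw [t0] at h0; linear_combination h0
      rw [t0, s0] at hC
      apply parc φ hi hf d (-3) 1
      simp only [map_neg, map_ofNat, map_one]
      linear_combination hC
    · obtain ⟨e, he⟩ : ∃ e, d = 1 - e := ⟨1 - d, by ring⟩
      have hse : s = t * e := by rw [he] at h0; linear_combination h0
      rw [hse] at hQ
      rw [hse, he] at hC
      have hE : t*e*(e+1)-t^2*e-3*(e+1) = 0 := by
        apply mul_left_cancel₀ t0
        linear_combination hQ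
      have hn : e^2-e+1 ≠ 0 := by
        intro h
        exact one_ne_zero (par3 φ hi hf e 1 (by linear_combination h))
      have hH : t*(e^2-e)-(2*e-1) = 0 := by
        apply mul_left_cancel₀ hn
        linear_combination -hC + (e^2-e)*hE
      have : e * (e^2-e+1)^2 = 0 := by
        linear_combination -(e^2-e)^2*hE + ((e^2-e)*e*(e+1)-e*(t*(e^2-e)+2*e-1))*hH
      rcases mul_eq_zero.1 this with h | h
      · exact hd1 (by rw [he, h]; ring)
      · exact pow_ne_zero 2 hn h
  obtain ⟨x, hx⟩ : ∃ x, x * (d * t + s - t) = d * s - t := ⟨_, div_mul_cancel₀ _ hden⟩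
  have hxc : x^3-3*x+1 = t*(x^2-x) := by
    apply mul_left_cancel₀ (pow_ne_zero 3 hden)
    have hG : (d*s-t)^3-3*(d*s-t)*(d * t + s - t)^2+(d * t + s - t)^3-t*(d*s-t)^2*(d * t + s - t)+t*(d*s-t)*(d * t + s - t)^2 = 0 := by
      linear_combination ((1)*d^0*s^3*t^0 + (-3)*d^0*s^1*t^2 + (1)*d^0*s^0*t^3 + (-1)*d^0*s^2*t^2 + (1)*d^0*s^1*t^3)*hC + ((1)*d^2*s^2*t^1 + (-1)*d^1*s^2*t^1 + (-2)*d^2*s^2*t^0 + (2)*d^1*s^2*t^0 + (-1)*d^2*s^1*t^2 + (1)*d^1*s^1*t^2 + (5)*d^2*s^1*t^1 + (-5)*d^1*s^1*t^1 + (-2)*d^2*s^0*t^2 + (2)*d^1*s^0*t^2)*hQ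
    rw [← hx] at hG
    linear_combination hG
  have hx1 : x^2-x ≠ 0 := by
    intro h
    rw [h, mul_zero] at hxc
    have : (1 : K) = 0 := by linear_combination -4 * h + (2 * x - 1) * ((x + 1) * h - hxc)
    exact one_ne_zero this
  have hn : x^2-x+1 ≠ 0 := by
    intro h
    exact one_ne_zero (par3 φ hi hf x 1 (by linear_combination h))
  obtain ⟨y, hy⟩ : ∃ y, y * (x^2-x+1) = (2*w-v^2-3*v-7)*(x^2-x)^2 := ⟨_, div_mul_cancel₀ _ hn⟩
  have := thmCK φ hi hf x y (by
    apply mul_left_cancel₀ (pow_ne_zero 2 hn)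
    have e1 : (2*w-v^2-3*v-7)^2 = (t^2+t+1)*(t^2-3*t+9) := by
      rw [ht]; rw [ht] at hw2; linear_combination 4 * hw2
    have e2 : (t^2-3*t+9)*(x^2-x)^2 = (x^2-x+1)^3 := by
      linear_combination -(t*(x^2-x)+(x^3-3*x+1)-3*(x^2-x))*hxc
    have e3 : (t^2+t+1)*(x^2-x)^2 = x^6+x^5-6*x^4-3*x^3+14*x^2-7*x+1 := by
      linear_combination -(t*(x^2-x)+(x^3-3*x+1)+(x^2-x))*hxc
    have e4 : (x^2-x+1)^2*y^2 = ((t^2+t+1)*(x^2-x)^2)*((t^2-3*t+9)*(x^2-x)^2) := by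
      linear_combination (y * (x^2-x+1) + (2*w-v^2-3*v-7)*(x^2-x)^2)*hy + (x^2-x)^4*e1
    rw [e4, e2, e3]; ring)
  apply hx1
  rcases this with rfl | rfl <;> ring

theorem part1 {K : Type*} [Field K] (φ : GaussianInt →+* K) (hi : Function.Injective φ)
    (hf : ∀ x, ∃ p q, q ≠ 0 ∧ IsCoprime p q ∧ x * φ q = φ p) (d X : K) (hd0 : d ≠ 0) (hd1 : d ≠ 1) (h2 : (2 : K) ≠ 0) (h3 : (3 : K) ≠ 0)
    (hX : 3*X^4+((1+d-d^2)^2+4*(d^2-d^3))*X^3+3*((1+d-d^2)*(d^2-d^3))*X^2+3*(d^2-d^3)^2*X+(d^2-d^3)^3=0) : False := by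
  obtain ⟨b2, hb2⟩ : ∃ b, b = (1+d-d^2)^2+4*(d^2-d^3) := ⟨_, rfl⟩
  obtain ⟨t, ht⟩ : ∃ t, t = 12*X+b2 := ⟨_, rfl⟩
  obtain ⟨c4, hc4⟩ : ∃ b, b = b2^2-24*((1+d-d^2)*(d^2-d^3)) := ⟨_, rfl⟩
  obtain ⟨c6, hc6⟩ : ∃ b, b = -b2^3+36*b2*((1+d-d^2)*(d^2-d^3))-216*(d^2-d^3)^2 := ⟨_, rfl⟩
  have ht4 : t^4-6*c4*t^2-8*c6*t-3*c4^2 = 0 := by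
    rw [ht, hc4, hc6, hb2]
    linear_combination 6912 * hX
  have hc40 : c4 ≠ 0 := by
    intro h
    rw [hc4, hb2] at h
    obtain ⟨p, q, e, hn⟩ := par φ hi hf d
    have h0 : φ (((q^2+p*q-p^2)^2+4*(p^2*q^2-p^3*q))^2-24*((q^2+p*q-p^2)*(p^2*q^2-p^3*q)*q^2)) = 0 := by
      simp only [map_add, map_sub, map_mul, map_pow, map_one, map_ofNat, ← e]
      linear_combination φ q ^ 8 * h
    have h1 := congrArg pa (hi (h0.trans (map_zero φ).symm))
    have p2 : pa 4 = 0 := by decide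
    have p3 : pa 24 = 0 := by decide
    simp only [map_add, map_sub, map_mul, map_pow, map_zero, map_one, p2, p3] at h1
    generalize pa p = P at *
    generalize pa q = Q at *
    revert P Q
    decide
  have ht0 : t ≠ 0 := by
    rintro rfl
    exact mul_ne_zero h3 (pow_ne_zero 2 hc40) (by linear_combination -ht4)
  obtain ⟨S, hS⟩ : ∃ S, S = (d^2-d+1)*(3*c4-2*b2*t-t^2) := ⟨_, rfl⟩
  obtain ⟨T, hT⟩ : ∃ T, T = 24*t*d^2*(d-1) := ⟨_, rfl⟩
  have hd1' : d - 1 ≠ 0 := sub_ne_zero.2 hd1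
  have hT0 : T ≠ 0 := by
    rw [hT, show (24 : K) = 2^3*3 by norm_num]
    exact mul_ne_zero (mul_ne_zero (mul_ne_zero (mul_ne_zero (pow_ne_zero 3 h2) h3) ht0) (pow_ne_zero 2 hd0)) hd1'
  have hD : d^2-d ≠ 0 := by
    rw [show d^2-d = d*(d-1) by ring]; exact mul_ne_zero hd0 hd1'
  have hV : (d^2-d)^2*(S+(2*d-3)*T)^4 - (d^3-8*d^2+5*d+1)*(d^2-d)*(S+(2*d-3)*T)^3*(T-S)
      - 3*(d^3-8*d^2+5*d+1)*(d^2-d)*(S+(2*d-3)*T)^2*(T-S)^2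
      - 7*(d^3-8*d^2+5*d+1)*(d^2-d)*(S+(2*d-3)*T)*(T-S)^3
      + (d^3-8*d^2+5*d+1)^2*(T-S)^4 = 0 := by
    rw [hS, hT, hc4, hb2]
    rw [hc4, hc6, hb2] at ht4
    linear_combination ((-27*d^0 - 243*d^1 + 648*d^2 + 6075*d^3 - 21465*d^4 - 36612*d^5 + 331101*d^6 - 627831*d^7 - 433026*d^8 + 4474845*d^9 - 9396729*d^10 + 5845122*d^11 + 17400987*d^12 - 57123711*d^13 + 83492694*d^14 - 53139051*d^15 - 53843778*d^16 + 205913745*d^17 - 333819333*d^18 + 378823554*d^19 - 332173305*d^20 + 232619661*d^21 - 131334858*d^22 + 59568777*d^23 - 21412539*d^24 + 5958684*d^25 - 1240353*d^26 + 184059*d^27 - 18144*d^28 + 1053*d^29 - 27*d^30)*t^0 + (18*d^0 + 90*d^1 - 540*d^2 - 630*d^3 + 8640*d^4 - 21114*d^5 + 7866*d^6 + 79740*d^7 - 234090*d^8 + 312210*d^9 - 89208*d^10 - 528282*d^11 + 1329768*d^12 - 1902510*d^13 + 1951830*d^14 - 1523844*d^15 + 918522*d^16 - 423738*d^17 + 145440*d^18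 - 35190*d^19 + 5508*d^20 - 486*d^21 + 18*d^22)*t^2 + (8*d^0 + 24*d^1 - 216*d^2 + 224*d^3 + 1488*d^4 - 7056*d^5 + 17584*d^6 - 32640*d^7 + 51096*d^8 - 70328*d^9 + 83832*d^10 - 83520*d^11 + 67088*d^12 - 42000*d^13 + 19728*d^14 - 6560*d^15 + 1416*d^16 - 168*d^17 + 8*d^18)*t^3 + (1*d^0 + 1*d^1 - 20*d^2 + 59*d^3 - 71*d^4 - 42*d^5 + 325*d^6 - 673*d^7 + 877*d^8 - 810*d^9 + 545*d^10 - 261*d^11 + 84*d^12 - 15*d^13 + 1*d^14)*t^4) * ht4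
  have hTS : T - S ≠ 0 := by
    intro h
    rw [h] at hV
    have h1 : (d^2-d)^2*(S+(2*d-3)*T)^4 = 0 := by linear_combination hV
    have h5 : S+(2*d-3)*T = 2*(d-1)*T := by linear_combination -h
    rw [h5] at h1
    exact mul_ne_zero (pow_ne_zero 2 hD) (pow_ne_zero 4 (mul_ne_zero (mul_ne_zero h2 hd1') hT0)) h1
  obtain ⟨v, hv⟩ : ∃ v, v * (T - S) = S+(2*d-3)*T := ⟨_, div_mul_cancel₀ _ hTS⟩
  obtain ⟨h, hh⟩ : ∃ h, h * (d^2-d) = d^3-8*d^2+5*d+1 := ⟨_, div_mul_cancel₀ _ hD⟩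
  apply noV φ hi hf d h v hd0 hd1 hh
  rw [← hv, ← hh] at hV
  apply mul_left_cancel₀ (mul_ne_zero (pow_ne_zero 2 hD) (pow_ne_zero 4 hTS))
  linear_combination hV
end
end S16

namespace S16

section
variable {F : Type*} [Field F] [DecidableEq F] {W : WeierstrassCurve.Affine F}

/-- x-coordinate of a point (junk value 0 at infinity). -/
def xc (P : W.Point) : F :=
  match P with
  | .zero => 0
  | .some x _ _ => x

theorem xc_some (x y : F) (h : W.Nonsingular x y) : xc (.some x y h : W.Point) = x := rfl

theorem xc_neg (P : W.Point) : xc (-P) = xc P := by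
  cases P <;> rfl

theorem xc_eq {P Q : W.Point} (hP : P ≠ 0) (hQ : Q ≠ 0) (h : xc P = xc Q) : P = Q ∨ P = -Q := by
  rcases P with _ | ⟨x1, y1, h1⟩
  · exact absurd rfl hP
  rcases Q with _ | ⟨x2, y2, h2⟩
  · exact absurd rfl hQ
  rw [xc_some, xc_some] at h
  subst h
  rcases Y_eq_of_X_eq h1.1 h2.1 rfl with rfl | rfl
  · exact Or.inl rfl
  · exact Or.inr rfl

theorem add_ne {x1 y1 x2 y2 x3 y3 : F} {h1 : W.Nonsingular x1 y1} {h2 : W.Nonsingular x2 y2} {h3 : W.Nonsingular x3 y3}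
    (hx : x1 ≠ x2) (h : (.some x1 y1 h1 + .some x2 y2 h2 : W.Point) = .some x3 y3 h3) :
    ∃ m, m * (x2 - x1) = y2 - y1 ∧ x3 = m^2 + W.a₁*m - W.a₂ - x1 - x2 ∧ y3 = -(m*(x3-x1)+y1)-W.a₁*x3-W.a₃ := by
  rw [Point.add_of_X_ne hx] at h
  simp only [Point.some.injEq] at h
  obtain ⟨e1, e2⟩ := h
  refine ⟨W.slope x1 x2 y1 y2, ?_, ?_, ?_⟩
  · rw [slope_of_X_ne hx]
    have : x1 - x2 ≠ 0 := sub_ne_zero.2 hx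
    field_simp; ring
  · rw [← e1]; rfl
  · rw [← e2, ← e1]; rfl

theorem add_dbl {x1 y1 x3 y3 : F} {h1 : W.Nonsingular x1 y1} {h3 : W.Nonsingular x3 y3}
    (h : (.some x1 y1 h1 + .some x1 y1 h1 : W.Point) = .some x3 y3 h3) :
    ∃ m, m * (2*y1+W.a₁*x1+W.a₃) = 3*x1^2+2*W.a₂*x1+W.a₄-W.a₁*y1 ∧ 2*y1+W.a₁*x1+W.a₃ ≠ 0 ∧
      x3 = m^2 + W.a₁*m - W.a₂ - x1 - x1 ∧ y3 = -(m*(x3-x1)+y1)-W.a₁*x3-W.a₃ := by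
  by_cases hy : y1 = W.negY x1 y1
  · rw [Point.add_self_of_Y_eq hy] at h
    exact absurd h.symm (Point.some_ne_zero h3)
  rw [Point.add_self_of_Y_ne hy] at h
  simp only [Point.some.injEq] at h
  obtain ⟨e1, e2⟩ := h
  have hne : 2*y1+W.a₁*x1+W.a₃ ≠ 0 := by
    intro h0; apply hy; rw [negY]; linear_combination h0
  refine ⟨W.slope x1 x1 y1 y1, ?_, hne, ?_, ?_⟩
  · rw [slope_of_Y_ne rfl hy, negY, show y1 - (-y1 - W.a₁*x1-W.a₃) = 2*y1+W.a₁*x1+W.a₃ by ring]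
    exact div_mul_cancel₀ _ hne
  · rw [← e1]; rfl
  · rw [← e2, ← e1]; rfl

theorem ex_some {P : W.Point} (hP : P ≠ 0) : ∃ x y h, P = .some x y h := by
  rcases P with _ | ⟨x1, y1, h1⟩
  · exact absurd rfl hP
  exact ⟨_, _, _, rfl⟩

theorem lem3 (R : W.Point) (hR : R ≠ 0) (h3 : 3 • R = 0) :
    3*(xc R)^4 + W.b₂*(xc R)^3 + 3*W.b₄*(xc R)^2 + 3*W.b₆*(xc R) + W.b₈ = 0 := by
  have h2 : R + R = -R := by
    rw [eq_neg_iff_add_eq_zero, ← h3]; abel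
  have hx := xc_neg R
  rw [← h2] at hx
  have hne : R + R ≠ 0 := by rw [h2]; exact neg_ne_zero.2 hR
  obtain ⟨x, y, h, rfl⟩ := ex_some hR
  obtain ⟨x3, y3, h3', e⟩ := ex_some hne
  obtain ⟨m, e1, -, e2, -⟩ := add_dbl e
  rw [e, xc_some, xc_some] at hx
  rw [xc_some]
  have hc := (W.equation_iff x y).1 h.1
  simp only [WeierstrassCurve.b₂, WeierstrassCurve.b₄, WeierstrassCurve.b₆, WeierstrassCurve.b₈]
  have hG : 3*x + W.a₂ - W.a₁*m - m^2 = 0 := by linear_combination e2 - hx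
  linear_combination (2*y+W.a₁*x+W.a₃)^2 * hG + W.a₁*(2*y+W.a₁*x+W.a₃)*e1 + (m*(2*y+W.a₁*x+W.a₃) + (3*x^2+2*W.a₂*x+W.a₄-W.a₁*y))*e1 - (12*x+W.a₁^2+4*W.a₂)*hc

theorem ord7 {G : Type*} [AddCommGroup G] {Q : G} (hQ : Q ≠ 0) (h7 : 7 • Q = 0) :
    2 • Q ≠ 0 ∧ 3 • Q ≠ 0 ∧ 4 • Q ≠ 0 := by
  refine ⟨fun h => hQ ?_, fun h => hQ ?_, fun h => hQ ?_⟩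
  · calc Q = 7 • Q - 3 • (2 • Q) := by abel
      _ = 0 := by rw [h7, h]; simp
  · calc Q = 7 • Q - 2 • (3 • Q) := by abel
      _ = 0 := by rw [h7, h]; simp
  · calc Q = 2 • (4 • Q) - 7 • Q := by abel
      _ = 0 := by rw [h7, h]; simp

theorem alg7 {F : Type*} [Field F] {a1 a2 a3 a4 a6 x1 y1 x2 y2 x3 y3 l m n : F}
    (hc : y1^2+a1*x1*y1+a3*y1 = x1^3+a2*x1^2+a4*x1+a6)
    (l1 : l * (2*y1+a1*x1+a3) = 3*x1^2+2*a2*x1+a4-a1*y1) (hA3 : 2*y1+a1*x1+a3 ≠ 0)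
    (l2 : x2 = l^2 + a1*l - a2 - x1 - x1) (l3 : y2 = -(l*(x2-x1)+y1)-a1*x2-a3)
    (p1 : m * (x2 - x1) = y2 - y1) (p2 : x3 = m^2 + a1*m - a2 - x1 - x2) (p3 : y3 = -(m*(x3-x1)+y1)-a1*x3-a3)
    (q1 : n * (x3 - x1) = y3 - y1) (q2 : x3 = n^2 + a1*n - a2 - x1 - x3) (k2 : x1 ≠ x2) (k3 : x1 ≠ x3) :
    ∃ d u, d ≠ 0 ∧ d ≠ 1 ∧ u ≠ 0 ∧ x2 - x1 = u * (d^3-d^2) ∧ x3 - x1 = u * (d^2-d) ∧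
     ∀ X, 3*(x1 + u * X)^4 + (a1^2+4*a2)*(x1 + u * X)^3 + 3*(2*a4+a1*a3)*(x1 + u * X)^2 + 3*(a3^2+4*a6)*(x1 + u * X)
        + (a1^2*a6+4*a2*a6-a1*a3*a4+a2*a3^2-a4^2) = 0 →
      3*X^4+((1+d-d^2)^2+4*(d^2-d^3))*X^3+3*((1+d-d^2)*(d^2-d^3))*X^2+3*(d^2-d^3)^2*X+(d^2-d^3)^3=0 := by
  obtain ⟨A1, hA1⟩ : ∃ A, A = a1+2*l := ⟨_, rfl⟩
  obtain ⟨A2, hA2⟩ : ∃ A, A = a2-l*a1+3*x1-l^2 := ⟨_, rfl⟩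
  obtain ⟨A3, hA3'⟩ : ∃ A, A = 2*y1+a1*x1+a3 := ⟨_, rfl⟩
  rw [← hA3'] at hA3
  have hx2 : x2 - x1 = -A2 := by rw [hA2]; linear_combination l2
  have hA20 : A2 ≠ 0 := by
    rintro rfl; exact k2 (by linear_combination -hx2)
  have hy2 : y2 - y1 = l * (x2-x1) + A1*A2-A3 := by
    linear_combination l3 + hA3' + (x2 - x1) * hA1 - A1 * hx2
  obtain ⟨u, hu⟩ : ∃ u, u * A2 = A3 := ⟨_, div_mul_cancel₀ _ hA20⟩
  have hu0 : u ≠ 0 := by rintro rfl; exact hA3 (by rw [← hu, zero_mul])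
  have hm : m = l - A1 + u := by
    apply mul_right_cancel₀ hA20
    linear_combination -p1 - hy2 + (m - l) * hx2 - hu
  have hx3 : x3 - x1 = u*(u-A1) := by
    rw [hm, hA1] at p2
    rw [hA1]
    linear_combination p2 + hA2 - hx2
  obtain ⟨c, hcc⟩ : ∃ c, u * (1 - c) = A1 := ⟨1 - A1 / u, by field_simp; ring⟩
  obtain ⟨b, hb⟩ : ∃ b, b * u^2 = -A2 := ⟨-A2 / u^2, by field_simp⟩
  have hx3' : x3 - x1 = u^2*c := by rw [hx3, ← hcc]; ring
  have hc0 : c ≠ 0 := by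
    rintro rfl; exact k3 (by linear_combination -hx3')
  have hb0 : b ≠ 0 := by
    rintro rfl; exact hA20 (by linear_combination hb)
  have hy3 : y3 - y1 = l*(x3-x1) - u^3*c + b*u^3 := by
    rw [hm] at p3
    linear_combination p3 + hA3' + (x3-x1)*hA1 - u*hx3' + hu - u * hb
  have hn : (n - l)*c = u*(b-c) := by
    apply mul_left_cancel₀ (pow_ne_zero 2 hu0)
    linear_combination q1 + hy3 - (n - l) * hx3'
  have hq : 2*(u^2*c) = (n-l)^2+A1*(n-l)-A2 := by
    rw [hA1]
    linear_combination q2 - 2 * hx3' + hA2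
  have hrel : c^3 = b^2-b*c := by
    apply mul_left_cancel₀ (pow_ne_zero 2 hu0)
    linear_combination c^2 * hq + ((n-l)*c + u*(b-c) + A1*c)*hn - c*u*(b-c)*hcc - c^2*hb
  obtain ⟨d, hd⟩ : ∃ d, d * c = b := ⟨_, div_mul_cancel₀ _ hc0⟩
  have hcd : c = d^2-d := by
    apply mul_left_cancel₀ (pow_ne_zero 2 hc0)
    rw [← hd] at hrel
    linear_combination hrel
  have hbd : b = d^3-d^2 := by rw [← hd, hcd]; ring
  refine ⟨d, u^2, ?_, ?_, pow_ne_zero 2 hu0, ?_, ?_, ?_⟩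
  · rintro rfl; exact hb0 (by rw [← hd, zero_mul])
  · rintro rfl; exact hc0 (by rw [hcd]; ring)
  · rw [← hbd, hx2]; linear_combination -hb
  · rw [← hcd, hx3']
  · intro X hX
    have h4 : a4 - l*a3 + 2*x1*a2 - (y1+x1*l)*a1 + 3*x1^2 - 2*l*y1 = 0 := by linear_combination -l1
    have h6 : a6+x1*a4+x1^2*a2+x1^3-y1*a3-y1^2-x1*y1*a1 = 0 := by linear_combination -hc
    have B2 : a1^2+4*a2+12*x1 = A1^2+4*A2 := by rw [hA1, hA2]; ring
    have B4 : (2*a4+a1*a3)+x1*(a1^2+4*a2)+6*x1^2 = A1*A3 := by rw [hA1, hA3']; linear_combination 2*h4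
    have B6 : (a3^2+4*a6)+2*x1*(2*a4+a1*a3)+x1^2*(a1^2+4*a2)+4*x1^3 = A3^2 := by rw [hA3']; linear_combination 4*h6
    have B8 : (a1^2*a6+4*a2*a6-a1*a3*a4+a2*a3^2-a4^2)+3*x1*(a3^2+4*a6)+3*x1^2*(2*a4+a1*a3)+x1^3*(a1^2+4*a2)+3*x1^4 = A2*A3^2 := by
      rw [hA2, hA3']
      linear_combination ((a1+2*l)^2+4*(a2-l*a1+3*x1-l^2))*h6 - ((a1+2*l)*(2*y1+a1*x1+a3) + (a4 - l*a3 + 2*x1*a2 - (y1+x1*l)*a1 + 3*x1^2 - 2*l*y1))*h4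
    have hA2' : A2 = -b*u^2 := by linear_combination hb
    have hA3'' : A3 = -b*u^3 := by rw [← hu, hA2']; ring
    rw [← hcc, hA2'] at B2
    rw [← hcc, hA3''] at B4
    rw [hA3''] at B6
    rw [hA2', hA3''] at B8
    rw [show 1+d-d^2 = 1-c by rw [hcd]; ring, show d^2-d^3 = -b by rw [hbd]; ring]
    apply mul_left_cancel₀ (pow_ne_zero 8 hu0)
    linear_combination hX - (u^2*X)^3*B2 - 3*(u^2*X)^2*B4 - 3*(u^2*X)*B6 - B8

theorem lem7 (Q : W.Point) (hQ : Q ≠ 0) (h7 : 7 • Q = 0) :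
    ∃ d u, d ≠ 0 ∧ d ≠ 1 ∧ u ≠ 0 ∧ xc (Q + Q) - xc Q = u * (d^3-d^2) ∧ xc (Q + (Q + Q)) - xc Q = u * (d^2-d) ∧
     ∀ X, 3*(xc Q + u * X)^4 + W.b₂*(xc Q + u * X)^3 + 3*W.b₄*(xc Q + u * X)^2 + 3*W.b₆*(xc Q + u * X) + W.b₈ = 0 →
      3*X^4+((1+d-d^2)^2+4*(d^2-d^3))*X^3+3*((1+d-d^2)*(d^2-d^3))*X^2+3*(d^2-d^3)^2*X+(d^2-d^3)^3=0 := by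
  obtain ⟨n2, n3, n4⟩ := ord7 hQ h7
  have m2 : Q + Q ≠ 0 := by intro h; apply n2; rw [← h]; abel
  have m3 : Q + (Q + Q) ≠ 0 := by intro h; apply n3; rw [← h]; abel
  have m4 : Q + (Q + (Q + Q)) ≠ 0 := by intro h; apply n4; rw [← h]; abel
  have k2 : xc Q ≠ xc (Q + Q) := by
    intro h
    rcases xc_eq hQ m2 h with h | h
    · exact hQ (by simpa using h)
    · apply m3
      rw [eq_neg_iff_add_eq_zero] at h
      exact h
  have k3 : xc Q ≠ xc (Q + (Q + Q)) := by
    intro h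
    rcases xc_eq hQ m3 h with h | h
    · exact m2 (by simpa using h)
    · apply m4
      rw [eq_neg_iff_add_eq_zero] at h
      exact h
  have k4 : xc (Q + (Q + (Q + Q))) = xc (Q + (Q + Q)) := by
    rw [← xc_neg (Q + (Q + Q))]
    congr 1
    rw [eq_neg_iff_add_eq_zero, ← h7]; abel
  obtain ⟨x1, y1, h1, rfl⟩ := ex_some hQ
  obtain ⟨x2, y2, h2, e2⟩ := ex_some m2
  rw [e2] at m3 m4 k2 k3 k4 ⊢
  obtain ⟨x3, y3, h3, e3⟩ := ex_some m3
  rw [e3] at m4 k3 k4 ⊢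
  obtain ⟨x4, y4, h4, e4⟩ := ex_some m4
  rw [e4] at k4
  simp only [xc_some] at k2 k3 k4 ⊢
  obtain ⟨l, l1, hA3, l2, l3⟩ := add_dbl e2
  obtain ⟨m, p1, p2, p3⟩ := add_ne k2 e3
  obtain ⟨n, q1, q2, -⟩ := add_ne k3 e4
  have hc := (W.equation_iff x1 y1).1 h1.1
  simp only [WeierstrassCurve.b₂, WeierstrassCurve.b₄, WeierstrassCurve.b₆, WeierstrassCurve.b₈]
  generalize W.a₁ = a1 at *
  generalize W.a₂ = a2 at *
  generalize W.a₃ = a3 at *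
  generalize W.a₄ = a4 at *
  generalize W.a₆ = a6 at *
  rw [k4] at q2
  clear k4 e2 e3 e4 m2 m3 m4 h2 h3 h4 n2 n3 n4 h7 hQ h1
  exact alg7 hc l1 hA3 l2 l3 p1 p2 p3 q1 q2 k2 k3
end

end S16

namespace S16

open scoped Classical in
theorem final {K : Type*} [Field K] [Algebra ℚ K] [IsCyclotomicExtension {4} ℚ K]
    (W : WeierstrassCurve K) {L : Type*} [Field L] [Algebra K L] (hL : Module.finrank K L = 2)
    (P7 P3 : WeierstrassCurve.Affine.Point (W.baseChange L)) (h7 : 7 • P7 = 0) (h7' : P7 ≠ 0)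
    (h3 : 3 • P3 = 0) (h3' : P3 ≠ 0) : False := by
  haveI : CharZero K := algebraRat.charZero K
  haveI : Algebra.IsQuadraticExtension K L := ⟨hL⟩
  haveI : FiniteDimensional K L := Module.finite_of_finrank_pos (by rw [hL]; norm_num)
  haveI : IsGalois K L := inferInstance
  have hcard : Nat.card (L ≃ₐ[K] L) = 2 := by rw [IsGalois.card_aut_eq_finrank, hL]
  obtain ⟨τ, hτ, hτu⟩ := (Nat.card_eq_two_iff' (1 : L ≃ₐ[K] L)).1 hcard
  have hττ : τ * τ = 1 := by
    by_contra h
    have := hτu _ h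
    exact hτ (mul_eq_left.1 this)
  have fixed : ∀ x : L, τ x = x → ∃ y : K, algebraMap K L y = x := by
    intro x hx
    refine (IsGalois.mem_range_algebraMap_iff_fixed x).2 ?_
    intro σ
    by_cases h : σ = 1
    · rw [h]; rfl
    · rw [hτu σ h]; exact hx
  set T : WeierstrassCurve.Affine.Point (W.baseChange L) →+ WeierstrassCurve.Affine.Point (W.baseChange L) :=
    Point.map (W' := W) (τ : L →ₐ[K] L) with hT
  have hTx : ∀ P, xc (T P) = τ (xc P) := by
    intro P
    rcases P with _ | ⟨x, y, h⟩
    · exact (map_zero τ).symm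
    · rfl
  have hTT : ∀ P, T (T P) = P := by
    intro P
    rw [hT, Point.map_map]
    rcases P with _ | ⟨x, y, h⟩
    · rfl
    · rw [Point.map_some]
      have h1 : ∀ z : L, ((τ : L →ₐ[K] L).comp (τ : L →ₐ[K] L)) z = z := fun z => DFunLike.congr_fun hττ z
      simp only [Point.some.injEq]
      exact ⟨h1 x, h1 y⟩
  have exQ : ∀ (p : ℕ) (P : WeierstrassCurve.Affine.Point (W.baseChange L)), p • P = 0 → P ≠ 0 →
      ∃ Q, p • Q = 0 ∧ Q ≠ 0 ∧ (T Q = Q ∨ T Q = -Q) := by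
    intro p P hp hP
    by_cases h : P + T P = 0
    · exact ⟨P, hp, hP, Or.inr (eq_neg_of_add_eq_zero_right h)⟩
    · refine ⟨P + T P, ?_, h, Or.inl ?_⟩
      · rw [smul_add, ← map_nsmul, hp, map_zero, add_zero]
      · rw [map_add, hTT, add_comm]
  obtain ⟨Q, q7, q0, hQ⟩ := exQ 7 P7 h7 h7'
  obtain ⟨R, r3, r0, hR⟩ := exQ 3 P3 h3 h3'
  have hxR : τ (xc R) = xc R := by
    rw [← hTx]
    rcases hR with h | h
    · rw [h]
    · rw [h, xc_neg]
  have hxQ : τ (xc Q) = xc Q ∧ τ (xc (Q + Q)) = xc (Q + Q) ∧ τ (xc (Q + (Q + Q))) = xc (Q + (Q + Q)) := by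
    simp only [← hTx, map_add]
    rcases hQ with h | h
    · rw [h]; exact ⟨rfl, rfl, rfl⟩
    · rw [h, ← neg_add, ← neg_add, xc_neg, xc_neg, xc_neg]; exact ⟨rfl, rfl, rfl⟩
  obtain ⟨f1, f2, f3⟩ := hxQ
  obtain ⟨d, u, d0, d1, u0, e2, e3, hpsi⟩ := lem7 Q q0 q7
  have hD : d^2 - d ≠ 0 := by
    rw [show d^2-d = d*(d-1) by ring]; exact mul_ne_zero d0 (sub_ne_zero.2 d1)
  have hd : d = (xc (Q + Q) - xc Q) / (xc (Q + (Q + Q)) - xc Q) := by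
    rw [eq_div_iff (by rw [e3]; exact mul_ne_zero u0 hD), e2, e3]; ring
  have fd : τ d = d := by
    rw [hd]; simp only [map_div₀, map_sub, f1, f2, f3]
  have hu : u = (xc (Q + (Q + Q)) - xc Q) / (d^2-d) := by
    rw [eq_div_iff hD, e3]
  have fu : τ u = u := by
    rw [hu]; simp only [map_div₀, map_sub, map_pow, f1, f3, fd]
  have hX := hpsi ((xc R - xc Q) / u) (by
    rw [mul_div_cancel₀ _ u0, add_sub_cancel]
    exact lem3 R r0 r3)
  have fX : τ ((xc R - xc Q) / u) = (xc R - xc Q) / u := by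
    simp only [map_div₀, map_sub, f1, hxR, fu]
  obtain ⟨d', hd'⟩ := fixed d fd
  obtain ⟨X', hX'⟩ := fixed _ fX
  obtain ⟨φ, hi, hf⟩ := ex_phi K
  rw [← hX', ← hd'] at hX
  refine part1 φ hi hf d' X' ?_ ?_ two_ne_zero three_ne_zero ?_
  · rintro rfl; exact d0 (by rw [← hd', map_zero])
  · rintro rfl; exact d1 (by rw [← hd', map_one])
  · apply (algebraMap K L).injective
    rw [map_zero, ← hX]
    simp only [map_add, map_sub, map_mul, map_pow, map_one, map_ofNat]

end S16

open scoped Classical in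
/-- Let `K = ℚ(i)` (the 4th cyclotomic field) and `E` any elliptic curve over
`K`. Then for every quadratic extension `L` of `K`, the group `E(L)` has no subgroup of
order `21`. -/
theorem stmt16 {K : Type*} [Field K] [Algebra ℚ K] [IsCyclotomicExtension {4} ℚ K]
    (W : WeierstrassCurve K) (hW : W.Δ ≠ 0)
    {L : Type*} [Field L] [Algebra K L] (hL : Module.finrank K L = 2) :
    ¬ ∃ H : AddSubgroup (WeierstrassCurve.Affine.Point (W.baseChange L)), Nat.card H = 21 := by
  rintro ⟨H, hH⟩
  haveI : Finite H := Nat.finite_of_card_ne_zero (by rw [hH]; norm_num)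
  have ex : ∀ p : ℕ, p.Prime → p ∣ 21 → ∃ P : WeierstrassCurve.Affine.Point (W.baseChange L), p • P = 0 ∧ P ≠ 0 := by
    intro p hp hd
    haveI := Fact.mk hp
    haveI := Fintype.ofFinite H
    obtain ⟨x, hx⟩ := exists_prime_addOrderOf_dvd_card (G := H) p (by rw [← Nat.card_eq_fintype_card, hH]; exact hd)
    refine ⟨x, ?_, ?_⟩
    · rw [← AddSubgroup.coe_nsmul, ← hx, addOrderOf_nsmul_eq_zero]; rfl
    · intro h
      have : x = 0 := Subtype.ext h
      rw [this, addOrderOf_zero] at hx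
      exact hp.one_lt.ne hx
  obtain ⟨P7, h7, h7'⟩ := ex 7 (by norm_num) (by norm_num)
  obtain ⟨P3, h3, h3'⟩ := ex 3 (by norm_num) (by norm_num)
  exact S16.final W hL P7 P3 h7 h7' h3 h3'
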